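/- arXiv:1902.01351 — 14 statements merged into one kernel-verified Lean document; each statement's English description precedes it below -/
import Mathlib

section
/- If u, v, w are complex numbers with |u| = |v| = |w| = 1 and u + v + w = 1, then at least one of u, v, w is equal to 1. -/
/-- If `u`, `v`, `w` are complex numbers of modulus 1 with `u + v + w = 1`,
then at least one of them equals 1. -/
theorem stmt0 (u v w : ℂ) (hu : ‖u‖ = 1) (hv : ‖v‖ = 1)
    (hw : ‖w‖ = 1) (h : u + v + w = 1) :
    u = 1 ∨ v = 1 ∨ w = 1 := by
  have key : ∀ z : ℂ, ‖z‖ = 1 → z * (starRingEnd ℂ) z = 1 := by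
    intro z hz
    rw [Complex.mul_conj, Complex.normSq_eq_norm_sq, hz]
    norm_num
  have a := key u hu
  have b := key v hv
  have c := key w hw
  have d := congrArg (starRingEnd ℂ) h
  simp only [map_add, map_one] at d
  have e : (u - 1) * ((v - 1) * (w - 1)) = 0 := by
    linear_combination h + v * w * a + u * w * b + u * v * c - u * v * w * d
  rcases mul_eq_zero.mp e with h1 | h1
  · exact Or.inl (sub_eq_zero.mp h1)
  · rcases mul_eq_zero.mp h1 with h2 | h2
    · exact Or.inr (Or.inl (sub_eq_zero.mp h2))
    · exact Or.inr (Or.inr (sub_eq_zero.mp h2))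
end

section
/- Let ℓ_1, …, ℓ_{n+1} be nonzero linear forms on ℂ^n that are pairwise non-proportional and span the dual space (ℂ^n)^* (i.e., the corresponding central hyperplane arrangement of the n+1 hyperplanes H_i = ker ℓ_i is essential and consists of n+1 distinct hyperplanes). Then there is a unique integer k with 2 ≤ k ≤ n such that the arrangement is linearly equivalent to the arrangement C_k : x_1 ⋯ x_n (x_1 + ⋯ + x_k) = 0; that is, there exists a linear automorphism T of ℂ^n with {T(H_1), …, T(H_{n+1})} = {{x_1 = 0}, …, {x_n = 0}, {x_1 + ⋯ + x_k = 0}}. -/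
lemma aux_prop {V : Type*} [AddCommGroup V] [Module ℂ V] (l m : V →ₗ[ℂ] ℂ) (hl : l ≠ 0)
    (h : ∀ x, l x = 0 ↔ m x = 0) : ∃ a : ℂ, a ≠ 0 ∧ m = a • l := by
  obtain ⟨v, hv⟩ : ∃ v, l v ≠ 0 := by
    by_contra! hc
    exact hl (LinearMap.ext hc)
  have hmv : m v ≠ 0 := fun h0 => hv ((h v).2 h0)
  refine ⟨m v / l v, div_ne_zero hmv hv, ?_⟩
  ext x
  have h1 : l (x - (l x / l v) • v) = 0 := by
    simp [hv]
  have h2 := (h _).1 h1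
  simp only [map_sub, map_smul, smul_eq_mul] at h2
  simp only [LinearMap.smul_apply, smul_eq_mul]
  rw [sub_eq_zero] at h2
  rw [h2]; ring

lemma aux_card (n k : ℕ) (hk : k ≤ n) :
    Fintype.card {j : Fin (n + 1) // (j : ℕ) < k + 1} = k + 1 := by
  rw [Fintype.card_subtype, Fin.card_filter_val_lt]
  omega

lemma aux_exists (n : ℕ) (ℓ : Fin (n + 1) → ((Fin n → ℂ) →ₗ[ℂ] ℂ))
    (hspan : Submodule.span ℂ (Set.range ℓ) = ⊤) (c : Fin (n + 1) → ℂ)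
    (hc : ∑ i, c i • ℓ i = 0) (k : ℕ) (hk : k ≤ n)
    (hcard : Fintype.card {i // c i ≠ 0} = k + 1) :
    ∃ T : (Fin n → ℂ) ≃ₗ[ℂ] (Fin n → ℂ),
        (fun H : Set (Fin n → ℂ) => T '' H) '' (Set.range fun i => {x | ℓ i x = 0}) =
          insert {x : Fin n → ℂ | (∑ i : Fin n, if (i : ℕ) < k then x i else 0) = 0}
            (Set.range fun i : Fin n => {x : Fin n → ℂ | x i = 0}) := by
  classical
  let e : {j : Fin (n + 1) // (j : ℕ) < k + 1} ≃ {i // c i ≠ 0} :=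
    Fintype.equivOfCardEq ((aux_card n k hk).trans hcard.symm)
  let σ : Equiv.Perm (Fin (n + 1)) := e.extendSubtype
  have hσ1 : ∀ j : Fin (n + 1), (j : ℕ) < k + 1 → c (σ j) ≠ 0 :=
    fun j hj => e.extendSubtype_mem j hj
  have hσ2 : ∀ j : Fin (n + 1), ¬ (j : ℕ) < k + 1 → c (σ j) = 0 :=
    fun j hj => not_not.1 (e.extendSubtype_not_mem j hj)
  let a : Fin n → ℂ := fun j => if (j : ℕ) < k then - c (σ j.succ) else 1
  have ha : ∀ j, a j ≠ 0 := by
    intro j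
    by_cases hj : (j : ℕ) < k
    · simp only [a, hj, if_true]
      exact neg_ne_zero.2 (hσ1 _ (by simpa using hj))
    · simp [a, hj]
  have h0 : c (σ 0) ≠ 0 := hσ1 0 (by simp)
  have hrel : ∀ x, c (σ 0) * ℓ (σ 0) x =
      ∑ j : Fin n, if (j : ℕ) < k then a j * ℓ (σ j.succ) x else 0 := by
    intro x
    have h1 := congrArg (fun f => f x) hc
    simp only [LinearMap.sum_apply, LinearMap.smul_apply, smul_eq_mul, LinearMap.zero_apply] at h1
    rw [← Equiv.sum_comp σ, Fin.sum_univ_succ] at h1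
    rw [eq_neg_of_add_eq_zero_left h1, ← Finset.sum_neg_distrib]
    refine Finset.sum_congr rfl fun j _ => ?_
    by_cases hj : (j : ℕ) < k
    · simp [a, hj]
    · have := hσ2 j.succ (by simpa using hj)
      simp [hj, this]
  let T0 : (Fin n → ℂ) →ₗ[ℂ] (Fin n → ℂ) := LinearMap.pi fun j => a j • ℓ (σ j.succ)
  have hT0 : ∀ x j, T0 x j = a j * ℓ (σ j.succ) x := fun x j => rfl
  have hinj : Function.Injective T0 := by
    rw [injective_iff_map_eq_zero]
    intro x hx
    have h1 : ∀ j : Fin n, ℓ (σ j.succ) x = 0 := by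
      intro j
      have := congrFun hx j
      rw [hT0] at this
      simpa [ha j] using this
    have h2 : ℓ (σ 0) x = 0 := by
      have := hrel x
      simpa [h1, h0] using this
    have h3 : ∀ i, ℓ i x = 0 := by
      intro i
      obtain ⟨j, rfl⟩ := σ.surjective i
      refine Fin.cases h2 h1 j
    have h4 : ∀ f : (Fin n → ℂ) →ₗ[ℂ] ℂ, f x = 0 := by
      intro f
      have hf : f ∈ Submodule.span ℂ (Set.range ℓ) := by rw [hspan]; trivial
      induction hf using Submodule.span_induction with
      | mem y hy => obtain ⟨i, rfl⟩ := hy; exact h3 i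
      | zero => rfl
      | add y z _ _ hy hz => simp [hy, hz]
      | smul r y _ hy => simp [hy]
    ext j
    exact h4 (LinearMap.proj j)
  let T := LinearEquiv.ofInjectiveEndo T0 hinj
  have hT : ∀ x j, T x j = a j * ℓ (σ j.succ) x := fun x j => rfl
  have himg : ∀ (P Q : (Fin n → ℂ) → Prop), (∀ x, P x ↔ Q (T x)) →
      T '' {x | P x} = {x | Q x} := by
    intro P Q h
    ext y
    constructor
    · rintro ⟨x, hx, rfl⟩
      exact (h x).1 hx
    · intro hy
      exact ⟨T.symm y, (h _).2 (by simpa using hy), by simp⟩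
  have e0 : T '' {x | ℓ (σ 0) x = 0} =
      {x : Fin n → ℂ | (∑ i : Fin n, if (i : ℕ) < k then x i else 0) = 0} := by
    apply himg
    intro x
    simp only [hT]
    rw [← hrel x]
    simp [h0]
  have e1 : ∀ j : Fin n, T '' {x | ℓ (σ j.succ) x = 0} = {x : Fin n → ℂ | x j = 0} := by
    intro j
    apply himg
    intro x
    rw [hT]
    simp [ha j]
  refine ⟨T, ?_⟩
  ext H
  constructor
  · rintro ⟨_, ⟨i, rfl⟩, rfl⟩
    obtain ⟨j, rfl⟩ := σ.surjective i
    refine Fin.cases ?_ ?_ j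
    · exact Or.inl e0
    · intro j
      exact Or.inr ⟨j, (e1 j).symm⟩
  · rintro (rfl | ⟨j, rfl⟩)
    · exact ⟨_, ⟨σ 0, rfl⟩, e0⟩
    · exact ⟨_, ⟨σ j.succ, rfl⟩, e1 j⟩

lemma aux_unique (n : ℕ) (ℓ : Fin (n + 1) → ((Fin n → ℂ) →ₗ[ℂ] ℂ))
    (hne : ∀ i, ℓ i ≠ 0)
    (hprop : ∀ i j, i ≠ j → ∀ c : ℂ, ℓ i ≠ c • ℓ j) (c : Fin (n + 1) → ℂ)
    (hc : ∑ i, c i • ℓ i = 0) (hc0 : ∃ i, c i ≠ 0) (k : ℕ) (hk : k ≤ n)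
    (T : (Fin n → ℂ) ≃ₗ[ℂ] (Fin n → ℂ))
    (hT : (fun H : Set (Fin n → ℂ) => T '' H) '' (Set.range fun i => {x | ℓ i x = 0}) =
          insert {x : Fin n → ℂ | (∑ i : Fin n, if (i : ℕ) < k then x i else 0) = 0}
            (Set.range fun i : Fin n => {x : Fin n → ℂ | x i = 0})) :
    Fintype.card {i // c i ≠ 0} = k + 1 := by
  classical
  let m : Fin (n + 1) → ((Fin n → ℂ) →ₗ[ℂ] ℂ) :=
    Fin.cons (∑ i : Fin n, if (i : ℕ) < k then LinearMap.proj i else 0)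
      (fun j => LinearMap.proj j)
  have hm0 : ∀ x, m 0 x = ∑ i : Fin n, if (i : ℕ) < k then x i else 0 := by
    intro x
    simp only [m, Fin.cons_zero, LinearMap.sum_apply]
    refine Finset.sum_congr rfl fun j _ => ?_
    split_ifs <;> rfl
  have hm1 : ∀ j x, m (Fin.succ j) x = x j := fun j x => rfl
  have hf : ∀ i, ∃ j, ∀ x, ℓ i x = 0 ↔ m j (T x) = 0 := by
    intro i
    have h1 : T '' {x | ℓ i x = 0} ∈ (fun H : Set (Fin n → ℂ) => T '' H) ''
      (Set.range fun i => {x | ℓ i x = 0}) := ⟨_, ⟨i, rfl⟩, rfl⟩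
    rw [hT] at h1
    have key : ∀ j, T '' {x | ℓ i x = 0} = {x | m j x = 0} →
        ∀ x, ℓ i x = 0 ↔ m j (T x) = 0 := by
      intro j h x
      have : T x ∈ T '' {x | ℓ i x = 0} ↔ T x ∈ {x | m j x = 0} := by rw [h]
      rw [T.injective.mem_set_image] at this
      exact this
    rcases h1 with h1 | ⟨j, h1⟩
    · refine ⟨0, key 0 ?_⟩
      rw [h1]; simp only [hm0]
    · exact ⟨j.succ, key _ h1.symm⟩
  choose f hf using hf
  have hinj : Function.Injective f := by
    intro i j hij
    by_contra hne'
    obtain ⟨a, -, ha⟩ := aux_prop (ℓ j) (ℓ i) (hne j) (fun x => by rw [hf j, hf i, hij])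
    exact hprop i j hne' a ha
  let F : Fin (n + 1) ≃ Fin (n + 1) := Equiv.ofBijective f (Finite.injective_iff_bijective.1 hinj)
  have hF : ∀ i, F i = f i := fun i => rfl
  have ha : ∀ i, ∃ a : ℂ, a ≠ 0 ∧ m (f i) ∘ₗ T.toLinearMap = a • ℓ i := fun i =>
    aux_prop _ _ (hne i) (hf i)
  choose a ha0 ha using ha
  let d : Fin (n + 1) → ℂ := fun j => c (F.symm j) / a (F.symm j)
  have hdf : ∀ i, d (F i) = c i / a i := fun i => by simp [d]
  have hd : ∀ y, ∑ j, d j * m j y = 0 := by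
    intro y
    obtain ⟨x, rfl⟩ := T.surjective y
    rw [← Equiv.sum_comp F]
    have h1 := congrArg (fun f => f x) hc
    simp only [LinearMap.sum_apply, LinearMap.smul_apply, smul_eq_mul, LinearMap.zero_apply] at h1
    rw [← h1]
    refine Finset.sum_congr rfl fun i _ => ?_
    have h2 : m (f i) (T x) = a i * ℓ i x := congrArg (fun f => f x) (ha i)
    rw [hdf, hF, h2]
    have := ha0 i
    field_simp
  have hds : ∀ j : Fin n, d j.succ = if (j : ℕ) < k then - d 0 else 0 := by
    intro j
    have h1 := hd (Pi.single j 1)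
    rw [Fin.sum_univ_succ] at h1
    simp only [hm0, hm1] at h1
    have h2 : (∑ i : Fin n, if (i : ℕ) < k then (Pi.single j (1 : ℂ) : Fin n → ℂ) i else 0)
        = if (j : ℕ) < k then 1 else 0 := by
      rw [Finset.sum_eq_single j]
      · simp
      · intro b _ hb
        simp [hb]
      · simp
    have h3 : (∑ i : Fin n, d i.succ * (Pi.single j (1 : ℂ) : Fin n → ℂ) i) = d j.succ := by
      rw [Finset.sum_eq_single j]
      · simp
      · intro b _ hb
        simp [hb]
      · simp
    rw [h2, h3] at h1
    split_ifs at h1 ⊢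
    · linear_combination h1
    · linear_combination h1
  have hci : ∀ i, c i ≠ 0 ↔ d (F i) ≠ 0 := by
    intro i
    rw [hdf]
    simp [ha0 i]
  have hd0 : d 0 ≠ 0 := by
    intro h0
    obtain ⟨i, hi⟩ := hc0
    rw [hci] at hi
    apply hi
    generalize F i = j
    refine Fin.cases h0 ?_ j
    intro j
    rw [hds, h0]; simp
  have hdj : ∀ j : Fin (n + 1), d j ≠ 0 ↔ (j : ℕ) < k + 1 := by
    intro j
    refine Fin.cases ?_ ?_ j
    · simp [hd0]
    · intro j
      rw [hds]
      by_cases hj : (j : ℕ) < k <;> simp [hj, hd0]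
  rw [← aux_card n k hk]
  exact Fintype.card_congr (F.subtypeEquiv fun i => (hci i).trans (hdj _))

/-- Let `ℓ 1, …, ℓ (n+1)` be nonzero linear forms on `ℂ^n`, pairwise non-proportional
(so the hyperplanes `ker (ℓ i)` are distinct) and spanning the dual space (the arrangement
is essential).  Then there is a unique `k` with `2 ≤ k ≤ n` such that the arrangement of
the `n+1` hyperplanes `{ℓ i = 0}` is carried by a linear automorphism `T` of `ℂ^n` onto
the arrangement `x_1 ⋯ x_n (x_1 + ⋯ + x_k) = 0`. -/
theorem stmt1 (n : ℕ) (ℓ : Fin (n + 1) → ((Fin n → ℂ) →ₗ[ℂ] ℂ))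
    (hne : ∀ i, ℓ i ≠ 0)
    (hprop : ∀ i j, i ≠ j → ∀ c : ℂ, ℓ i ≠ c • ℓ j)
    (hspan : Submodule.span ℂ (Set.range ℓ) = ⊤) :
    ∃! k : ℕ, 2 ≤ k ∧ k ≤ n ∧
      ∃ T : (Fin n → ℂ) ≃ₗ[ℂ] (Fin n → ℂ),
        (fun H : Set (Fin n → ℂ) => T '' H) '' (Set.range fun i => {x | ℓ i x = 0}) =
          insert {x : Fin n → ℂ | (∑ i : Fin n, if (i : ℕ) < k then x i else 0) = 0}
            (Set.range fun i : Fin n => {x : Fin n → ℂ | x i = 0}) := by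
  classical
  obtain ⟨c, hc, hc0⟩ : ∃ c : Fin (n + 1) → ℂ, ∑ i, c i • ℓ i = 0 ∧ ∃ i, c i ≠ 0 := by
    apply Fintype.not_linearIndependent_iff.1
    intro h
    have h1 := h.fintype_card_le_finrank
    have h2 : Module.finrank ℂ ((Fin n → ℂ) →ₗ[ℂ] ℂ) = n := by
      simp [Module.finrank_linearMap]
    rw [h2] at h1
    simp at h1
  have hlow : 3 ≤ Fintype.card {i // c i ≠ 0} := by
    obtain ⟨i, hi⟩ := hc0
    rw [Fintype.card_subtype]
    by_contra! hlt
    have hmem : i ∈ Finset.univ.filter (fun i => c i ≠ 0) := by simp [hi]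
    have hlt2 : ((Finset.univ.filter (fun i => c i ≠ 0)).erase i).card ≤ 1 := by
      rw [Finset.card_erase_of_mem hmem]; omega
    rw [← Finset.add_sum_erase _ _ (Finset.mem_univ i)] at hc
    by_cases h : ∃ j, j ≠ i ∧ c j ≠ 0
    · obtain ⟨j, hji, hj⟩ := h
      rw [Finset.sum_eq_single j] at hc
      · apply hprop i j hji.symm (-(c j / c i))
        have h1 : ℓ i = (c i)⁻¹ • (c i • ℓ i) := by rw [smul_smul, inv_mul_cancel₀ hi, one_smul]
        rw [h1, eq_neg_of_add_eq_zero_left hc, smul_neg, smul_smul, neg_smul]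
        congr 2
        field_simp
      · intro b hb hbj
        by_cases hcb : c b = 0
        · simp [hcb]
        · exact absurd (Finset.card_le_one.1 hlt2 b (by simp_all) j (by simp_all)) hbj
      · intro h; simp [hji] at h
    · push Not at h
      rw [Finset.sum_eq_zero] at hc
      · rw [add_zero] at hc
        exact (smul_ne_zero hi (hne i)) hc
      · intro b hb
        rw [h b (by simpa using hb), zero_smul]
  have hup : Fintype.card {i // c i ≠ 0} ≤ n + 1 := by
    simpa using Fintype.card_subtype_le (fun i => c i ≠ 0)
  obtain ⟨k, hk⟩ : ∃ k, Fintype.card {i // c i ≠ 0} = k + 1 :=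
    ⟨Fintype.card {i // c i ≠ 0} - 1, by omega⟩
  refine ⟨k, ⟨by omega, by omega, aux_exists n ℓ hspan c hc k (by omega) (by convert hk)⟩, ?_⟩
  rintro k' ⟨-, hk', T, hT⟩
  have h1 := aux_unique n ℓ hne hprop c hc hc0 k' hk' T hT
  have h2 : k' + 1 = k + 1 := by rw [← h1, ← hk]
  omega
end

section
/- Let f ∈ ℂ[x_1,…,x_n]_d with n ≥ 3 and d ≥ 3 be a homogeneous polynomial defining a reduced hypersurface (f is squarefree), essentially involving all n variables, and having Waring rank n+1. Then there is a unique integer k with 2 ≤ k ≤ n such that, after a suitable linear change of coordinates, f = x_1^d + ⋯ + x_n^d + (a_1x_1 + ⋯ + a_kx_k)^d for some nonzero complex numbers a_1, …, a_k. -/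
open MvPolynomial

noncomputable def linf {n : ℕ} (p : Fin n → ℂ) : MvPolynomial (Fin n) ℂ := ∑ j, C (p j) * X j

lemma linf_single {n : ℕ} (i : Fin n) : linf (Pi.single i 1) = X i := by
  classical
  unfold linf
  rw [Finset.sum_eq_single i]
  · simp
  · intro b _ hb; simp [Pi.single_eq_of_ne hb]
  · simp

lemma linf_smul {n : ℕ} (c : ℂ) (p : Fin n → ℂ) : linf (c • p) = C c * linf p := by
  simp [linf, Finset.mul_sum, mul_assoc]

lemma aeval_linf {n : ℕ} (M : Matrix (Fin n) (Fin n) ℂ) (p : Fin n → ℂ) :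
    aeval (fun i => ∑ j, C (M i j) * X j) (linf p) = linf (Matrix.vecMul p M) := by
  simp only [linf, map_sum, map_mul, aeval_X, aeval_C, Matrix.vecMul, dotProduct,
    Finset.mul_sum, Finset.sum_mul, algebraMap_eq]
  rw [Finset.sum_comm]
  simp [mul_assoc]

lemma eval_linf {n : ℕ} (p x : Fin n → ℂ) : eval x (linf p) = p ⬝ᵥ x := by
  simp [linf, dotProduct]

lemma pderiv_linf {n : ℕ} (p : Fin n → ℂ) (i : Fin n) : pderiv i (linf p) = C (p i) := by
  classical
  simp only [linf, map_sum, Derivation.leibniz, pderiv_C, pderiv_X, smul_eq_mul, mul_zero, add_zero]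
  rw [Finset.sum_eq_single i]
  · simp
  · intro b _ hb; simp [Pi.single_eq_of_ne hb.symm, hb]
  · simp

lemma hess_pow {n : ℕ} (d : ℕ) (p x : Fin n → ℂ) (i j : Fin n) :
    eval x (pderiv i (pderiv j (linf p ^ (d+2)))) =
      ((d+2:ℂ) * (d+1)) * (p i * p j * (p ⬝ᵥ x) ^ d) := by
  have h2 : pderiv i (2 : MvPolynomial (Fin n) ℂ) = 0 := by
    simpa using (pderiv (R := ℂ) i).map_natCast 2
  simp [Derivation.leibniz_pow, pderiv_linf, eval_linf, Derivation.leibniz, h2]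
  ring

lemma hess_eq {n : ℕ} (d : ℕ) (P R : Fin n → Fin n → ℂ) (q r : Fin n → ℂ)
    (h : (∑ s, linf (P s) ^ (d+2)) + linf q ^ (d+2) = (∑ s, linf (R s) ^ (d+2)) + linf r ^ (d+2))
    (x : Fin n → ℂ) (i j : Fin n) :
    (∑ s, P s i * P s j * (P s ⬝ᵥ x) ^ d) + q i * q j * (q ⬝ᵥ x) ^ d =
    (∑ s, R s i * R s j * (R s ⬝ᵥ x) ^ d) + r i * r j * (r ⬝ᵥ x) ^ d := by
  have h2 := congrArg (fun g => eval x (pderiv i (pderiv j g))) h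
  simp only [map_add, map_sum, hess_pow, ← Finset.mul_sum, ← mul_add] at h2
  refine mul_left_cancel₀ ?_ h2
  have h1 : (d+2:ℂ) ≠ 0 := by exact_mod_cast (by omega : d + 2 ≠ 0)
  have h3 : (d+1:ℂ) ≠ 0 := by exact_mod_cast (by omega : d + 1 ≠ 0)
  exact mul_ne_zero h1 h3

/-- functions constant on the first `k` indices -/
def Wk (n k : ℕ) : Submodule ℂ (Fin n → ℂ) where
  carrier := {c | ∀ i j : Fin n, (i:ℕ) < k → (j:ℕ) < k → c i = c j}
  add_mem' := by
    intro a b ha hb i j hi hj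
    simp [ha i j hi hj, hb i j hi hj]
  zero_mem' := by intro i j _ _; rfl
  smul_mem' := by
    intro c a ha i j hi hj
    simp [ha i j hi hj]

lemma Wk_lt {n k l : ℕ} (hk : 2 ≤ k) (hkl : k < l) (hl : l ≤ n) : Wk n l < Wk n k := by
  refine lt_of_le_of_ne ?_ ?_
  · intro c hc i j hi hj
    exact hc i j (by omega) (by omega)
  · intro h
    have : (Pi.single (⟨k, by omega⟩ : Fin n) (1:ℂ) : Fin n → ℂ) ∈ Wk n k := by
      intro i j hi hj
      rw [Pi.single_eq_of_ne, Pi.single_eq_of_ne]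
      · rintro rfl; simp at hj
      · rintro rfl; simp at hi
    rw [← h] at this
    have := this ⟨0, by omega⟩ ⟨k, by omega⟩ (by simp; omega) (by simpa using hkl)
    rw [Pi.single_eq_of_ne, Pi.single_eq_same] at this
    · exact zero_ne_one this
    · intro h; simp at h; omega

/-- the centre of the second form is contained in the diagonal matrices -/
lemma center_diag {n d k : ℕ} (hd : 1 ≤ d) (hk : 3 ≤ k) (hkn : k ≤ n) (a : Fin n → ℂ)
    (ha : ∀ j : Fin n, (j : ℕ) < k → a j ≠ 0)
    (A : Matrix (Fin n) (Fin n) ℂ)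
    (h : ∀ (x : Fin n → ℂ) (i j : Fin n),
      x i ^ d * A i j + a i * (Matrix.vecMul a A) j * (a ⬝ᵥ x) ^ d =
      x j ^ d * A j i + a j * (Matrix.vecMul a A) i * (a ⬝ᵥ x) ^ d) :
    (∀ i j, i ≠ j → A i j = 0) ∧ (fun i => A i i) ∈ Wk n k := by
  have hm : ∀ i j : Fin n, ∃ m : Fin n, (m:ℕ) < k ∧ m ≠ i ∧ m ≠ j := by
    intro i j
    by_contra! hc
    have h0 := hc ⟨0, by omega⟩ (by simp; omega)
    have h1 := hc ⟨1, by omega⟩ (by simp; omega)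
    have h2 := hc ⟨2, by omega⟩ (by simp; omega)
    simp only [ne_eq, Fin.ext_iff] at h0 h1 h2
    omega
  have hd0 : d ≠ 0 := by omega
  have hsym : ∀ i j, a i * (Matrix.vecMul a A) j = a j * (Matrix.vecMul a A) i := by
    intro i j
    obtain ⟨m, hmk, hmi, hmj⟩ := hm i j
    have := h (Pi.single m 1) i j
    rw [Pi.single_eq_of_ne hmi.symm, Pi.single_eq_of_ne hmj.symm] at this
    simp only [zero_pow hd0, zero_mul, zero_add, dotProduct_single, mul_one] at this
    exact mul_right_cancel₀ (pow_ne_zero _ (ha m hmk)) this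
  have hdiag : ∀ i j, i ≠ j → A i j = 0 := by
    intro i j hij
    have := h (Pi.single i 1) i j
    rw [hsym i j] at this
    have := add_right_cancel this
    rw [Pi.single_eq_same, Pi.single_eq_of_ne hij.symm] at this
    simpa [zero_pow hd0] using this
  refine ⟨hdiag, ?_⟩
  have hb : ∀ j, (Matrix.vecMul a A) j = a j * A j j := by
    intro j
    simp only [Matrix.vecMul, dotProduct]
    rw [Finset.sum_eq_single j]
    · intro b _ hb; rw [hdiag b j hb, mul_zero]
    · simp
  intro i j hi hj
  have := hsym i j
  rw [hb, hb] at this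
  have h3 : (a i * a j) * (A i i - A j j) = 0 := by linear_combination -this
  rcases mul_eq_zero.1 h3 with h4 | h4
  · exact absurd h4 (mul_ne_zero (ha i hi) (ha j hj))
  · exact sub_eq_zero.1 h4

lemma key {n d k l : ℕ} (hd : 1 ≤ d) (hk : 2 ≤ k) (hkl : k < l) (hl : l ≤ n)
    (N : Matrix (Fin n) (Fin n) ℂ) (hN : IsUnit N.det) (a b : Fin n → ℂ)
    (ha0 : ∀ j : Fin n, k ≤ (j : ℕ) → a j = 0)
    (hb : ∀ j : Fin n, (j : ℕ) < l → b j ≠ 0)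
    (h : (∑ i, linf (Pi.single i 1 : Fin n → ℂ) ^ (d+2)) + linf b ^ (d+2) =
      (∑ i, linf (N i) ^ (d+2)) + linf (Matrix.vecMul a N) ^ (d+2)) : False := by
  classical
  have hH := hess_eq d _ _ _ _ h
  set q := Matrix.vecMul a N with hq
  -- matrix for c
  have main : ∀ c ∈ Wk n k, (∀ i j, i ≠ j → (N⁻¹ * Matrix.diagonal c * N) i j = 0) ∧
      (fun i => (N⁻¹ * Matrix.diagonal c * N) i i) ∈ Wk n l := by
    intro c hc
    apply center_diag hd (by omega) hl b hb
    set A := N⁻¹ * Matrix.diagonal c * N with hA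
    have hNA : N * A = Matrix.diagonal c * N := by
      rw [hA, Matrix.mul_assoc, Matrix.mul_nonsing_inv_cancel_left _ _ hN]
    set z : Fin n := ⟨0, by omega⟩
    have hqA : Matrix.vecMul q A = c z • q := by
      rw [hq, Matrix.vecMul_vecMul, hNA, ← Matrix.vecMul_vecMul, ← Matrix.smul_vecMul]
      congr 1
      ext i
      rw [Matrix.vecMul_diagonal]
      by_cases hi : (i:ℕ) < k
      · rw [hc i z hi (by simp [z]; omega)]; simp [mul_comm]
      · rw [ha0 i (by omega)]; simp [ha0 i (by omega)]
    intro x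
    have e1 : ∀ i j, x i ^ d * A i j + b i * (Matrix.vecMul b A) j * (b ⬝ᵥ x) ^ d =
        ∑ t, ((∑ s, (Pi.single s 1 : Fin n → ℂ) i * (Pi.single s 1 : Fin n → ℂ) t *
          ((Pi.single s 1 : Fin n → ℂ) ⬝ᵥ x) ^ d) + b i * b t * (b ⬝ᵥ x) ^ d) * A t j := by
      intro i j
      simp only [add_mul, Finset.sum_add_distrib]
      congr 1
      · rw [Finset.sum_eq_single i]
        · rw [Finset.sum_eq_single i]
          · simp
          · intro s _ hs; simp [Pi.single_eq_of_ne hs.symm]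
          · simp
        · intro t _ ht
          rw [Finset.sum_eq_zero, zero_mul]
          intro s _
          by_cases hs : s = i
          · subst hs; simp [Pi.single_eq_of_ne ht]
          · simp [Pi.single_eq_of_ne (Ne.symm hs)]
        · simp
      · simp only [Matrix.vecMul, dotProduct, Finset.mul_sum, Finset.sum_mul]
        refine Finset.sum_congr rfl fun t _ => by ring
    have e2 : ∀ i j, ∑ t, ((∑ s, N s i * N s t * (N s ⬝ᵥ x) ^ d) + q i * q t * (q ⬝ᵥ x) ^ d) * A t j
        = (∑ s, c s * N s i * N s j * (N s ⬝ᵥ x) ^ d) + c z * q i * q j * (q ⬝ᵥ x) ^ d := by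
      intro i j
      simp only [add_mul, Finset.sum_add_distrib]
      congr 1
      · simp only [Finset.sum_mul]
        rw [Finset.sum_comm]
        refine Finset.sum_congr rfl fun s _ => ?_
        have := congrFun (congrFun hNA s) j
        rw [Matrix.mul_apply, Matrix.diagonal_mul] at this
        calc _ = (N s i * (N s ⬝ᵥ x) ^ d) * ∑ t, N s t * A t j := by
              rw [Finset.mul_sum]; refine Finset.sum_congr rfl fun t _ => by ring
          _ = _ := by rw [this]; ring
      · have := congrFun hqA j
        simp only [Matrix.vecMul, dotProduct, Pi.smul_apply, smul_eq_mul] at this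
        calc _ = (q i * (q ⬝ᵥ x) ^ d) * ∑ t, q t * A t j := by
              rw [Finset.mul_sum]; refine Finset.sum_congr rfl fun t _ => by ring
          _ = _ := by rw [this]; ring
    intro i j
    rw [e1, e1]
    simp only [hH]
    rw [e2, e2]
    congr 1
    · exact Finset.sum_congr rfl fun s _ => by ring
    · ring
  let φ : Wk n k →ₗ[ℂ] Wk n l :=
    { toFun := fun c => ⟨fun i => (N⁻¹ * Matrix.diagonal c.1 * N) i i, (main c.1 c.2).2⟩
      map_add' := by
        intro c e
        ext i
        have h3 : Matrix.diagonal (c.1 + e.1) = Matrix.diagonal c.1 + Matrix.diagonal e.1 :=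
          (Matrix.diagonal_add _ _).symm
        change (N⁻¹ * Matrix.diagonal (c.1 + e.1) * N) i i = (N⁻¹ * Matrix.diagonal c.1 * N) i i +
          (N⁻¹ * Matrix.diagonal e.1 * N) i i
        rw [h3, Matrix.mul_add, Matrix.add_mul, Matrix.add_apply]
      map_smul' := by
        intro r c
        ext i
        simp [Matrix.diagonal_smul] }
  have hφ : Function.Injective φ := by
    rw [injective_iff_map_eq_zero]
    intro c hc
    have hz : N⁻¹ * Matrix.diagonal c.1 * N = 0 := by
      ext i j
      by_cases hij : i = j
      · subst hij
        exact congrFun (congrArg Subtype.val hc) i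
      · exact (main c.1 c.2).1 i j hij
    have h2 : Matrix.diagonal c.1 = 0 := by
      have := congrArg (fun Y => N * Y * N⁻¹) hz
      simpa [Matrix.mul_assoc, Matrix.mul_nonsing_inv_cancel_left _ _ hN,
        Matrix.mul_nonsing_inv _ hN] using this
    ext i
    have := congrFun (congrFun h2 i) i
    simpa using this
  have h1 := LinearMap.finrank_le_finrank_of_injective hφ
  have h2 := Submodule.finrank_lt_finrank_of_lt (Wk_lt hk hkl hl)
  omega

lemma aeval_inv {n : ℕ} (M : Matrix (Fin n) (Fin n) ℂ) (hM : IsUnit M.det)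
    (f : MvPolynomial (Fin n) ℂ) :
    aeval (fun i => ∑ j, C (M⁻¹ i j) * X j) (aeval (fun i => ∑ j, C (M i j) * X j) f) = f := by
  rw [← AlgHom.comp_apply]
  conv_rhs => rw [← AlgHom.id_apply (R := ℂ) f]
  congr 1
  ext1 i
  have : aeval (fun i => (∑ j, C (M i j) * X j : MvPolynomial (Fin n) ℂ))
      (X i : MvPolynomial (Fin n) ℂ) = linf (M i) := by
    rw [aeval_X]; rfl
  rw [AlgHom.comp_apply, this, aeval_linf, AlgHom.id_apply, ← linf_single i]
  congr 1
  ext j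
  have := congrFun (congrFun (Matrix.mul_nonsing_inv M hM) i) j
  rw [Matrix.mul_apply] at this
  simp only [Matrix.vecMul, dotProduct]
  rw [this, Matrix.one_apply, Pi.single_apply]
  simp [eq_comm]

lemma uniq {n d k l : ℕ} (hd : 3 ≤ d) (f : MvPolynomial (Fin n) ℂ) (hk : 2 ≤ k) (hkl : k < l)
    (hl : l ≤ n) (M M' : Matrix (Fin n) (Fin n) ℂ) (hM : IsUnit M.det) (hM' : IsUnit M'.det)
    (a b : Fin n → ℂ)
    (ha0 : ∀ j : Fin n, k ≤ (j : ℕ) → a j = 0)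
    (hb : ∀ j : Fin n, (j : ℕ) < l → b j ≠ 0)
    (h : aeval (fun i => ∑ j, C (M i j) * X j) f
            = (∑ i, X i ^ d) + (∑ j, C (a j) * X j) ^ d)
    (h' : aeval (fun i => ∑ j, C (M' i j) * X j) f
            = (∑ i, X i ^ d) + (∑ j, C (b j) * X j) ^ d) : False := by
  obtain ⟨e, rfl⟩ : ∃ e, d = e + 2 := ⟨d - 2, by omega⟩
  refine key (d := e) (by omega) hk hkl hl (M⁻¹ * M') ?_ a b ha0 hb ?_
  · rw [Matrix.det_mul]
    exact (Matrix.isUnit_nonsing_inv_det _ hM).mul hM'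
  · have hf := aeval_inv M hM f
    rw [h] at hf
    generalize M⁻¹ = K at hf ⊢
    have e1 : f = (∑ i, linf (K i) ^ (e+2)) + linf (Matrix.vecMul a K) ^ (e+2) := by
      rw [← hf, map_add, map_sum]
      refine congrArg₂ (· + ·) ?_ ?_
      · refine Finset.sum_congr rfl fun i _ => ?_
        rw [map_pow, aeval_X, linf]
      · rw [map_pow, ← aeval_linf, linf]
    rw [e1, map_add, map_sum] at h'
    simp only [map_pow, aeval_linf] at h'
    simp only [linf_single]
    rw [← Matrix.vecMul_vecMul]
    exact h'.symm

lemma perm_exists {n : ℕ} (a : Fin n → ℂ) : ∃ k ≤ n, ∃ σ : Equiv.Perm (Fin n),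
    (∀ j : Fin n, (j:ℕ) < k → a (σ j) ≠ 0) ∧ ∀ j : Fin n, k ≤ (j:ℕ) → a (σ j) = 0 := by
  classical
  have hk : Fintype.card {j : Fin n // a j ≠ 0} ≤ n := by
    simpa using Fintype.card_subtype_le (fun j : Fin n => a j ≠ 0)
  refine ⟨_, hk, ?_⟩
  set k := Fintype.card {j : Fin n // a j ≠ 0} with hkdef
  have hc : Fintype.card {j : Fin n // (j:ℕ) < k} = Fintype.card {j : Fin n // a j ≠ 0} := by
    rw [Fintype.card_subtype, Fin.card_filter_val_lt, ← hkdef]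
    omega
  let e := Fintype.equivOfCardEq hc
  refine ⟨e.extendSubtype, fun j hj => e.extendSubtype_mem j hj, fun j hj => ?_⟩
  by_contra h
  exact e.extendSubtype_not_mem j (by omega) h

lemma basis_exists {n : ℕ} (v : Fin (n+1) → Fin n → ℂ) (h : Submodule.span ℂ (Set.range v) = ⊤) :
    ∃ s : Fin (n+1), Submodule.span ℂ (Set.range (fun i => v (s.succAbove i))) = ⊤ := by
  have hnot : ¬ LinearIndependent ℂ v := by
    intro hl
    have := hl.fintype_card_le_finrank
    simp at this
  rw [Fintype.not_linearIndependent_iff] at hnot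
  obtain ⟨g, hg, s, hs⟩ := hnot
  refine ⟨s, ?_⟩
  rw [eq_top_iff, ← h, Submodule.span_le]
  rintro _ ⟨t, rfl⟩
  have hmem : ∀ i, v (s.succAbove i) ∈ Submodule.span ℂ (Set.range (fun i => v (s.succAbove i))) :=
    fun i => Submodule.subset_span ⟨i, rfl⟩
  rcases Fin.eq_self_or_eq_succAbove s t with rfl | ⟨i, rfl⟩
  · rw [Fin.sum_univ_succAbove _ t] at hg
    have : v t = (-(g t)⁻¹) • ∑ i, g (t.succAbove i) • v (t.succAbove i) := by
      rw [eq_neg_of_add_eq_zero_right hg, smul_neg, neg_smul, neg_neg, smul_smul,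
        inv_mul_cancel₀ hs, one_smul]
    rw [this]
    exact Submodule.smul_mem _ _ (Submodule.sum_mem _ fun i _ => Submodule.smul_mem _ _ (hmem i))
  · exact hmem i

theorem stmt3 (n d : ℕ) (hn : 3 ≤ n) (hd : 3 ≤ d)
    (f : MvPolynomial (Fin n) ℂ) (hhom : f.IsHomogeneous d) (hsf : Squarefree f)
    (hess : ∀ (r : ℕ) (ℓ : Fin r → Fin n → ℂ),
      f = ∑ i, (∑ j, C (ℓ i j) * X j) ^ d → Submodule.span ℂ (Set.range ℓ) = ⊤)
    (hrank : IsLeast {r : ℕ | ∃ ℓ : Fin r → Fin n → ℂ,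
      f = ∑ i, (∑ j, C (ℓ i j) * X j) ^ d} (n + 1)) :
    ∃! k : ℕ, 2 ≤ k ∧ k ≤ n ∧
      ∃ M : Matrix (Fin n) (Fin n) ℂ, IsUnit M.det ∧
        ∃ a : Fin n → ℂ, (∀ j : Fin n, (j : ℕ) < k → a j ≠ 0) ∧
          (∀ j : Fin n, k ≤ (j : ℕ) → a j = 0) ∧
          aeval (fun i => ∑ j, C (M i j) * X j) f
            = (∑ i, X i ^ d) + (∑ j, C (a j) * X j) ^ d := by
  refine existsUnique_of_exists_of_unique ?_ ?_
  · obtain ⟨⟨v, hv⟩, hmin⟩ := hrank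
    have hspan := hess _ v hv
    obtain ⟨s, hs⟩ := basis_exists v hspan
    have hmem : v s ∈ Submodule.span ℂ (Set.range (fun i => v (s.succAbove i))) := by
      rw [hs]; trivial
    rw [Submodule.mem_span_range_iff_exists_fun] at hmem
    obtain ⟨a, ha⟩ := hmem
    obtain ⟨k, hkn, σ, h1, h2⟩ := perm_exists a
    let B : Matrix (Fin n) (Fin n) ℂ := fun i => v (s.succAbove (σ i))
    have hB : IsUnit B.det := by
      have hr : Set.range B = Set.range (fun i => v (s.succAbove i)) :=
        σ.surjective.range_comp (fun i => v (s.succAbove i))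
      have hli : LinearIndependent ℂ B := by
        apply linearIndependent_of_top_le_span_of_card_eq_finrank
        · rw [hr, hs]
        · simp
      rw [← Matrix.isUnit_iff_isUnit_det]
      exact Matrix.linearIndependent_rows_iff_isUnit.1 hli
    have hvs : v s = Matrix.vecMul (a ∘ σ) B := by
      rw [← ha, ← Equiv.sum_comp σ]
      ext j
      simp [Matrix.vecMul, dotProduct, B]
    have hf : f = (∑ i, linf (B i) ^ d) + linf (Matrix.vecMul (a ∘ σ) B) ^ d := by
      rw [← hvs, hv, Fin.sum_univ_succAbove _ s, add_comm, ← Equiv.sum_comp σ]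
      rfl
    refine ⟨k, ?_, hkn, B⁻¹, Matrix.isUnit_nonsing_inv_det _ hB, a ∘ σ, h1, h2, ?_⟩
    · by_contra hk
      let z : Fin n := ⟨0, by omega⟩
      have hz : ∀ j, j ≠ z → (a ∘ σ) j = 0 := by
        intro j hj
        apply h2
        have : (j:ℕ) ≠ 0 := fun h => hj (Fin.ext h)
        omega
      have hvm : Matrix.vecMul (a ∘ σ) B = (a ∘ σ) z • B z := by
        ext j
        simp only [Matrix.vecMul, dotProduct, Pi.smul_apply, smul_eq_mul]
        rw [Finset.sum_eq_single z]
        · intro b _ hb; rw [hz b hb, zero_mul]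
        · simp
      obtain ⟨c, hc⟩ := IsAlgClosed.exists_pow_nat_eq (1 + ((a ∘ σ) z) ^ d) (by omega : 0 < d)
      have : n + 1 ≤ n := by
        apply hmin
        refine ⟨Function.update B z (c • B z), ?_⟩
        change f = ∑ i, linf (Function.update B z (c • B z) i) ^ d
        rw [hf, hvm, ← Finset.add_sum_erase _ _ (Finset.mem_univ z),
          ← Finset.add_sum_erase _ (fun i => linf (Function.update B z (c • B z) i) ^ d)
            (Finset.mem_univ z), Function.update_self, linf_smul, linf_smul, mul_pow, mul_pow,
          ← C_pow, ← C_pow, hc]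
        have : ∑ i ∈ Finset.univ.erase z, linf (Function.update B z (c • B z) i) ^ d =
            ∑ i ∈ Finset.univ.erase z, linf (B i) ^ d := by
          refine Finset.sum_congr rfl fun i hi => ?_
          rw [Function.update_of_ne (Finset.ne_of_mem_erase hi)]
        rw [this, C_add, C_1]
        ring
      omega
    · have hg : f = aeval (fun i => ∑ j, C (B i j) * X j)
          ((∑ i, X i ^ d) + linf (a ∘ σ) ^ d) := by
        rw [hf, map_add, map_sum, map_pow, aeval_linf]
        congr 1
        refine Finset.sum_congr rfl fun i _ => ?_
        rw [map_pow, aeval_X]; rfl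
      rw [hg, aeval_inv B hB]
      rfl
  · rintro k l ⟨hk, hkn, M, hM, a, ha, ha0, h⟩ ⟨hl, hln, M', hM', b, hb, hb0, h'⟩
    rcases lt_trichotomy k l with hlt | heq | hlt
    · exact (uniq hd f hk hlt hln M M' hM hM' a b ha0 hb h h').elim
    · exact heq
    · exact (uniq hd f hl hlt hkn M' M hM' hM b a hb0 ha h' h).elim
end

section
/- Let f = x_1^d + ⋯ + x_n^d + (a_1x_1 + ⋯ + a_kx_k)^d with n ≥ 3, d ≥ 3, 2 ≤ k ≤ n and all a_j ∈ ℂ^*. A nonzero point p ∈ ℂ^n is a common zero of all first-order partial derivatives of f if and only if p is a nonzero scalar multiple of (u_1, …, u_{k−1}, 1, 0, …, 0) for some solution u = (u_1,…,u_{k−1}) of the system (S). In particular, the set of singular points of the hypersurface V : f = 0 in ℙ^{n−1} is finite and is in bijection with the set of solutions of (S). -/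
open MvPolynomial

theorem aux_sum (n k : ℕ) (hk : 1 ≤ k) (hkn : k ≤ n) (g : Fin n → ℂ)
    (hz : ∀ i : Fin n, k ≤ (i : ℕ) → g i = 0) :
    ∑ i, g i = (∑ j : Fin (k - 1), g (Fin.castLE (by omega) j)) + g ⟨k - 1, by omega⟩ := by
  obtain ⟨m, rfl⟩ : ∃ m, k = m + 1 := ⟨k - 1, by omega⟩
  obtain ⟨r, rfl⟩ : ∃ r, n = m + 1 + r := ⟨n - (m + 1), by omega⟩
  rw [Fin.sum_univ_add, Fin.sum_univ_castSucc]
  have h0 : ∑ i : Fin r, g (Fin.natAdd (m + 1) i) = 0 :=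
    Finset.sum_eq_zero (fun i _ => hz _ (by simp))
  rw [h0, add_zero]
  rfl

theorem aux_eval (n d : ℕ) (a p : Fin n → ℂ) (i : Fin n) :
    eval p (pderiv i ((∑ i, X i ^ d) + (∑ j, C (a j) * X j) ^ d : MvPolynomial (Fin n) ℂ)) =
      d * (p i ^ (d - 1) + a i * (∑ j, a j * p j) ^ (d - 1)) := by
  have h1 : pderiv i (∑ j, C (a j) * X j : MvPolynomial (Fin n) ℂ) = C (a i) := by
    rw [map_sum, Finset.sum_eq_single i]
    · simp
    · intro b _ hb
      simp [pderiv_X_of_ne hb]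
    · simp
  have h2 : pderiv i (∑ j, X j ^ d : MvPolynomial (Fin n) ℂ) =
      (d : MvPolynomial (Fin n) ℂ) * X i ^ (d - 1) := by
    rw [map_sum, Finset.sum_eq_single i]
    · simp [pderiv_pow]
    · intro b _ hb
      simp [pderiv_pow, pderiv_X_of_ne hb]
    · simp
  rw [map_add, pderiv_pow, h1, h2]
  simp
  ring

/-- Let `f = x_1^d + ⋯ + x_n^d + (a_1 x_1 + ⋯ + a_k x_k)^d` with `n ≥ 3`, `d ≥ 3`,
`2 ≤ k ≤ n`, all `a_j` nonzero for indices `< k` (zero-indexed).  A nonzero `p ∈ ℂ^n`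
is a common zero of all first-order partial derivatives of `f` iff `p` is a nonzero
scalar multiple of `(u_1, …, u_{k-1}, 1, 0, …, 0)` for some solution `u` of the system
`(S)`.  In particular the set of singular points of `V : f = 0` in `ℙ^{n-1}` is finite
and in bijection with the set of solutions of `(S)`. -/
theorem stmt4 (n d k : ℕ) (hn : 3 ≤ n) (hd : 3 ≤ d) (hk2 : 2 ≤ k) (hkn : k ≤ n)
    (a : Fin n → ℂ) (ha : ∀ j : Fin n, (j : ℕ) < k → a j ≠ 0)
    (ha' : ∀ j : Fin n, k ≤ (j : ℕ) → a j = 0)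
    (f : MvPolynomial (Fin n) ℂ)
    (hf : f = (∑ i, X i ^ d) + (∑ j, C (a j) * X j) ^ d)
    (SolS : (Fin (k - 1) → ℂ) → Prop)
    (hS : ∀ u : Fin (k - 1) → ℂ, SolS u ↔
      ((∀ j : Fin (k - 1),
          a ⟨k - 1, by omega⟩ * (u j) ^ (d - 1) - a (Fin.castLE (by omega) j) = 0) ∧
        a ⟨k - 1, by omega⟩ *
            ((∑ j : Fin (k - 1), a (Fin.castLE (by omega) j) * u j) + a ⟨k - 1, by omega⟩)
              ^ (d - 1) + 1 = 0))
    (pt : (Fin (k - 1) → ℂ) → (Fin n → ℂ))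
    (hpt : ∀ (u : Fin (k - 1) → ℂ) (i : Fin n),
      pt u i = if h : (i : ℕ) < k - 1 then u ⟨i, h⟩
        else if (i : ℕ) = k - 1 then 1 else 0) :
    (∀ p : Fin n → ℂ, p ≠ 0 →
      ((∀ i, eval p (pderiv i f) = 0) ↔
        ∃ c : ℂ, c ≠ 0 ∧ ∃ u : Fin (k - 1) → ℂ, SolS u ∧ p = c • pt u)) ∧
    {x : Projectivization ℂ (Fin n → ℂ) | ∀ i, eval x.rep (pderiv i f) = 0}.Finite ∧
    Nonempty ({u : Fin (k - 1) → ℂ // SolS u} ≃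
      {x : Projectivization ℂ (Fin n → ℂ) // ∀ i, eval x.rep (pderiv i f) = 0}) := by
  have hdC : (d : ℂ) ≠ 0 := by exact_mod_cast (by omega : d ≠ 0)
  have hd1 : d - 1 ≠ 0 := by omega
  have hev : ∀ (p : Fin n → ℂ) (i : Fin n), eval p (pderiv i f) = 0 ↔
      p i ^ (d - 1) + a i * (∑ j, a j * p j) ^ (d - 1) = 0 := by
    intro p i
    rw [hf, aux_eval]
    simp [hdC]
  set K : Fin n := ⟨k - 1, by omega⟩ with hK
  have haK : a K ≠ 0 := ha K (by simp [hK]; omega)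
  have hsum : ∀ p : Fin n → ℂ, ∑ j, a j * p j =
      (∑ j : Fin (k - 1), a (Fin.castLE (by omega) j) * p (Fin.castLE (by omega) j))
        + a K * p K := fun p =>
    aux_sum n k (by omega) hkn (fun j => a j * p j) (fun i hi => by simp [ha' i hi])
  have hptK : ∀ u, pt u K = 1 := by intro u; rw [hpt]; simp [hK]
  have hptj : ∀ u (j : Fin (k - 1)), pt u (Fin.castLE (by omega) j) = u j := by
    intro u j; rw [hpt]; simp
  have hptz : ∀ u (i : Fin n), k ≤ (i : ℕ) → pt u i = 0 := by
    intro u i hi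
    rw [hpt, dif_neg (by omega), if_neg (by omega)]
  have hcases : ∀ i : Fin n, (∃ j : Fin (k - 1), i = Fin.castLE (by omega) j) ∨ i = K ∨
      k ≤ (i : ℕ) := by
    intro i
    rcases lt_trichotomy (i : ℕ) (k - 1) with h | h | h
    · exact Or.inl ⟨⟨i, h⟩, rfl⟩
    · exact Or.inr (Or.inl (Fin.ext h))
    · exact Or.inr (Or.inr (by omega))
  have hptinj : ∀ (u v : Fin (k - 1) → ℂ) (c : ℂ), pt u = c • pt v → u = v := by
    intro u v c h
    have h1 := congrFun h K
    rw [Pi.smul_apply, hptK, hptK, smul_eq_mul, mul_one] at h1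
    funext j
    have h2 := congrFun h (Fin.castLE (by omega) j)
    rw [Pi.smul_apply, hptj, hptj, ← h1, one_smul] at h2
    exact h2
  have hpt0 : ∀ u, pt u ≠ 0 := by
    intro u h
    have := congrFun h K
    rw [hptK] at this
    simp at this
  have main : ∀ p : Fin n → ℂ, p ≠ 0 →
      ((∀ i, eval p (pderiv i f) = 0) ↔
        ∃ c : ℂ, c ≠ 0 ∧ ∃ u : Fin (k - 1) → ℂ, SolS u ∧ p = c • pt u) := by
    intro p hp
    simp only [hev]
    constructor
    · intro h
      have hz : ∀ i : Fin n, k ≤ (i : ℕ) → p i = 0 := by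
        intro i hi
        have := h i
        rw [ha' i hi, zero_mul, add_zero] at this
        exact pow_eq_zero_iff hd1 |>.1 this
      have hpK : p K ≠ 0 := by
        intro h0
        apply hp
        have hL := h K
        rw [h0, zero_pow hd1, zero_add] at hL
        have hL' := (mul_eq_zero.1 hL).resolve_left haK
        funext i
        have := h i
        rw [hL', mul_zero, add_zero] at this
        exact pow_eq_zero_iff hd1 |>.1 this
      have hpe : p = p K • pt (fun j => p (Fin.castLE (by omega) j) / p K) := by
        funext i
        rw [Pi.smul_apply, smul_eq_mul]
        rcases hcases i with ⟨j, rfl⟩ | rfl | hi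
        · rw [hptj]; field_simp
        · rw [hptK, mul_one]
        · rw [hptz _ _ hi, hz _ hi, mul_zero]
      refine ⟨p K, hpK, fun j => p (Fin.castLE (by omega) j) / p K, ?_, hpe⟩
      have hKe := h K
      rw [hS]
      have hpd : p K ^ (d - 1) ≠ 0 := pow_ne_zero _ hpK
      constructor
      · intro j
        have hj := h (Fin.castLE (by omega) j)
        rw [div_pow]
        field_simp
        linear_combination a K * hj - a (Fin.castLE (by omega) j) * hKe
      · have : (∑ j : Fin (k - 1), a (Fin.castLE (by omega) j) *
            (p (Fin.castLE (by omega) j) / p K)) + a K = (∑ j, a j * p j) / p K := by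
          rw [hsum, add_div, Finset.sum_div]
          congr 1
          · exact Finset.sum_congr rfl (fun j _ => by ring)
          · field_simp
        rw [this, div_pow]
        field_simp
        linear_combination hKe
    · rintro ⟨c, hc, u, hu, rfl⟩ i
      rw [hS] at hu
      obtain ⟨h1, h2⟩ := hu
      have hL : ∑ j, a j * (c • pt u) j =
          c * ((∑ j : Fin (k - 1), a (Fin.castLE (by omega) j) * u j) + a K) := by
        rw [hsum, mul_add, Finset.mul_sum]
        congr 1
        · refine Finset.sum_congr rfl (fun j _ => ?_)
          rw [Pi.smul_apply, hptj, smul_eq_mul]; ring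
        · rw [Pi.smul_apply, hptK, smul_eq_mul]; ring
      rw [hL, Pi.smul_apply, smul_eq_mul, mul_pow, mul_pow]
      generalize (∑ j : Fin (k - 1), a (Fin.castLE (by omega) j) * u j) + a K = L at h2
      rcases hcases i with ⟨j, rfl⟩ | rfl | hi
      · rw [hptj]
        have hj := h1 j
        apply mul_left_cancel₀ haK
        linear_combination c ^ (d - 1) * hj + c ^ (d - 1) * a (Fin.castLE (by omega) j) * h2
      · rw [hptK, one_pow]
        linear_combination c ^ (d - 1) * h2
      · rw [hptz _ _ hi, ha' _ hi, zero_pow hd1]; ring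
  have hfinS : Finite {u : Fin (k - 1) → ℂ // SolS u} := by
    have hfin : (Set.pi Set.univ (fun j : Fin (k - 1) =>
        {z : ℂ | a K * z ^ (d - 1) - a (Fin.castLE (by omega) j) = 0})).Finite := by
      refine Set.Finite.pi (fun j => ?_)
      set b := a (Fin.castLE (by omega) j)
      have hq : (Polynomial.X ^ (d - 1) - Polynomial.C (b / a K) : Polynomial ℂ) ≠ 0 :=
        Polynomial.X_pow_sub_C_ne_zero (by omega) _
      refine (Polynomial.finite_setOf_isRoot hq).subset (fun z hz => ?_)
      simp only [Set.mem_setOf_eq] at hz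
      simp only [Set.mem_setOf_eq, Polynomial.IsRoot, Polynomial.eval_sub, Polynomial.eval_pow,
        Polynomial.eval_X, Polynomial.eval_C]
      field_simp
      linear_combination hz
    exact (hfin.subset (t := {u | SolS u}) (fun u hu j _ => ((hS u).1 hu).1 j)).to_subtype
  have hrep : ∀ u, SolS u → ∀ i, eval (Projectivization.mk ℂ (pt u) (hpt0 u)).rep
      (pderiv i f) = 0 := by
    intro u hu
    obtain ⟨c, hc⟩ := Projectivization.exists_smul_eq_mk_rep ℂ (pt u) (hpt0 u)
    exact (main _ (Projectivization.rep_nonzero _)).2 ⟨c, c.ne_zero, u, hu, hc.symm⟩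
  let F : {u : Fin (k - 1) → ℂ // SolS u} →
      {x : Projectivization ℂ (Fin n → ℂ) // ∀ i, eval x.rep (pderiv i f) = 0} :=
    fun u => ⟨Projectivization.mk ℂ (pt u.1) (hpt0 u.1), hrep u.1 u.2⟩
  have hF : Function.Bijective F := by
    constructor
    · intro u v huv
      have h := congrArg Subtype.val huv
      obtain ⟨c, hc⟩ := (Projectivization.mk_eq_mk_iff' ℂ _ _ _ _).1 h
      exact Subtype.ext (hptinj _ _ c hc.symm)
    · rintro ⟨x, hx⟩
      obtain ⟨c, hc, u, hu, he⟩ := (main _ (Projectivization.rep_nonzero x)).1 hx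
      refine ⟨⟨u, hu⟩, Subtype.ext ?_⟩
      change Projectivization.mk ℂ (pt u) (hpt0 u) = x
      rw [← Projectivization.mk_rep x]
      refine (Projectivization.mk_eq_mk_iff' ℂ _ _ _ _).2 ⟨c⁻¹, ?_⟩
      rw [he, smul_smul, inv_mul_cancel₀ hc, one_smul]
  refine ⟨main, ?_, ⟨Equiv.ofBijective F hF⟩⟩
  have : Finite {x : Projectivization ℂ (Fin n → ℂ) // ∀ i, eval x.rep (pderiv i f) = 0} :=
    Finite.of_surjective F hF.2
  exact Set.finite_coe_iff.1 this
end

section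
/- Let k ≥ 2, let a_1, …, a_k and u_1, …, u_{k−1} be nonzero complex numbers, and set γ = a_1u_1 + ⋯ + a_{k−1}u_{k−1} + a_k; assume γ ≠ 0. Then the (k−1)×(k−1) symmetric matrix N with off-diagonal entries N_{ij} = −a_i a_j (for i ≠ j) and diagonal entries N_{jj} = a_jγ/u_j − a_j^2 has nonzero determinant. -/
/-- Let `k ≥ 2`, `a_1, …, a_{k-1}, a_k` and `u_1, …, u_{k-1}` nonzero complex numbers,
`γ = a_1 u_1 + ⋯ + a_{k-1} u_{k-1} + a_k ≠ 0`.  Then the `(k-1) × (k-1)` symmetric matrix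
with off-diagonal entries `-a_i a_j` and diagonal entries `a_j γ / u_j - a_j ^ 2` has
nonzero determinant. -/
theorem stmt5 (k : ℕ) (hk : 2 ≤ k) (a : Fin (k - 1) → ℂ) (ak : ℂ)
    (ha : ∀ i, a i ≠ 0) (hak : ak ≠ 0)
    (u : Fin (k - 1) → ℂ) (hu : ∀ i, u i ≠ 0)
    (γ : ℂ) (hγ : γ = (∑ j, a j * u j) + ak) (hγ0 : γ ≠ 0) :
    (Matrix.of fun i j : Fin (k - 1) =>
      if i = j then a i * γ / u i - (a i) ^ 2 else -(a i * a j)).det ≠ 0 := by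
  intro hdet
  obtain ⟨v, hv0, hv⟩ := Matrix.exists_mulVec_eq_zero_iff.mpr hdet
  have key : ∀ i, v i * γ = u i * ∑ j, a j * v j := by
    intro i
    have h := congrFun hv i
    have e : ∀ j, (if i = j then a i * γ / u i - (a i) ^ 2 else -(a i * a j)) * v j
        = (if i = j then a i * γ / u i * v j else 0) - a i * (a j * v j) := by
      intro j
      split_ifs with hij
      · subst hij; ring
      · ring
    simp only [Matrix.mulVec, dotProduct, Matrix.of_apply, Pi.zero_apply, e,
      Finset.sum_sub_distrib, Finset.sum_ite_eq, Finset.mem_univ, if_true,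
      ← Finset.mul_sum] at h
    have h2 : a i * (γ / u i * v i - ∑ j, a j * v j) = 0 := by
      rw [← h]; ring
    have h3 := (mul_eq_zero.mp h2).resolve_left (ha i)
    rw [← sub_eq_zero.mp h3]
    have := hu i
    field_simp
  have hs : (∑ j, a j * v j) * γ = (∑ j, a j * u j) * ∑ j, a j * v j := by
    rw [Finset.sum_mul, Finset.sum_mul]
    refine Finset.sum_congr rfl fun i _ => ?_
    rw [mul_assoc, key i, mul_assoc]
  have hs2 : ak * ∑ j, a j * v j = 0 := by
    rw [hγ] at hs
    linear_combination hs
  have hs0 := (mul_eq_zero.mp hs2).resolve_left hak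
  apply hv0
  funext i
  have h := key i
  rw [hs0, mul_zero] at h
  exact (mul_eq_zero.mp h).resolve_right hγ0
end

section
/- Let f = x_1^d + ⋯ + x_n^d + (a_1x_1 + ⋯ + a_kx_k)^d with n ≥ 3, d ≥ 3, 2 ≤ k ≤ n and all a_j ∈ ℂ^*. At every singular point p of the hypersurface V : f = 0 in ℙ^{n−1} (i.e., nonzero p ∈ ℂ^n with all first-order partial derivatives of f vanishing at p), the n×n Hessian matrix of f evaluated at p has rank exactly k−1. (This expresses that all singularities of V are of type A_{2^{k−1},d^{n−k}}, given in suitable local coordinates by v_1^2 + ⋯ + v_{k−1}^2 + w_1^d + ⋯ + w_{n−k}^d = 0; for k = n all singularities are nodes.) -/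
open MvPolynomial

theorem card_aux (n k : ℕ) (hkn : k ≤ n) :
    Fintype.card {i : Fin n // k ≤ (i : ℕ)} = n - k := by
  have e : {i : Fin n // k ≤ (i : ℕ)} ≃ Fin (n - k) :=
    { toFun := fun i => ⟨i.1.1 - k, by have := i.1.2; have := i.2; omega⟩
      invFun := fun j => ⟨⟨j.1 + k, by have := j.2; omega⟩, by simp⟩
      left_inv := fun i => by
        have := i.2
        apply Subtype.ext; apply Fin.ext; simp; omega
      right_inv := fun j => by apply Fin.ext; simp }
  rw [Fintype.card_congr e, Fintype.card_fin]

noncomputable def gAux (n k : ℕ) (p : Fin n → ℂ) :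
    (ℂ × ({i : Fin n // k ≤ (i : ℕ)} → ℂ)) →ₗ[ℂ] (Fin n → ℂ) where
  toFun x := fun i => if h : k ≤ (i : ℕ) then x.2 ⟨i, h⟩ else x.1 * p i
  map_add' x y := by
    ext i; by_cases h : k ≤ (i : ℕ) <;> simp [h, add_mul]
  map_smul' c x := by
    ext i; by_cases h : k ≤ (i : ℕ) <;> simp [h, mul_assoc]

theorem pd_aux (n d : ℕ) (a : Fin n → ℂ) (i : Fin n) :
    pderiv i (((∑ i, X i ^ d) + (∑ j, C (a j) * X j) ^ d : MvPolynomial (Fin n) ℂ))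
      = C (d : ℂ) * (X i ^ (d - 1) + C (a i) * (∑ j, C (a j) * X j) ^ (d - 1)) := by
  simp [pderiv_X, Pi.single_apply, Derivation.leibniz]
  ring

theorem pd2_aux (n e : ℕ) (a p : Fin n → ℂ) (c : ℂ) (i j : Fin n) :
    eval p (pderiv i (C c * (X j ^ e + C (a j) * (∑ j, C (a j) * X j) ^ e)
        : MvPolynomial (Fin n) ℂ))
      = c * e * ((if i = j then p i ^ (e - 1) else 0)
        + a i * a j * (∑ j, a j * p j) ^ (e - 1)) := by
  have h := eq_comm (a := i) (b := j)
  by_cases hij : i = j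
  · subst hij
    simp [pderiv_X, Pi.single_apply, Derivation.leibniz]
    ring
  · have hji : ¬ j = i := fun h => hij h.symm
    simp [pderiv_X, Pi.single_apply, Derivation.leibniz, hij, hji]
    ring

theorem stmt6 (n d k : ℕ) (hn : 3 ≤ n) (hd : 3 ≤ d) (hk2 : 2 ≤ k) (hkn : k ≤ n)
    (a : Fin n → ℂ) (ha : ∀ j : Fin n, (j : ℕ) < k → a j ≠ 0)
    (ha' : ∀ j : Fin n, k ≤ (j : ℕ) → a j = 0)
    (f : MvPolynomial (Fin n) ℂ)
    (hf : f = (∑ i, X i ^ d) + (∑ j, C (a j) * X j) ^ d)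
    (p : Fin n → ℂ) (hp : p ≠ 0)
    (hsing : ∀ i, eval p (pderiv i f) = 0) :
    (Matrix.of fun i j : Fin n => eval p (pderiv i (pderiv j f))).rank = k - 1 := by
  subst hf
  obtain ⟨e, rfl⟩ : ∃ e, d = e + 3 := ⟨d - 3, by omega⟩
  simp only [pd_aux, pd2_aux] at hsing ⊢
  obtain ⟨L, hL⟩ : ∃ L, L = ∑ j, a j * p j := ⟨_, rfl⟩
  have hd0 : ((e + 3 : ℕ) : ℂ) ≠ 0 := by norm_cast
  have hd1 : ((e + 3 - 1 : ℕ) : ℂ) ≠ 0 := Nat.cast_ne_zero.2 (by omega)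
  have hs : ∀ i, p i ^ (e + 2) + a i * L ^ (e + 2) = 0 := by
    intro i
    have := hsing i
    rw [map_mul, eval_C] at this
    have := (mul_eq_zero.1 this).resolve_left hd0
    simpa [hL] using this
  have hL0 : L ≠ 0 := by
    intro h0
    apply hp
    ext i
    have := hs i
    rw [h0] at this
    simpa using this
  have hpk : ∀ i : Fin n, k ≤ (i : ℕ) → p i = 0 := by
    intro i hi
    have := hs i
    rw [ha' i hi] at this
    simpa using this
  have hpn : ∀ i : Fin n, (i : ℕ) < k → p i ≠ 0 := by
    intro i hi h0
    have := hs i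
    rw [h0] at this
    simp [ha i hi, hL0] at this
  have hmv : ∀ v : Fin n → ℂ, ∀ i, ((Matrix.of fun i j : Fin n =>
      ((e + 3 : ℕ) : ℂ) * ((e + 3 - 1 : ℕ) : ℂ) * ((if i = j then p i ^ (e + 3 - 1 - 1) else 0)
        + a i * a j * (∑ j, a j * p j) ^ (e + 3 - 1 - 1))).mulVec v) i =
      ((e + 3 : ℕ) : ℂ) * ((e + 3 - 1 : ℕ) : ℂ) * (p i ^ (e + 1) * v i
        + a i * L ^ (e + 1) * ∑ j, a j * v j) := by
    intro v i
    rw [← hL]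
    simp only [Matrix.mulVec, dotProduct, Matrix.of_apply, mul_assoc, ← Finset.mul_sum, add_mul,
      Finset.sum_add_distrib, ite_mul, zero_mul, Finset.sum_ite_eq, Finset.mem_univ, if_true]
    congr 3
    simp only [Finset.mul_sum]
    apply Finset.sum_congr rfl
    intro j _
    simp only [Nat.add_sub_cancel, show e + 3 - 1 - 1 = e + 1 by omega]
    ring
  have hker : LinearMap.ker (Matrix.mulVecLin (Matrix.of fun i j : Fin n =>
      ((e + 3 : ℕ) : ℂ) * ((e + 3 - 1 : ℕ) : ℂ) * ((if i = j then p i ^ (e + 3 - 1 - 1) else 0)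
        + a i * a j * (∑ j, a j * p j) ^ (e + 3 - 1 - 1)))) = LinearMap.range (gAux n k p) := by
    ext v
    rw [LinearMap.mem_ker, Matrix.mulVecLin_apply, _root_.funext_iff]
    simp only [hmv, Pi.zero_apply, mul_eq_zero, hd0, hd1, false_or]
    constructor
    · intro h
      refine ⟨((∑ j, a j * v j) / L, fun i => v i), ?_⟩
      ext i
      by_cases hi : k ≤ (i : ℕ)
      · simp [gAux, hi]
      · simp only [gAux, LinearMap.coe_mk, AddHom.coe_mk, hi, dite_false]
        have h1 := h i
        have h2 := hs i
        have h3 := pow_ne_zero (e + 1) (hpn i (by omega))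
        apply mul_left_cancel₀ h3
        rw [div_mul_eq_mul_div, ← mul_div_assoc, div_eq_iff hL0]
        linear_combination (∑ j, a j * v j) * h2 - L * h1
    · rintro ⟨⟨c, w⟩, rfl⟩ i
      have hsum : ∑ j, a j * gAux n k p (c, w) j = c * L := by
        rw [hL, Finset.mul_sum]
        apply Finset.sum_congr rfl
        intro j _
        by_cases hj : k ≤ (j : ℕ)
        · simp [ha' j hj]
        · simp only [gAux, LinearMap.coe_mk, AddHom.coe_mk, hj, dite_false]; ring
      rw [hsum]
      by_cases hi : k ≤ (i : ℕ)
      · simp [ha' i hi, hpk i hi]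
      · simp only [gAux, LinearMap.coe_mk, AddHom.coe_mk, hi, dite_false]
        linear_combination c * hs i
  have hinj : Function.Injective (gAux n k p) := by
    rintro ⟨c, w⟩ ⟨c', w'⟩ h
    rw [_root_.funext_iff] at h
    refine Prod.ext ?_ ?_
    · have h0 := h ⟨0, by omega⟩
      have := hpn ⟨0, by omega⟩ (by simp; omega)
      have hk : k ≠ 0 := by omega
      simpa [gAux, hk, this] using h0
    · ext ⟨i, hi⟩
      simpa [gAux, hi] using h i
  have hrn := LinearMap.finrank_range_add_finrank_ker (Matrix.mulVecLin (Matrix.of fun i j : Fin n =>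
      ((e + 3 : ℕ) : ℂ) * ((e + 3 - 1 : ℕ) : ℂ) * ((if i = j then p i ^ (e + 3 - 1 - 1) else 0)
        + a i * a j * (∑ j, a j * p j) ^ (e + 3 - 1 - 1))))
  rw [hker, LinearMap.finrank_range_of_inj hinj, Module.finrank_prod, Module.finrank_self,
    Module.finrank_fintype_fun_eq_card, Module.finrank_fintype_fun_eq_card, card_aux n k hkn,
    Fintype.card_fin] at hrn
  unfold Matrix.rank
  omega
end

section
/- Let n ≥ 4, d ≥ 3, 2 ≤ k ≤ n and a_1, …, a_k ∈ ℂ^*. Then the polynomial f = x_1^d + ⋯ + x_n^d + (a_1x_1 + ⋯ + a_kx_k)^d is irreducible in ℂ[x_1, …, x_n]. -/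
open MvPolynomial

noncomputable def killHom (n j : ℕ) : MvPolynomial (Fin n) ℂ →ₐ[ℂ] MvPolynomial (Fin n) ℂ :=
  aeval (fun i => if (i : ℕ) < j then 0 else X i)

lemma killHom_comp (n j : ℕ) (p : MvPolynomial (Fin n) ℂ) :
    killHom n (j+1) (killHom n j p) = killHom n (j+1) p := by
  rw [← AlgHom.comp_apply]
  congr 1
  apply MvPolynomial.algHom_ext
  intro i
  simp only [AlgHom.comp_apply, killHom, aeval_X]
  split_ifs with h1 h2
  · simp
  · omega
  · rw [aeval_X, if_pos (by assumption)]
  · rw [aeval_X, if_neg (by assumption)]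

instance killHom_prime (n j : ℕ) : (RingHom.ker (killHom n j)).IsPrime :=
  RingHom.ker_isPrime _

lemma killHom_height (n j : ℕ) (hj : j ≤ n) : (j : ℕ∞) ≤ (RingHom.ker (killHom n j)).height := by
  induction j with
  | zero => simp
  | succ j ih =>
    have h1 := ih (by omega)
    have hlt : RingHom.ker (killHom n j) < RingHom.ker (killHom n (j+1)) := by
      refine lt_of_le_of_ne ?_ ?_
      · intro p hp
        rw [RingHom.mem_ker] at hp ⊢
        rw [← killHom_comp, hp, map_zero]
      · intro h
        have : (X ⟨j, by omega⟩ : MvPolynomial (Fin n) ℂ) ∈ RingHom.ker (killHom n j) := by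
          rw [h, RingHom.mem_ker, killHom, aeval_X, if_pos (by simp)]
        rw [RingHom.mem_ker, killHom, aeval_X, if_neg (by simp)] at this
        exact X_ne_zero _ this
    have h2 := Ideal.height_add_one_le_of_lt_of_isPrime hlt
    push_cast
    exact le_trans (by gcongr) h2

lemma killHom_full (n : ℕ) (p : MvPolynomial (Fin n) ℂ) :
    killHom n n p = C (constantCoeff p) := by
  have : killHom n n = (Algebra.ofId ℂ (MvPolynomial (Fin n) ℂ)).comp (aeval (fun _ => 0)) := by
    apply MvPolynomial.algHom_ext
    intro i
    simp [killHom]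
  rw [this, AlgHom.comp_apply]
  simp [Algebra.ofId_apply, aeval_zero']

lemma unit_of_hom (n d : ℕ) (f g h : MvPolynomial (Fin n) ℂ) (hf : f.IsHomogeneous d)
    (hf0 : f ≠ 0) (hgh : f = g * h) (hh : constantCoeff h ≠ 0) : IsUnit h := by
  let ψ : MvPolynomial (Fin n) ℂ →ₐ[ℂ] Polynomial (MvPolynomial (Fin n) ℂ) :=
    aeval (fun i => Polynomial.C (X i) * Polynomial.X)
  have hev : ∀ p, (ψ p).eval 1 = p := by
    intro p
    have : ((Polynomial.aeval (1 : MvPolynomial (Fin n) ℂ)).restrictScalars ℂ).comp ψ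
        = AlgHom.id ℂ _ := by
      apply MvPolynomial.algHom_ext
      intro i
      simp [ψ]
    have := DFunLike.congr_fun this p
    simpa [Polynomial.aeval_def] using this
  have hev0 : ∀ p, (ψ p).coeff 0 = C (constantCoeff p) := by
    intro p
    have : ((Polynomial.aeval (0 : MvPolynomial (Fin n) ℂ)).restrictScalars ℂ).comp ψ
        = killHom n n := by
      apply MvPolynomial.algHom_ext
      intro i
      simp [ψ, killHom]
    have := DFunLike.congr_fun this p
    rw [killHom_full] at this
    rw [← this, Polynomial.coeff_zero_eq_eval_zero]
    simp [Polynomial.aeval_def]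
  have hψf : ψ f = Polynomial.C f * Polynomial.X ^ d := by
    have key : ∀ m ∈ f.support, ψ (monomial m (coeff m f)) =
        Polynomial.C (monomial m (coeff m f)) * Polynomial.X ^ d := by
      intro m hm
      have hd : m.degree = d := by
        have := hf (mem_support_iff.mp hm)
        rw [Finsupp.degree_eq_weight_one]; exact this
      rw [aeval_monomial, monomial_eq, Finsupp.prod, Finsupp.prod]
      simp only [mul_pow, Finset.prod_mul_distrib, Finset.prod_pow_eq_pow_sum, map_mul, map_prod,
        map_pow]
      rw [← mul_assoc, ← hd]
      rfl
    conv_lhs => rw [f.as_sum]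
    conv_rhs => rw [f.as_sum]
    rw [map_sum, map_sum, Finset.sum_mul]
    exact Finset.sum_congr rfl key
  have hψgh : ψ g * ψ h = Polynomial.C f * Polynomial.X ^ d := by
    rw [← hψf, hgh, map_mul]
  have hne : ψ g * ψ h ≠ 0 := by
    rw [hψgh]
    exact mul_ne_zero (by simpa using hf0) (pow_ne_zero _ Polynomial.X_ne_zero)
  have hg0 := left_ne_zero_of_mul hne
  have hh0 := right_ne_zero_of_mul hne
  have e1 := Polynomial.natDegree_mul hg0 hh0
  have e2 := Polynomial.natTrailingDegree_mul hg0 hh0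
  rw [hψgh, Polynomial.natDegree_C_mul_X_pow _ _ hf0] at e1
  rw [hψgh, Polynomial.C_mul_X_pow_eq_monomial, Polynomial.natTrailingDegree_monomial hf0] at e2
  have e3 : (ψ h).natTrailingDegree = 0 := by
    rw [Polynomial.natTrailingDegree_eq_zero]
    right
    rw [hev0]
    simpa using hh
  have e4 := Polynomial.natTrailingDegree_le_natDegree (ψ g)
  have e5 : (ψ h).natDegree = 0 := by omega
  have e6 := Polynomial.eq_C_of_natDegree_eq_zero e5
  have e7 := hev h
  rw [e6, Polynomial.eval_C, hev0] at e7
  rw [← e7]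
  exact (isUnit_iff_ne_zero.mpr hh).map C

lemma no_factor (n d : ℕ) (hn : 4 ≤ n) (hd : 3 ≤ d)
    (a : Fin n → ℂ) (i0 : Fin n) (ha : a i0 ≠ 0) (g h : MvPolynomial (Fin n) ℂ)
    (hf : ((∑ i, X i ^ d) + (∑ j, C (a j) * X j) ^ d : MvPolynomial (Fin n) ℂ) = g * h)
    (hg : constantCoeff g = 0) (hh : constantCoeff h = 0) : False := by
  classical
  let s : Finset (MvPolynomial (Fin n) ℂ) := {g, h, X i0}
  have hder : ∀ i, (X i ^ (d-1) + C (a i) * (∑ j, C (a j) * X j) ^ (d-1) : MvPolynomial (Fin n) ℂ)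
      ∈ Ideal.span (s : Set (MvPolynomial (Fin n) ℂ)) := by
    intro i
    have hL : pderiv i (∑ j, C (a j) * X j : MvPolynomial (Fin n) ℂ) = C (a i) := by
      simp [pderiv_X, Pi.single_apply]
    have hS : pderiv i (∑ j, X j ^ d : MvPolynomial (Fin n) ℂ) = (d : MvPolynomial (Fin n) ℂ) * X i ^ (d-1) := by
      simp [pderiv_X, Derivation.leibniz_pow, Pi.single_apply]
    have h1 := congrArg (pderiv i) hf
    rw [map_add, hS, Derivation.leibniz_pow, hL, Derivation.leibniz] at h1
    have hgm : g ∈ Ideal.span (s : Set (MvPolynomial (Fin n) ℂ)) :=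
      Ideal.subset_span (by simp [s])
    have hhm : h ∈ Ideal.span (s : Set (MvPolynomial (Fin n) ℂ)) :=
      Ideal.subset_span (by simp [s])
    have h2 : g • pderiv i h + h • pderiv i g ∈ Ideal.span (s : Set (MvPolynomial (Fin n) ℂ)) :=
      Ideal.add_mem _ (Ideal.mul_mem_right _ _ hgm) (Ideal.mul_mem_right _ _ hhm)
    rw [← h1] at h2
    have h3 := Ideal.mul_mem_left _ (C ((d:ℂ)⁻¹)) h2
    have hd0 : (C ((d:ℂ)⁻¹) * (d : MvPolynomial (Fin n) ℂ)) = 1 := by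
      rw [← map_natCast (C : ℂ →+* MvPolynomial (Fin n) ℂ), ← C_mul, inv_mul_cancel₀, C_1]
      exact_mod_cast (by omega : d ≠ 0)
    convert h3 using 1
    simp only [nsmul_eq_mul, smul_eq_mul]
    linear_combination (-(X i ^ (d-1) + C (a i) * (∑ j, C (a j) * X j) ^ (d-1))) * hd0
  have hmin : RingHom.ker (killHom n n) ∈ (Ideal.span (s : Set (MvPolynomial (Fin n) ℂ))).minimalPrimes := by
    refine ⟨⟨inferInstance, ?_⟩, ?_⟩
    · rw [Ideal.span_le]
      intro p hp
      simp only [s, Finset.coe_insert, Finset.coe_singleton, Set.mem_insert_iff,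
        Set.mem_singleton_iff] at hp
      rw [SetLike.mem_coe, RingHom.mem_ker, killHom_full]
      rcases hp with rfl | rfl | rfl
      · simp [hg]
      · simp [hh]
      · simp
    · rintro P ⟨hP, hIP⟩ -
      have hd' : d - 1 ≠ 0 := by omega
      have hX0 : X i0 ∈ P := hIP (Ideal.subset_span (by simp [s]))
      have hL : (∑ j, C (a j) * X j : MvPolynomial (Fin n) ℂ) ^ (d-1) ∈ P := by
        have h1 := hIP (hder i0)
        have h2 := (Ideal.add_mem_iff_right P (Ideal.pow_mem_of_mem P hX0 (d-1) (by omega))).mp h1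
        have h3 := P.mul_mem_left (C (a i0)⁻¹) h2
        rwa [← mul_assoc, ← C_mul, inv_mul_cancel₀ ha, C_1, one_mul] at h3
      have hX : ∀ i, X i ∈ P := by
        intro i
        have h1 := hIP (hder i)
        have h2 := (Ideal.add_mem_iff_left P (P.mul_mem_left (C (a i)) hL)).mp h1
        exact hP.mem_of_pow_mem _ h2
      intro p hp
      rw [RingHom.mem_ker, killHom_full] at hp
      have hq : ∀ q : MvPolynomial (Fin n) ℂ, q - C (constantCoeff q) ∈ P := by
        intro q
        induction q using MvPolynomial.induction_on with
        | C r => simp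
        | add p q hp hq =>
          have := P.add_mem hp hq
          convert this using 1
          simp only [map_add]; ring
        | mul_X p i hp =>
          simpa using P.mul_mem_left p (hX i)
      have := hq p
      rwa [hp, sub_zero] at this
  have h1 := Ideal.height_le_card_of_mem_minimalPrimes_span_finset hmin
  have h2 := killHom_height n n le_rfl
  have h3 : (n : ℕ∞) ≤ s.card := h2.trans h1
  have h4 : n ≤ s.card := by exact_mod_cast h3
  have h5 : s.card ≤ 3 := Finset.card_le_three
  omega

/-- For `n ≥ 4`, `d ≥ 3`, `2 ≤ k ≤ n` and nonzero `a_1, …, a_k`, the polynomial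
`f = x_1^d + ⋯ + x_n^d + (a_1 x_1 + ⋯ + a_k x_k)^d` is irreducible in `ℂ[x_1, …, x_n]`. -/
theorem stmt7 (n d k : ℕ) (hn : 4 ≤ n) (hd : 3 ≤ d) (hk2 : 2 ≤ k) (hkn : k ≤ n)
    (a : Fin n → ℂ) (ha : ∀ j : Fin n, (j : ℕ) < k → a j ≠ 0)
    (ha' : ∀ j : Fin n, k ≤ (j : ℕ) → a j = 0) :
    Irreducible ((∑ i, X i ^ d) + (∑ j, C (a j) * X j) ^ d : MvPolynomial (Fin n) ℂ) := by
  have hd0 : d ≠ 0 := by omega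
  have key := no_factor n d hn hd a ⟨0, by omega⟩ (ha _ (by simp; omega))
  have hhom : ((∑ i, X i ^ d) + (∑ j, C (a j) * X j) ^ d : MvPolynomial (Fin n) ℂ).IsHomogeneous d := by
    apply IsHomogeneous.add
    · exact IsHomogeneous.sum _ _ _ fun i _ => isHomogeneous_X_pow i d
    · have : (∑ j, C (a j) * X j : MvPolynomial (Fin n) ℂ).IsHomogeneous 1 :=
        IsHomogeneous.sum _ _ _ fun i _ => isHomogeneous_C_mul_X _ _
      simpa using this.pow d
  have hcc : constantCoeff ((∑ i, X i ^ d) + (∑ j, C (a j) * X j) ^ d : MvPolynomial (Fin n) ℂ) = 0 := by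
    simp [hd0]
  generalize ((∑ i, X i ^ d) + (∑ j, C (a j) * X j) ^ d : MvPolynomial (Fin n) ℂ) = f at *
  have hf0 : f ≠ 0 := fun h => key 0 0 (by simp [h]) (by simp) (by simp)
  refine ⟨fun hu => ?_, fun g h hgh => ?_⟩
  · have := hu.map (constantCoeff (R := ℂ) (σ := Fin n))
    rw [hcc] at this
    exact not_isUnit_zero this
  · by_cases h1 : constantCoeff h = 0
    · by_cases h2 : constantCoeff g = 0
      · exact (key g h hgh h2 h1).elim
      · left
        exact unit_of_hom n d f h g hhom hf0 (by rw [hgh, mul_comm]) h2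
    · right
      exact unit_of_hom n d f g h hhom hf0 hgh h1
end

section
/- Let n ≥ 3 and let d ≥ 3 be odd. Consider f = (n−2)^{d−1}(x_1^d + ⋯ + x_n^d) − (x_1 + ⋯ + x_n)^d (a generalized Cayley hypersurface). Then for each i = 1, …, n, the point p^i ∈ ℙ^{n−1} whose coordinates are p^i_j = 1 for j ≠ i and p^i_i = −1 is a singular point of the hypersurface V : f = 0, and each p^i is a node: the n×n Hessian matrix of f evaluated at p^i has rank n−1. -/
open MvPolynomial

lemma aux_pd_sum (n : ℕ) (l : Fin n) : pderiv l (∑ i, X i : MvPolynomial (Fin n) ℂ) = 1 := by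
  rw [map_sum, Finset.sum_eq_single l]
  · simp
  · intro b _ hb
    exact pderiv_X_of_ne hb
  · simp

lemma aux_pd1 (n d : ℕ) (c : ℂ) (l : Fin n) :
    pderiv l (C c * (∑ i, X i ^ d) - (∑ i, X i) ^ d : MvPolynomial (Fin n) ℂ)
      = C (c * d) * X l ^ (d - 1) - C (d : ℂ) * (∑ i, X i) ^ (d - 1) := by
  have h : pderiv l (∑ i, X i ^ d : MvPolynomial (Fin n) ℂ) = C (d : ℂ) * X l ^ (d - 1) := by
    rw [map_sum, Finset.sum_eq_single l]
    · rw [pderiv_pow, pderiv_X_self]; simp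
    · intro b _ hb
      rw [pderiv_pow, pderiv_X_of_ne hb, mul_zero]
    · simp
  rw [map_sub, pderiv_C_mul, h, pderiv_pow, aux_pd_sum, C_mul]
  simp [mul_assoc]

lemma aux_pd2 (n d : ℕ) (c : ℂ) (j l : Fin n) :
    pderiv j (C c * X l ^ d - C (d + 1 : ℂ) * (∑ i, X i) ^ d : MvPolynomial (Fin n) ℂ)
      = (if j = l then C (c * d) * X l ^ (d - 1) else 0)
        - C ((d + 1) * d : ℂ) * (∑ i, X i) ^ (d - 1) := by
  rw [map_sub, pderiv_C_mul, pderiv_C_mul, pderiv_pow, pderiv_pow, aux_pd_sum]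
  split_ifs with h
  · subst h
    rw [pderiv_X_self]
    simp [mul_assoc]
  · rw [pderiv_X_of_ne (Ne.symm h)]
    simp [mul_assoc]

/-- statement -/
theorem stmt8 (n d : ℕ) (hn : 3 ≤ n) (hd : 3 ≤ d) (hodd : Odd d)
    (f : MvPolynomial (Fin n) ℂ)
    (hf : f = C (((n : ℂ) - 2) ^ (d - 1)) * (∑ i, X i ^ d) - (∑ i, X i) ^ d)
    (i : Fin n) (p : Fin n → ℂ) (hp : p = fun j => if j = i then -1 else 1) :
    (∀ j, eval p (pderiv j f) = 0) ∧
    (Matrix.of fun j l : Fin n => eval p (pderiv j (pderiv l f))).rank = n - 1 := by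
  have hm : (n : ℂ) - 2 ≠ 0 := by
    rw [sub_ne_zero]
    exact_mod_cast (by omega : n ≠ 2)
  have hs : ∑ j, p j = (n : ℂ) - 2 := by
    have : ∀ j, p j = 1 + (if j = i then (-2 : ℂ) else 0) := by
      intro j; rw [hp]; dsimp only; split_ifs <;> norm_num
    simp_rw [this]
    rw [Finset.sum_add_distrib]
    simp
    ring
  have hp2 : ∀ j, p j * p j = 1 := by
    intro j; rw [hp]; dsimp only; split_ifs <;> norm_num
  obtain ⟨k, rfl⟩ : ∃ k, d = 2 * k + 3 := by
    obtain ⟨a, ha⟩ := hodd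
    exact ⟨a - 1, by omega⟩
  have hpe : ∀ j, p j ^ (2 * k + 2) = 1 := by
    intro j
    rw [show 2 * k + 2 = 2 * (k + 1) by ring, pow_mul, pow_two, hp2, one_pow]
  have hpo : ∀ j, p j ^ (2 * k + 1) = p j := by
    intro j
    rw [pow_succ, pow_mul, pow_two, hp2, one_pow, one_mul]
  set m := (n : ℂ) - 2 with hmdef
  have h1 : ∀ l, pderiv l f = C (m ^ (2 * k + 2) * ((2 * k + 2 : ℕ) + 1 : ℂ)) * X l ^ (2 * k + 2)
      - C ((2 * k + 2 : ℕ) + 1 : ℂ) * (∑ i, X i) ^ (2 * k + 2) := by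
    intro l
    rw [hf, aux_pd1]
    simp only [show 2 * k + 3 - 1 = 2 * k + 2 by omega]
    have : ((2 * k + 3 : ℕ) : ℂ) = ((2 * k + 2 : ℕ) : ℂ) + 1 := by push_cast; ring
    rw [this]
  refine ⟨?_, ?_⟩
  · intro j
    rw [h1]
    simp only [map_sub, map_mul, map_pow, eval_C, eval_X, map_sum, hs, hpe]
    ring
  · obtain ⟨c, hc, hH⟩ : ∃ c : ℂ, c ≠ 0 ∧ ∀ j l, eval p (pderiv j (pderiv l f))
        = c * ((if j = l then m * p l else 0) - 1) := by
      refine ⟨((2 * k + 2 : ℕ) + 1 : ℂ) * (2 * k + 2 : ℕ) * m ^ (2 * k + 1), ?_, ?_⟩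
      · refine mul_ne_zero (mul_ne_zero ?_ ?_) (pow_ne_zero _ hm)
        · exact Nat.cast_add_one_ne_zero _
        · exact Nat.cast_ne_zero.mpr (by omega)
      · intro j l
        rw [h1, aux_pd2]
        simp only [show 2 * k + 2 - 1 = 2 * k + 1 by omega]
        split_ifs
        · simp only [map_sub, map_mul, map_pow, eval_C, eval_X, map_sum, hs, hpo]
          ring
        · simp only [map_sub, map_mul, map_pow, eval_C, map_zero, eval_X, map_sum, hs]
          ring
    set M := (Matrix.of fun j l : Fin n => eval p (pderiv j (pderiv l f))) with hM
    have hmv : ∀ v j, M.mulVec v j = c * (m * p j * v j - ∑ l, v l) := by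
      intro v j
      simp only [Matrix.mulVec, dotProduct, hM, Matrix.of_apply, hH]
      simp only [mul_assoc, sub_mul, ite_mul, zero_mul, one_mul]
      rw [← Finset.mul_sum, Finset.sum_sub_distrib]
      simp
    have hker : LinearMap.ker M.mulVecLin = Submodule.span ℂ {p} := by
      ext v
      rw [LinearMap.mem_ker, Submodule.mem_span_singleton, Matrix.mulVecLin_apply]
      constructor
      · intro h
        refine ⟨(∑ l, v l) / m, ?_⟩
        ext j
        have hj := congrFun h j
        rw [hmv] at hj
        have hj' : m * p j * v j - ∑ l, v l = 0 := by simpa [hc] using hj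
        rw [Pi.smul_apply, smul_eq_mul, ← sub_eq_zero.mp hj']
        field_simp
        linear_combination v j * hp2 j
      · rintro ⟨a, rfl⟩
        ext j
        rw [hmv]
        simp only [Pi.smul_apply, smul_eq_mul, ← Finset.mul_sum, hs, Pi.zero_apply]
        linear_combination c * m * a * hp2 j
    have hp0 : p ≠ 0 := by
      intro h
      have := hp2 i
      rw [h] at this
      simp at this
    have hrn := LinearMap.finrank_range_add_finrank_ker M.mulVecLin
    rw [hker, finrank_span_singleton hp0, Module.finrank_fin_fun] at hrn
    rw [Matrix.rank]
    omega
end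

section
/- Let d ≥ 3 be odd and let a, b be nonzero complex numbers. Then the polynomial f = x^d + y^d + z^d + (ax + by)^d is irreducible in ℂ[x, y, z]. -/
open MvPolynomial

lemma aux_deriv {h F : MvPolynomial (Fin 2) ℂ} (n : ℕ) (i : Fin 2) (hF : h ^ (n + 1) ∣ F) :
    h ^ n ∣ pderiv i F := by
  obtain ⟨q, rfl⟩ := hF
  rw [pderiv_mul, pderiv_pow]
  refine ⟨((n + 1 : ℕ) : MvPolynomial (Fin 2) ℂ) * pderiv i h * q + h * pderiv i q, ?_⟩
  simp only [Nat.add_sub_cancel]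
  ring

lemma aux_pow (n : ℕ) (a b : ℂ) (ha : a ≠ 0) (hb : b ≠ 0) (h : MvPolynomial (Fin 2) ℂ)
    (hg : h ^ 3 ∣ (X 0) ^ (n + 3) + (X 1) ^ (n + 3) + (C a * X 0 + C b * X 1) ^ (n + 3)) :
    IsUnit h := by
  set l : MvPolynomial (Fin 2) ℂ := C a * X 0 + C b * X 1 with hl
  have l0 : pderiv 0 l = C a := by simp [hl, pderiv_X]
  have l1 : pderiv 1 l = C b := by simp [hl, pderiv_X]
  have x01 : pderiv 0 (X 1 : MvPolynomial (Fin 2) ℂ) = 0 := by simp [pderiv_X]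
  have x10 : pderiv 1 (X 0 : MvPolynomial (Fin 2) ℂ) = 0 := by simp [pderiv_X]
  have c0 (m : ℕ) (i : Fin 2) : pderiv i (m : MvPolynomial (Fin 2) ℂ) = 0 := by simp
  have h00 := aux_deriv 1 0 (aux_deriv 2 0 hg)
  have h01 := aux_deriv 1 1 (aux_deriv 2 0 hg)
  have h11 := aux_deriv 1 1 (aux_deriv 2 1 hg)
  have e1 : n + 3 - 1 = n + 2 := by omega
  have e2 : n + 2 - 1 = n + 1 := by omega
  simp only [pow_one, map_add, pderiv_pow, pderiv_mul, l0, l1, x01, x10, c0, pderiv_X_self,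
    pderiv_C, pderiv_one, map_zero, e1, e2] at h00 h01 h11
  have hu (c : ℂ) (hc : c ≠ 0) : IsUnit (C c : MvPolynomial (Fin 2) ℂ) :=
    (isUnit_iff_ne_zero.mpr hc).map C
  have hN (m : ℕ) (hm : m ≠ 0) : IsUnit (m : MvPolynomial (Fin 2) ℂ) := by
    have := hu m (by exact_mod_cast hm)
    simpa using this
  have hc : IsUnit (((n + 3 : ℕ) : MvPolynomial (Fin 2) ℂ) * ((n + 2 : ℕ))) :=
    (hN _ (by omega)).mul (hN _ (by omega))
  have hL : h ∣ l ^ (n + 1) := by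
    rw [← (hc.mul ((hu a ha).mul (hu b hb))).dvd_mul_left]
    convert h01 using 1
    ring
  have hX : h ∣ X 0 ^ (n + 1) := by
    rw [← hc.dvd_mul_left]
    have := dvd_sub h00 (hL.mul_left
      (((n + 3 : ℕ) : MvPolynomial (Fin 2) ℂ) * ((n + 2 : ℕ) : MvPolynomial (Fin 2) ℂ) * C a * C a))
    convert this using 1
    ring
  have hY : h ∣ X 1 ^ (n + 1) := by
    rw [← hc.dvd_mul_left]
    have := dvd_sub h11 (hL.mul_left
      (((n + 3 : ℕ) : MvPolynomial (Fin 2) ℂ) * ((n + 2 : ℕ) : MvPolynomial (Fin 2) ℂ) * C b * C b))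
    convert this using 1
    ring
  have p0 : Prime (X 0 : MvPolynomial (Fin 2) ℂ) := MvPolynomial.X_prime
  obtain ⟨i, -, hi⟩ := (dvd_prime_pow p0 _).1 hX
  rcases Nat.eq_zero_or_pos i with rfl | hi0
  · rw [pow_zero] at hi
    exact associated_one_iff_isUnit.1 hi
  · have h1 : (X 0 : MvPolynomial (Fin 2) ℂ) ∣ X 1 ^ (n + 1) :=
      ((dvd_pow_self _ hi0.ne').trans hi.symm.dvd).trans hY
    have h2 := p0.dvd_of_dvd_pow h1
    rw [X_dvd_X] at h2
    simp at h2

/-- For `d ≥ 3` odd and nonzero complex numbers `a`, `b`, the polynomial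
`f = x^d + y^d + z^d + (a x + b y)^d` is irreducible in `ℂ[x, y, z]`. -/
theorem stmt9 (d : ℕ) (hd : 3 ≤ d) (hodd : Odd d) (a b : ℂ) (ha : a ≠ 0) (hb : b ≠ 0) :
    Irreducible ((X 0) ^ d + (X 1) ^ d + (X 2) ^ d + (C a * X 0 + C b * X 1) ^ d :
      MvPolynomial (Fin 3) ℂ) := by
  let e := (renameEquiv ℂ (finRotate 3)).trans (finSuccEquiv ℂ 2)
  set g : MvPolynomial (Fin 2) ℂ := (X 0) ^ d + (X 1) ^ d + (C a * X 0 + C b * X 1) ^ d with hg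
  have e0 : e (X 0) = Polynomial.C (X 0) := by
    have : finRotate 3 0 = (0 : Fin 2).succ := by decide
    simp only [e, AlgEquiv.trans_apply, renameEquiv_apply, rename_X, this, finSuccEquiv_X_succ]
  have e1 : e (X 1) = Polynomial.C (X 1) := by
    have : finRotate 3 1 = (1 : Fin 2).succ := by decide
    simp only [e, AlgEquiv.trans_apply, renameEquiv_apply, rename_X, this, finSuccEquiv_X_succ]
  have e2 : e (X 2) = Polynomial.X := by
    have : finRotate 3 2 = 0 := by decide
    simp only [e, AlgEquiv.trans_apply, renameEquiv_apply, rename_X, this, finSuccEquiv_X_zero]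
  have eC (c : ℂ) : e (C c) = Polynomial.C (C c) := by
    simp [e, finSuccEquiv_apply]
  rw [← MulEquiv.irreducible_iff e]
  have key : e ((X 0) ^ d + (X 1) ^ d + (X 2) ^ d + (C a * X 0 + C b * X 1) ^ d)
      = Polynomial.X ^ d - Polynomial.C (-g) := by
    simp only [map_add, map_pow, map_mul, e0, e1, e2, eC, hg, map_neg]
    ring
  rw [key]
  have hmon : (Polynomial.X ^ d - Polynomial.C (-g)).Monic :=
    Polynomial.monic_X_pow_sub_C _ (by omega)
  rw [hmon.irreducible_iff_irreducible_map_fraction_map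
    (K := FractionRing (MvPolynomial (Fin 2) ℂ))]
  rw [Polynomial.map_sub, Polynomial.map_pow, Polynomial.map_X, Polynomial.map_C]
  refine X_pow_sub_C_irreducible_of_odd hodd ?_
  intro p hp hpd w hw
  have hp3 : 3 ≤ p := by
    have h2 := hp.two_le
    rcases h2.eq_or_lt with h | h
    · subst h
      exact absurd hpd (by rw [← even_iff_two_dvd]; simpa using hodd)
    · exact h
  obtain ⟨h, rfl⟩ := IsIntegrallyClosed.exists_algebraMap_eq_of_isIntegral_pow
    (R := MvPolynomial (Fin 2) ℂ) hp.pos (hw ▸ isIntegral_algebraMap)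
  rw [← map_pow] at hw
  have hw' : h ^ p = -g := IsFractionRing.injective _ _ hw
  have hdvd : h ^ 3 ∣ g := by
    rw [← dvd_neg, ← hw']
    exact pow_dvd_pow _ hp3
  obtain ⟨n, rfl⟩ : ∃ n, d = n + 3 := ⟨d - 3, by omega⟩
  have hu := (aux_pow n a b ha hb h hdvd).pow p
  rw [hw'] at hu
  have := hu.map (constantCoeff (R := ℂ) (σ := Fin 2))
  simp [hg] at this
end

section
/- Let d = 2d' ≥ 4 be even and let a, b be nonzero complex numbers, and set f = x^d + y^d + z^d + (ax + by)^d ∈ ℂ[x,y,z]. Then f is squarefree and has at most two irreducible factors (up to units). If f = f_1 · f_2 with f_1, f_2 non-associated irreducible polynomials, then both plane curves f_1 = 0 and f_2 = 0 are smooth, and the polynomials g_1(t) = b t^{d−1} − a and g_2(t) = b(at + b)^{d−1} + 1 have exactly d' common roots in ℂ. Moreover, when d' = 2 (d = 4), conversely, if g_1 and g_2 have d' = 2 common roots, then f is reducible. -/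
open MvPolynomial

lemma aux_sq {R : Type*} [CommRing R] [IsDomain R] [UniqueFactorizationMonoid R] (h : R) :
    (∀ π : R, Prime π → π ∣ h → π ^ 2 ∣ h ∧ ¬ π ^ 3 ∣ h) → ∃ k, Associated h (k ^ 2) := by
  refine UniqueFactorizationMonoid.induction_on_coprime h ?_ ?_ ?_ ?_
  · intro _; exact ⟨0, by simp⟩
  · intro x hx _; exact ⟨1, by simpa using associated_one_iff_isUnit.2 hx⟩
  · intro p i hp H
    rcases i with _ | _ | _ | i
    · exact ⟨1, by simp⟩
    · exfalso
      have := (H p hp (by simp)).1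
      have h2 : p ^ 2 ∣ p ^ 1 := by simpa using this
      rw [pow_dvd_pow_iff hp.ne_zero hp.not_isUnit] at h2
      omega
    · exact ⟨p, Associated.refl _⟩
    · exact absurd (pow_dvd_pow p (by omega)) (H p hp (dvd_pow_self _ (by omega))).2
  · intro x y hxy ihx ihy H
    have key : ∀ x y : R, IsRelPrime x y → (∀ π : R, Prime π → π ∣ x * y → π ^ 2 ∣ x * y ∧ ¬ π ^ 3 ∣ x * y) →
        (∀ π : R, Prime π → π ∣ x → π ^ 2 ∣ x ∧ ¬ π ^ 3 ∣ x) := by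
      intro x y hxy H π hπ hx
      have hy : ¬ π ∣ y := fun hy => hπ.not_isUnit (hxy hx hy)
      obtain ⟨h1, h2⟩ := H π hπ (hx.mul_right y)
      exact ⟨hπ.pow_dvd_of_dvd_mul_right 2 hy h1, fun h3 => h2 (h3.mul_right y)⟩
    obtain ⟨k, hk⟩ := ihx (key x y hxy H)
    obtain ⟨l, hl⟩ := ihy (key y x hxy.symm (by simpa [mul_comm] using H))
    exact ⟨k * l, by rw [mul_pow]; exact hk.mul_mul hl⟩

lemma aux_eis {R : Type*} [CommRing R] [IsDomain R] (π c : R) (hπ : Prime π) (h1 : π ∣ c)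
    (h2 : ¬ π ^ 2 ∣ c) (n : ℕ) (hn : 0 < n) :
    Irreducible (Polynomial.X ^ n + Polynomial.C c : Polynomial R) := by
  have hm : (Polynomial.X ^ n + Polynomial.C c : Polynomial R).Monic :=
    Polynomial.monic_X_pow_add_C c hn.ne'
  refine Polynomial.irreducible_of_eisenstein_criterion (P := Ideal.span {π})
    ((Ideal.span_singleton_prime hπ.ne_zero).2 hπ) ?_ ?_ ?_ ?_ hm.isPrimitive
  · rw [hm.leadingCoeff, Ideal.mem_span_singleton]
    exact fun h => hπ.not_isUnit (isUnit_of_dvd_one h)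
  · intro m hmn
    rw [Polynomial.degree_X_pow_add_C hn] at hmn
    have hmn : m < n := by exact_mod_cast hmn
    rw [Ideal.mem_span_singleton, Polynomial.coeff_add, Polynomial.coeff_X_pow, if_neg hmn.ne,
      Polynomial.coeff_C]
    split_ifs <;> simp [h1]
  · rw [Polynomial.degree_X_pow_add_C hn]; exact_mod_cast hn
  · rw [Ideal.span_singleton_pow, Ideal.mem_span_singleton]
    simpa [Polynomial.coeff_X_pow, hn.ne] using h2

lemma aux_d2 (e : ℕ) (a b : ℂ) :
    pderiv 1 (pderiv 0 ((X 0) ^ (e+2) + (X 1) ^ (e+2) + (C a * X 0 + C b * X 1) ^ (e+2) : MvPolynomial (Fin 2) ℂ))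
      = C (((e+2)*(e+1) : ℂ) * a * b) * (C a * X 0 + C b * X 1) ^ e ∧
    pderiv 0 (pderiv 0 ((X 0) ^ (e+2) + (X 1) ^ (e+2) + (C a * X 0 + C b * X 1) ^ (e+2) : MvPolynomial (Fin 2) ℂ))
      = C ((e+2)*(e+1) : ℂ) * (X 0 ^ e + C a * (C a * (C a * X 0 + C b * X 1) ^ e)) := by
  have h2 : ∀ i, pderiv i (2 : MvPolynomial (Fin 2) ℂ) = 0 := by
    intro i
    exact_mod_cast (pderiv (R := ℂ) i).map_natCast 2
  have h3 : (C 2 : MvPolynomial (Fin 2) ℂ) = 2 := map_ofNat C 2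
  constructor <;>
  · simp [Derivation.leibniz, Derivation.leibniz_pow, pderiv_X, h2, h3]
    try ring

lemma aux_dvd (i : Fin 2) (π g : MvPolynomial (Fin 2) ℂ) (n : ℕ) (h : π ^ (n+1) ∣ g) :
    π ^ n ∣ pderiv i g := by
  obtain ⟨r, rfl⟩ := h
  rw [Derivation.leibniz, Derivation.leibniz_pow]
  simp only [smul_eq_mul, nsmul_eq_mul, Nat.add_sub_cancel]
  refine ⟨π * pderiv i r + r * (((n+1 : ℕ) : MvPolynomial (Fin 2) ℂ) * pderiv i π), by ring⟩

lemma aux_cube (d : ℕ) (hd : 4 ≤ d) (a b : ℂ) (ha : a ≠ 0) (hb : b ≠ 0)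
    (π : MvPolynomial (Fin 2) ℂ) (hπ : Prime π) :
    ¬ π ^ 3 ∣ (X 0) ^ d + (X 1) ^ d + (C a * X 0 + C b * X 1) ^ d := by
  intro hr
  obtain ⟨e, rfl⟩ : ∃ e, d = e + 2 := ⟨d - 2, by omega⟩
  have hC : ∀ c : ℂ, c ≠ 0 → ∀ x, π ∣ C c * x → π ∣ x := by
    intro c hc x hx
    have : IsUnit (C c : MvPolynomial (Fin 2) ℂ) := (IsUnit.mk0 c hc).map C
    exact (this.dvd_mul_left).1 hx
  have e1 := aux_dvd 1 _ _ 1 (aux_dvd 0 _ _ 2 hr)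
  have e2 := aux_dvd 0 _ _ 1 (aux_dvd 0 _ _ 2 hr)
  rw [(aux_d2 e a b).1, pow_one] at e1
  rw [(aux_d2 e a b).2, pow_one] at e2
  have hne : ((e+2)*(e+1) : ℂ) ≠ 0 := by
    refine mul_ne_zero ?_ ?_ <;> norm_cast
  have e1 := hC _ (mul_ne_zero (mul_ne_zero hne ha) hb) _ e1
  have e2 := hC _ hne _ e2
  have e3 : π ∣ X 0 := hπ.dvd_of_dvd_pow
    ((dvd_add_left ((e1.mul_left _).mul_left _)).1 e2)
  have e4 : π ∣ X 1 := hC b hb _ ((dvd_add_right (e3.mul_left (C a))).1 (hπ.dvd_of_dvd_pow e1))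
  have e5 : Associated π (X 0) := hπ.associated_of_dvd (X_prime) e3
  have := e5.symm.dvd.trans e4
  rw [X_dvd_X] at this
  simp at this

lemma aux_sing (d : ℕ) (hd : 4 ≤ d) (a b : ℂ) (ha : a ≠ 0) (hb : b ≠ 0)
    (k : MvPolynomial (Fin 2) ℂ)
    (hk : (X 0) ^ d + (X 1) ^ d + (C a * X 0 + C b * X 1) ^ d = - k ^ 2) (p : Fin 2 → ℂ)
    (h0 : eval p k = 0) (h1 : ∀ i, eval p (pderiv i k) = 0) : p = 0 := by
  obtain ⟨e, rfl⟩ : ∃ e, d = e + 2 := ⟨d - 2, by omega⟩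
  have D : ∀ i j, eval p (pderiv i (pderiv j (-k ^ 2))) = 0 := by
    intro i j
    simp [Derivation.leibniz, Derivation.leibniz_pow, h0, h1]
  have e1 := D 1 0
  have e2 := D 0 0
  rw [← hk] at e1 e2
  rw [(aux_d2 e a b).1] at e1
  rw [(aux_d2 e a b).2] at e2
  have hne : ((e+2)*(e+1) : ℂ) ≠ 0 := by
    refine mul_ne_zero ?_ ?_ <;> norm_cast
  have hne2 := mul_ne_zero (mul_ne_zero hne ha) hb
  rw [map_mul, eval_C] at e1 e2
  have e1 := (mul_eq_zero.1 e1).resolve_left hne2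
  have e2 := (mul_eq_zero.1 e2).resolve_left hne
  have he : e ≠ 0 := by omega
  simp only [map_add, map_mul, map_pow, eval_C, eval_X] at e1 e2
  rw [e1] at e2
  have e1 := eq_zero_of_pow_eq_zero e1
  have e2 : p 0 = 0 := eq_zero_of_pow_eq_zero (n := e) (by simpa using e2)
  have e3 : p 1 = 0 := by simpa [e2, hb] using e1
  ext i; fin_cases i <;> simp [e2, e3]

lemma aux_struct (d d' : ℕ) (hd' : 2 ≤ d') (hd : d = 2 * d')
    (a b : ℂ) (ha : a ≠ 0) (hb : b ≠ 0) (h : MvPolynomial (Fin 2) ℂ)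
    (hh : h = (X 0) ^ d + (X 1) ^ d + (C a * X 0 + C b * X 1) ^ d) :
    Irreducible (Polynomial.X ^ d + Polynomial.C h) ∨
    ∃ k, h = - k ^ 2 ∧ k ≠ 0 ∧ Irreducible (Polynomial.X ^ d' + Polynomial.C k) ∧
      Irreducible (Polynomial.X ^ d' + Polynomial.C (-k)) := by
  have hcube : ∀ π, Prime π → ¬ π ^ 3 ∣ h := fun π hπ =>
    hh ▸ aux_cube d (by omega) a b ha hb π hπ
  have h0 : h ≠ 0 := by
    rintro h0
    exact hcube (X 0) (X_prime) (by simp [h0])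
  have hu : ¬ IsUnit h := by
    intro hu
    have := hu.map (eval (0 : Fin 2 → ℂ))
    have hd0 : d ≠ 0 := by omega
    simp [hh, hd0] at this
  by_cases H : ∃ π, Prime π ∧ π ∣ h ∧ ¬ π ^ 2 ∣ h
  · obtain ⟨π, h1, h2, h3⟩ := H
    exact Or.inl (aux_eis π h h1 h2 h3 d (by omega))
  · right
    push Not at H
    obtain ⟨k, u, hk⟩ := aux_sq h fun π hπ hd => ⟨H π hπ hd, hcube π hπ⟩
    obtain ⟨c, hc, hcu⟩ := MvPolynomial.isUnit_iff_eq_C_of_isReduced.1 (u⁻¹).isUnit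
    have hk' : h = C c * k ^ 2 := by
      rw [← hcu, ← hk, mul_comm, mul_assoc, Units.mul_inv, mul_one]
    obtain ⟨s, hs⟩ := IsAlgClosed.exists_pow_nat_eq (-c) (n := 2) (by norm_num)
    have hK : h = - (C s * k) ^ 2 := by
      rw [mul_pow, ← C_pow, hs, hk']; simp
    generalize C s * k = K at hK
    have hK0 : K ≠ 0 := by rintro rfl; simp [hK] at h0
    have hKu : ¬ IsUnit K := by
      intro hKu; exact hu (hK ▸ (hKu.pow 2).neg)
    obtain ⟨π, hπi, hπK⟩ := WfDvdMonoid.exists_irreducible_factor hKu hK0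
    have hπ := hπi.prime
    have h2 : ¬ π ^ 2 ∣ K := by
      rintro ⟨r, hr⟩
      exact hcube π hπ ⟨-(π * r ^ 2), by rw [hK, hr]; ring⟩
    exact ⟨K, hK, hK0, aux_eis π _ hπ hπK h2 d' (by omega),
      aux_eis π _ hπ ((dvd_neg).2 hπK) (by rwa [dvd_neg]) d' (by omega)⟩

lemma aux_roots (d : ℕ) (hd : 4 ≤ d) (a b t : ℂ) (ha : a ≠ 0) (hb : b ≠ 0) :
    (b * t ^ (d - 1) - a = 0 ∧ b * (a * t + b) ^ (d - 1) + 1 = 0) ↔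
    (t ^ d + 1 + (a * t + b) ^ d = 0 ∧ t ^ (d-1) + a * (a * t + b) ^ (d-1) = 0) := by
  obtain ⟨e, rfl⟩ : ∃ e, d = e + 1 := ⟨d - 1, by omega⟩
  simp only [Nat.add_sub_cancel, pow_succ]
  generalize t ^ e = T
  generalize (a * t + b) ^ e = S
  constructor
  · rintro ⟨h1, h2⟩
    constructor
    · apply mul_left_cancel₀ hb
      linear_combination t * h1 + (a*t+b) * h2
    · apply mul_left_cancel₀ hb
      linear_combination h1 + a * h2
  · rintro ⟨h1, h2⟩
    have : b * S + 1 = 0 := by linear_combination h1 - t * h2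
    refine ⟨?_, this⟩
    linear_combination b * h2 - a * this

lemma aux_roots2 (d : ℕ) (hd : 4 ≤ d) (a b t : ℂ) (ha : a ≠ 0) (hb : b ≠ 0)
    (h1 : b * t ^ (d - 1) - a = 0) (h2 : b * (a * t + b) ^ (d - 1) + 1 = 0) :
    t ^ (d-2) + a ^ 2 * (a * t + b) ^ (d-2) ≠ 0 := by
  obtain ⟨e, rfl⟩ : ∃ e, d = e + 2 := ⟨d - 2, by omega⟩
  have : e + 2 - 1 = e + 1 := by omega
  rw [this, pow_succ] at h1 h2
  simp only [Nat.add_sub_cancel]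
  generalize t ^ e = T at *
  generalize (a * t + b) ^ e = S at *
  intro h
  have hS : b * (a * b * S) = 0 := by
    linear_combination (-(b * t)) * h + h1 + a * h2
  have : S = 0 := by simpa [ha, hb] using hS
  simp [this] at h2

lemma aux_count (d d' : ℕ) (hd' : 2 ≤ d') (hd : d = 2 * d')
    (a b : ℂ) (ha : a ≠ 0) (hb : b ≠ 0) (K : Polynomial ℂ)
    (hK : Polynomial.X ^ d + 1 + (Polynomial.C a * Polynomial.X + Polynomial.C b) ^ d = - K ^ 2) :
    {t : ℂ | b * t ^ (d - 1) - a = 0 ∧ b * (a * t + b) ^ (d - 1) + 1 = 0}.ncard = d' := by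
  have hd4 : 4 ≤ d := by omega
  have hfac : (Polynomial.C a * Polynomial.X + Polynomial.C b) ^ d =
      Polynomial.C (a ^ d) * (Polynomial.X + Polynomial.C (b / a)) ^ d := by
    rw [Polynomial.C_pow, ← mul_pow, mul_add, ← Polynomial.C_mul, mul_div_cancel₀ _ ha]
  have hc : ∀ n, (- K ^ 2).coeff n = (if n = d then 1 else 0) + (if n = 0 then 1 else 0) +
      a ^ d * ((b / a) ^ (d - n) * (d.choose n : ℂ)) := by
    intro n
    rw [← hK, hfac, Polynomial.coeff_add, Polynomial.coeff_add, Polynomial.coeff_C_mul,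
      Polynomial.coeff_X_add_C_pow, Polynomial.coeff_X_pow, Polynomial.coeff_one]
  have hdeg : (- K ^ 2).natDegree = 2 * K.natDegree := by
    rw [Polynomial.natDegree_neg, Polynomial.natDegree_pow]
  have hle : (- K ^ 2).natDegree ≤ d := by
    rw [Polynomial.natDegree_le_iff_coeff_eq_zero]
    intro n hn
    rw [hc, Nat.choose_eq_zero_of_lt hn, if_neg (by omega), if_neg (by omega)]
    simp
  have hge : d - 1 ≤ (- K ^ 2).natDegree := by
    apply Polynomial.le_natDegree_of_ne_zero
    rw [hc, if_neg (by omega), if_neg (by omega), show d.choose (d-1) = d by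
      rw [Nat.choose_symm_of_eq_add (b := 1) (by omega), Nat.choose_one_right]]
    have : (d : ℂ) ≠ 0 := by exact_mod_cast (by omega : d ≠ 0)
    simp [ha, hb, this]
  have hn : K.natDegree = d' := by omega
  have hK0 : K ≠ 0 := by rintro rfl; simp at hn; omega
  have hev : ∀ t, t ^ d + 1 + (a * t + b) ^ d = - (K.eval t) ^ 2 := by
    intro t
    simpa using congrArg (Polynomial.eval t) hK
  have hdK := congrArg Polynomial.derivative hK
  have hdd := congrArg Polynomial.derivative hdK
  have hd0 : (d : ℂ) ≠ 0 := by exact_mod_cast (by omega : d ≠ 0)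
  have hd1 : ((d - 1 : ℕ) : ℂ) ≠ 0 := by exact_mod_cast (by omega : d - 1 ≠ 0)
  have hev1 : ∀ t, d * (t ^ (d-1) + a * (a * t + b) ^ (d-1)) =
      - (2 * (K.eval t) * K.derivative.eval t) := by
    intro t
    have := congrArg (Polynomial.eval t) hdK
    simp [Polynomial.derivative_pow] at this
    linear_combination this
  have hev2 : ∀ t, d * ((d - 1 : ℕ) : ℂ) * (t ^ (d-2) + a ^ 2 * (a * t + b) ^ (d-2)) =
      - (2 * (K.derivative.eval t) ^ 2 + 2 * K.eval t * K.derivative.derivative.eval t) := by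
    intro t
    have := congrArg (Polynomial.eval t) hdd
    simp [Polynomial.derivative_pow] at this
    rw [show d - 1 - 1 = d - 2 by omega] at this
    linear_combination this
  have hset : {t : ℂ | b * t ^ (d - 1) - a = 0 ∧ b * (a * t + b) ^ (d - 1) + 1 = 0} =
      (K.roots.toFinset : Set ℂ) := by
    ext t
    rw [Set.mem_ofPred_eq, aux_roots d hd4 a b t ha hb]
    simp only [Finset.mem_coe, Multiset.mem_toFinset, Polynomial.mem_roots hK0, Polynomial.IsRoot.def]
    rw [hev]
    constructor
    · rintro ⟨h1, _⟩
      simpa using h1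
    · intro h
      refine ⟨by simp [h], ?_⟩
      have := hev1 t
      rw [h] at this
      simpa [hd0] using this
  have hnd : K.roots.Nodup := by
    rw [Multiset.nodup_iff_count_le_one]
    intro t
    rw [Polynomial.count_roots]
    by_contra hlt
    push Not at hlt
    rw [Polynomial.one_lt_rootMultiplicity_iff_isRoot hK0] at hlt
    obtain ⟨h1, h2⟩ := hlt
    rw [Polynomial.IsRoot.def] at h1 h2
    have hm : t ∈ {t : ℂ | b * t ^ (d - 1) - a = 0 ∧ b * (a * t + b) ^ (d - 1) + 1 = 0} := by
      rw [hset]; simpa [hK0] using h1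
    have h3 := aux_roots2 d hd4 a b t ha hb hm.1 hm.2
    have h4 := hev2 t
    rw [h1, h2] at h4
    simp [hd0, hd1] at h4
    exact h3 h4
  rw [hset, Set.ncard_coe_finset, Multiset.toFinset_card_of_nodup hnd, ← hn]
  exact (IsAlgClosed.splits K).natDegree_eq_card_roots.symm

lemma aux_conv (a b : ℂ) (ha : a ≠ 0) (hb : b ≠ 0)
    (hn : {t : ℂ | b * t ^ (4 - 1) - a = 0 ∧ b * (a * t + b) ^ (4 - 1) + 1 = 0}.ncard = 2) :
    ∃ c u v : ℂ, ((X 0) ^ 4 + (X 1) ^ 4 + (C a * X 0 + C b * X 1) ^ 4 : MvPolynomial (Fin 3) ℂ) =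
      C c * (X 0 ^ 2 + C u * X 0 * X 1 + C v * X 1 ^ 2) ^ 2 := by
  obtain ⟨r, s, hrs, hset⟩ := Set.ncard_eq_two.1 hn
  set H : Polynomial ℂ := Polynomial.X ^ 4 + 1 + (Polynomial.C a * Polynomial.X + Polynomial.C b) ^ 4 with hH
  have hH0 : H ≠ 0 := by
    intro h0
    have h1 := congrArg (fun p => Polynomial.eval 0 p.derivative) h0
    simp [hH, Polynomial.derivative_pow, ha, hb] at h1
  have hdvd : ∀ t, t ∈ ({r, s} : Set ℂ) → (Polynomial.X - Polynomial.C t) ^ 2 ∣ H := by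
    intro t ht
    rw [← hset, Set.mem_ofPred_eq, aux_roots 4 le_rfl a b t ha hb] at ht
    rw [← Polynomial.le_rootMultiplicity_iff hH0]
    change 1 < _
    rw [Polynomial.one_lt_rootMultiplicity_iff_isRoot hH0]
    refine ⟨by simpa [hH] using ht.1, ?_⟩
    simp [hH, Polynomial.derivative_pow]
    linear_combination 4 * ht.2
  have hcop : IsCoprime ((Polynomial.X - Polynomial.C r) ^ 2) ((Polynomial.X - Polynomial.C s) ^ 2) :=
    (Polynomial.isCoprime_X_sub_C_of_isUnit_sub (IsUnit.mk0 _ (sub_ne_zero.2 hrs))).pow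
  obtain ⟨Q, hQ⟩ := hcop.mul_dvd (hdvd r (by simp)) (hdvd s (by simp))
  have hQ0 : Q ≠ 0 := by rintro rfl; simp [hQ] at hH0
  have hQd : Q.natDegree = 0 := by
    have h1 : H.natDegree ≤ 4 := by rw [hH]; compute_degree
    have hm : ((Polynomial.X - Polynomial.C r) ^ 2 * (Polynomial.X - Polynomial.C s) ^ 2).Monic :=
      ((Polynomial.monic_X_sub_C r).pow 2).mul ((Polynomial.monic_X_sub_C s).pow 2)
    rw [hQ, hm.natDegree_mul' hQ0, Polynomial.natDegree_mul (by simp [Polynomial.X_sub_C_ne_zero]) (by simp [Polynomial.X_sub_C_ne_zero])] at h1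
    simp at h1
    omega
  rw [Polynomial.eq_C_of_natDegree_eq_zero hQd] at hQ
  generalize Q.coeff 0 = c at hQ
  refine ⟨c, -(r+s), r*s, ?_⟩
  have hev : ∀ t, t ^ 4 + 1 + (a * t + b) ^ 4 = c * (t^2 + -(r+s) * t + r*s) ^ 2 := by
    intro t
    have := congrArg (Polynomial.eval t) hQ
    simp [hH] at this
    linear_combination this
  have e0 := hev 0
  have e1 := hev 1
  have e2 := hev (-1)
  have e3 := hev 2
  have e4 := hev (-2)
  have hl : 1 + a ^ 4 = c := by
    linear_combination (6 * e0 - 4 * e1 - 4 * e2 + e3 + e4) / 24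
  apply MvPolynomial.funext
  intro x
  simp
  by_cases hy : x 1 = 0
  · rw [hy]; simp; linear_combination x 0 ^ 4 * hl
  · have := hev (x 0 / x 1)
    field_simp at this
    linear_combination this

def auxI : Fin 2 → Fin 3 := ![0, 1]

lemma auxI_inj : Function.Injective auxI := by decide

lemma auxI_ne : ∀ i, auxI i ≠ 2 := by decide

noncomputable def auxPhi : MvPolynomial (Fin 3) ℂ ≃ₐ[ℂ] Polynomial (MvPolynomial (Fin 2) ℂ) :=
  (renameEquiv ℂ (finRotate 3)).trans (finSuccEquiv ℂ 2)

lemma auxPhi_X0 : auxPhi (X 0) = Polynomial.C (X 0) := by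
  have : (finRotate 3) 0 = Fin.succ 0 := by decide
  simp only [auxPhi, AlgEquiv.trans_apply, renameEquiv_apply, rename_X, this, finSuccEquiv_X_succ]

lemma auxPhi_X1 : auxPhi (X 1) = Polynomial.C (X 1) := by
  have : (finRotate 3) 1 = Fin.succ 1 := by decide
  simp only [auxPhi, AlgEquiv.trans_apply, renameEquiv_apply, rename_X, this, finSuccEquiv_X_succ]

lemma auxPhi_X2 : auxPhi (X 2) = Polynomial.X := by
  have : (finRotate 3) 2 = 0 := by decide
  simp only [auxPhi, AlgEquiv.trans_apply, renameEquiv_apply, rename_X, this, finSuccEquiv_X_zero]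

lemma auxPhi_C (c : ℂ) : auxPhi (C c) = Polynomial.C (C c) := by
  have := auxPhi.commutes c
  simpa [MvPolynomial.algebraMap_eq, Polynomial.algebraMap_apply] using this

lemma auxPhi_rename (k : MvPolynomial (Fin 2) ℂ) :
    auxPhi (rename auxI k) = Polynomial.C k := by
  induction k using MvPolynomial.induction_on with
  | C c => rw [rename_C, auxPhi_C]
  | add p q hp hq => simp only [map_add, hp, hq]
  | mul_X p i hp =>
    have hX : auxPhi (X (auxI i)) = Polynomial.C (X i) := by
      revert i
      rw [Fin.forall_fin_two]
      exact ⟨auxPhi_X0, auxPhi_X1⟩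
    rw [map_mul, map_mul, hp, rename_X, map_mul, hX]

lemma aux_smooth (d d' : ℕ) (hd' : 2 ≤ d') (hd : d = 2 * d')
    (a b : ℂ) (ha : a ≠ 0) (hb : b ≠ 0) (k : MvPolynomial (Fin 2) ℂ)
    (hk : (X 0) ^ d + (X 1) ^ d + (C a * X 0 + C b * X 1) ^ d = - k ^ 2)
    (g : MvPolynomial (Fin 3) ℂ)
    (hg : Associated g (X 2 ^ d' + rename auxI k)) (p : Fin 3 → ℂ) (h0 : eval p g = 0)
    (h1 : ∀ i, eval p (pderiv i g) = 0) : p = 0 := by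
  obtain ⟨u, hu⟩ := hg
  have e0 := congrArg (eval p) hu
  have e1 := fun i => congrArg (fun q => eval p (pderiv i q)) hu
  simp only [Derivation.leibniz, map_add, smul_eq_mul, map_mul, h0, h1, mul_zero, zero_mul, zero_add,
    Derivation.leibniz_pow, nsmul_eq_mul, map_pow, eval_X, eval_rename, map_natCast] at e0 e1
  have hz : p 2 = 0 := by
    have h2 := e1 2
    have : pderiv 2 (rename auxI k) = 0 := by
      apply pderiv_eq_zero_of_notMem_vars
      intro hm
      have := vars_rename auxI k hm
      simp only [Finset.mem_image] at this
      obtain ⟨i, _, hi⟩ := this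
      exact auxI_ne i hi
    rw [this, pderiv_X_self] at h2
    have hdn : d' ≠ 0 := by omega
    simp [hdn] at h2
    exact h2.1
  have hq : p ∘ auxI = 0 := by
    apply aux_sing d (by omega) a b ha hb k hk
    · simpa [hz, show d' ≠ 0 by omega] using e0.symm
    · intro i
      have h2 := e1 (auxI i)
      rw [pderiv_X_of_ne (auxI_ne i).symm,
        pderiv_rename auxI_inj, eval_rename] at h2
      simpa using h2.symm
  ext i
  fin_cases i
  · exact congrFun hq 0
  · exact congrFun hq 1
  · exact hz





/-- Let `d = 2 d' ≥ 4` be even, `a, b ∈ ℂ*`, `f = x^d + y^d + z^d + (a x + b y)^d`.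
Then `f` is squarefree with at most two irreducible factors (up to units); if
`f = f₁ f₂` with `f₁`, `f₂` non-associated irreducibles, then both curves `f₁ = 0`
and `f₂ = 0` are smooth and the polynomials `g₁(t) = b t^(d-1) - a` and
`g₂(t) = b (a t + b)^(d-1) + 1` have exactly `d'` common roots; conversely, for
`d' = 2`, if `g₁` and `g₂` have `d' = 2` common roots then `f` is reducible. -/
theorem stmt10 (d d' : ℕ) (hd' : 2 ≤ d') (hd : d = 2 * d')
    (a b : ℂ) (ha : a ≠ 0) (hb : b ≠ 0)
    (f : MvPolynomial (Fin 3) ℂ)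
    (hf : f = (X 0) ^ d + (X 1) ^ d + (X 2) ^ d + (C a * X 0 + C b * X 1) ^ d) :
    Squarefree f ∧
    (∀ q₁ q₂ q₃ : MvPolynomial (Fin 3) ℂ,
      Irreducible q₁ → Irreducible q₂ → Irreducible q₃ →
      q₁ ∣ f → q₂ ∣ f → q₃ ∣ f →
      Associated q₁ q₂ ∨ Associated q₁ q₃ ∨ Associated q₂ q₃) ∧
    (∀ f₁ f₂ : MvPolynomial (Fin 3) ℂ,
      Irreducible f₁ → Irreducible f₂ → ¬ Associated f₁ f₂ → f = f₁ * f₂ →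
      (∀ p : Fin 3 → ℂ, eval p f₁ = 0 → (∀ i, eval p (pderiv i f₁) = 0) → p = 0) ∧
      (∀ p : Fin 3 → ℂ, eval p f₂ = 0 → (∀ i, eval p (pderiv i f₂) = 0) → p = 0) ∧
      {t : ℂ | b * t ^ (d - 1) - a = 0 ∧ b * (a * t + b) ^ (d - 1) + 1 = 0}.ncard = d') ∧
    (d' = 2 →
      {t : ℂ | b * t ^ (d - 1) - a = 0 ∧ b * (a * t + b) ^ (d - 1) + 1 = 0}.ncard = d' →
      ∃ g h : MvPolynomial (Fin 3) ℂ, ¬ IsUnit g ∧ ¬ IsUnit h ∧ f = g * h) := by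
  have hΦ : auxPhi f = Polynomial.X ^ d +
      Polynomial.C ((X 0) ^ d + (X 1) ^ d + (C a * X 0 + C b * X 1) ^ d) := by
    rw [hf]
    simp only [map_add, map_mul, map_pow, auxPhi_X0, auxPhi_X1, auxPhi_X2, auxPhi_C]
    ring
  have hirr : ∀ q, Irreducible (auxPhi q) → Irreducible q := fun q hq =>
    (MulEquiv.irreducible_iff auxPhi.toMulEquiv (x := q)).1 hq
  have main : Squarefree f ∧
    (∀ q₁ q₂ q₃ : MvPolynomial (Fin 3) ℂ,
      Irreducible q₁ → Irreducible q₂ → Irreducible q₃ →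
      q₁ ∣ f → q₂ ∣ f → q₃ ∣ f →
      Associated q₁ q₂ ∨ Associated q₁ q₃ ∨ Associated q₂ q₃) ∧
    (∀ f₁ f₂ : MvPolynomial (Fin 3) ℂ,
      Irreducible f₁ → Irreducible f₂ → ¬ Associated f₁ f₂ → f = f₁ * f₂ →
      (∀ p : Fin 3 → ℂ, eval p f₁ = 0 → (∀ i, eval p (pderiv i f₁) = 0) → p = 0) ∧
      (∀ p : Fin 3 → ℂ, eval p f₂ = 0 → (∀ i, eval p (pderiv i f₂) = 0) → p = 0) ∧
      {t : ℂ | b * t ^ (d - 1) - a = 0 ∧ b * (a * t + b) ^ (d - 1) + 1 = 0}.ncard = d') := by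
    rcases aux_struct d d' hd' hd a b ha hb _ rfl with h | ⟨k, hk, hk0, hi1, hi2⟩
    · rw [← hΦ] at h
      have h := hirr _ h
      refine ⟨h.squarefree, ?_, ?_⟩
      · intro q₁ q₂ q₃ h1 h2 _ d1 d2 _
        exact Or.inl ((h1.associated_of_dvd h d1).trans (h2.associated_of_dvd h d2).symm)
      · intro f₁ f₂ h1 h2 _ he
        rcases h.isUnit_or_isUnit he with hu | hu
        · exact absurd hu h1.not_isUnit
        · exact absurd hu h2.not_isUnit
    · have hd0 : d' ≠ 0 := by omega
      have hu : Irreducible (X 2 ^ d' + rename auxI k) := by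
        apply hirr
        rwa [map_add, map_pow, auxPhi_X2, auxPhi_rename]
      have hv : Irreducible (X 2 ^ d' + rename auxI (-k)) := by
        apply hirr
        rwa [map_add, map_pow, auxPhi_X2, auxPhi_rename]
      have hfuv : f = (X 2 ^ d' + rename auxI k) * (X 2 ^ d' + rename auxI (-k)) := by
        apply auxPhi.injective
        rw [hΦ, hk]
        simp only [map_mul, map_add, map_pow, auxPhi_X2, auxPhi_rename, map_neg, hd, pow_mul']
        ring
      have hnass : ¬ Associated (X 2 ^ d' + rename auxI k)
          (X 2 ^ d' + rename auxI (-k)) := by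
        intro hass
        have := hass.map auxPhi
        simp only [map_add, map_pow, auxPhi_X2, auxPhi_rename] at this
        have := Polynomial.eq_of_monic_of_associated (Polynomial.monic_X_pow_add_C k hd0)
          (Polynomial.monic_X_pow_add_C (-k) hd0) this
        have := Polynomial.C_injective (add_left_cancel this)
        exact hk0 (self_eq_neg.1 this)
      have hcl : ∀ q, Irreducible q → q ∣ f → Associated q (X 2 ^ d' + rename auxI k) ∨
          Associated q (X 2 ^ d' + rename auxI (-k)) := by
        intro q hq hqf
        rw [hfuv] at hqf
        rcases hq.prime.dvd_or_dvd hqf with h | h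
        · exact Or.inl (hq.associated_of_dvd hu h)
        · exact Or.inr (hq.associated_of_dvd hv h)
      have hsm : ∀ q, Irreducible q → q ∣ f → 
          (∀ p : Fin 3 → ℂ, eval p q = 0 → (∀ i, eval p (pderiv i q) = 0) → p = 0) := by
        intro q hq hqf p h0 h1
        rcases hcl q hq hqf with h | h
        · exact aux_smooth d d' hd' hd a b ha hb k hk q h p h0 h1
        · exact aux_smooth d d' hd' hd a b ha hb (-k) (by rw [neg_sq]; exact hk) q h p h0 h1
      refine ⟨?_, ?_, ?_⟩
      · rw [hfuv, squarefree_mul_iff]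
        refine ⟨?_, hu.squarefree, hv.squarefree⟩
        rw [hu.isRelPrime_iff_not_dvd]
        exact fun h => hnass (hu.associated_of_dvd hv h)
      · intro q₁ q₂ q₃ h1 h2 h3 d1 d2 d3
        rcases hcl q₁ h1 d1 with k1 | k1 <;> rcases hcl q₂ h2 d2 with k2 | k2 <;>
          rcases hcl q₃ h3 d3 with k3 | k3 <;>
          first
          | exact Or.inl (k1.trans k2.symm)
          | exact Or.inr (Or.inl (k1.trans k3.symm))
          | exact Or.inr (Or.inr (k2.trans k3.symm))
      · intro f₁ f₂ h1 h2 _ he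
        refine ⟨hsm f₁ h1 (he ▸ dvd_mul_right _ _), hsm f₂ h2 (he ▸ dvd_mul_left _ _), ?_⟩
        apply aux_count d d' hd' hd a b ha hb (aeval ![Polynomial.X, 1] k)
        have := congrArg (aeval ![(Polynomial.X : Polynomial ℂ), 1]) hk
        simpa [Polynomial.algebraMap_apply] using this
  refine ⟨main.1, main.2.1, main.2.2, ?_⟩
  intro h2 hn
  subst h2
  subst hd
  obtain ⟨c, u, v, hcuv⟩ := aux_conv a b ha hb hn
  obtain ⟨s, hs⟩ := IsAlgClosed.exists_pow_nat_eq (-c) (n := 2) (by norm_num)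
  have hnu : ∀ w : MvPolynomial (Fin 3) ℂ, eval 0 w = 0 → ¬ IsUnit w := by
    intro w hw hu
    have := hu.map (eval (0 : Fin 3 → ℂ))
    rw [hw] at this
    exact not_isUnit_zero this
  refine ⟨X 2 ^ 2 + C s * (X 0 ^ 2 + C u * X 0 * X 1 + C v * X 1 ^ 2),
    X 2 ^ 2 - C s * (X 0 ^ 2 + C u * X 0 * X 1 + C v * X 1 ^ 2), hnu _ (by simp), hnu _ (by simp), ?_⟩
  have hs' : (C s : MvPolynomial (Fin 3) ℂ) ^ 2 = - C c := by
    rw [← C_pow, hs, C_neg]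
  rw [hf]
  linear_combination hcuv + (X 0 ^ 2 + C u * X 0 * X 1 + C v * X 1 ^ 2) ^ 2 * hs'
end

section
/- Let d ≥ 5 be odd and f = x^d + y^d + z^d − (x + y + z)^d. Then f factors as f = (x+y)(x+z)(y+z)·g, where g is a homogeneous polynomial of degree d−3 such that: the plane curve g = 0 is smooth (hence g is irreducible), g does not vanish at the three points (1:1:−1), (1:−1:1), (−1:1:1), and g = 0 meets each of the three lines x+y = 0, x+z = 0, y+z = 0 in exactly d−3 distinct points, none of which is one of the vertices (1:−1:0), (1:0:−1), (0:1:−1) of the triangle (x+y)(x+z)(y+z) = 0. -/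
open MvPolynomial

lemma mod_aux (n : ℕ) (hn : n ≠ 0) (x y z : ℂ) (hx : x ^ n = (x+y+z)^n) (hy : y ^ n = (x+y+z)^n)
    (hz : z ^ n = (x+y+z)^n) : (x+y)*(x+z)*(y+z) = 0 := by
  have key : ∀ w : ℂ, w ^ n = (x+y+z)^n → ‖w‖ = ‖x+y+z‖ := by
    intro w hw
    have := congrArg norm hw
    rw [norm_pow, norm_pow] at this
    exact (pow_left_inj₀ (norm_nonneg _) (norm_nonneg _) hn).1 this
  have k2 : ∀ w : ℂ, w ^ n = (x+y+z)^n → w * (starRingEnd ℂ) w = (x+y+z) * (starRingEnd ℂ) (x+y+z) := by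
    intro w hw
    rw [Complex.mul_conj', Complex.mul_conj', key w hw]
  have h1 := k2 x hx
  have h2 := k2 y hy
  have h3 := k2 z hz
  rw [map_add, map_add] at h1 h2 h3
  by_cases h0 : (x+y+z) = 0
  · have a1 := key x hx
    have a2 := key y hy
    rw [h0, norm_zero, norm_eq_zero] at a1 a2
    rw [a1, a2]; ring
  have hR : (x+y+z) * ((starRingEnd ℂ) x+(starRingEnd ℂ) y+(starRingEnd ℂ) z) ≠ 0 := by
    rw [← map_add, ← map_add]
    exact mul_ne_zero h0 (by simpa only [ne_eq, map_eq_zero] using h0)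
  generalize (starRingEnd ℂ) x = x' at *
  generalize (starRingEnd ℂ) y = y' at *
  generalize (starRingEnd ℂ) z = z' at *
  set R := (x+y+z) * (x'+y'+z') with hRd
  have : R * ((x+y)*(x+z)*(y+z)) = 0 := by
    have e : x*y*z*(x+y+z)*(x'+y'+z') = (x+y+z) * (y*z*R+x*z*R+x*y*R) := by
      linear_combination (x+y+z) * (y*z*h1+x*z*h2+x*y*h3)
    have e2 : x*y*z*R = (x+y+z) * (y*z*R+x*z*R+x*y*R) := by rw [← e, hRd]; ring
    linear_combination -e2
  exact (mul_eq_zero.1 this).resolve_left hR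

lemma dvd_sub_aeval (l : MvPolynomial (Fin 3) ℂ) (v : Fin 3 → MvPolynomial (Fin 3) ℂ)
    (h : ∀ k, l ∣ X k - v k) (p : MvPolynomial (Fin 3) ℂ) : l ∣ p - aeval v p := by
  rw [← Ideal.mem_span_singleton, ← Ideal.Quotient.eq]
  have : (Ideal.Quotient.mkₐ ℂ (Ideal.span {l})) = 
      (Ideal.Quotient.mkₐ ℂ (Ideal.span {l})).comp (aeval v) := by
    ext k
    simp only [Ideal.Quotient.mkₐ_eq_mk, AlgHom.comp_apply, aeval_X]
    rw [Ideal.Quotient.eq, Ideal.mem_span_singleton]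
    exact h k
  exact DFunLike.congr_fun this p

lemma factor (d : ℕ) (hd : 5 ≤ d) (hodd : Odd d) :
   ∃ g : MvPolynomial (Fin 3) ℂ, 
    (X 0) ^ d + (X 1) ^ d + (X 2) ^ d - (X 0 + X 1 + X 2) ^ d =
     (X 0 + X 1) * (X 0 + X 2) * (X 1 + X 2) * g := by
  set f : MvPolynomial (Fin 3) ℂ := (X 0) ^ d + (X 1) ^ d + (X 2) ^ d - (X 0 + X 1 + X 2) ^ d with hf
  have hd0 : d ≠ 0 := by omega
  have main : ∀ l v, (∀ k, l ∣ X k - v k) → ∀ p : MvPolynomial (Fin 3) ℂ, aeval v p = 0 → l ∣ p := by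
    intro l v h p hp
    have := dvd_sub_aeval l v h p
    rwa [hp, sub_zero] at this
  obtain ⟨h, hh⟩ : (X 0 + X 1) ∣ f := by
    apply main _ ![-X 1, X 1, X 2]
    · intro k; fin_cases k <;> simp
    · simp [hf, hodd.neg_pow]
  obtain ⟨k, hk⟩ : (X 0 + X 2) ∣ h := by
    apply main _ ![X 0, X 1, - X 0]
    · intro k; fin_cases k <;> simp [add_comm]
    · have := congrArg (aeval (![X 0, X 1, - X 0] : Fin 3 → MvPolynomial (Fin 3) ℂ)) hh
      rw [hf] at this
      simp [hodd.neg_pow] at this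
      refine this.resolve_left ?_
      intro h0
      simpa using congrArg (eval ![1,0,0]) h0
  obtain ⟨g, hg⟩ : (X 1 + X 2) ∣ k := by
    apply main _ ![X 0, X 1, - X 1]
    · intro k; fin_cases k <;> simp [add_comm]
    · have := congrArg (aeval (![X 0, X 1, - X 1] : Fin 3 → MvPolynomial (Fin 3) ℂ)) hh
      rw [hf, hk] at this
      simp [hodd.neg_pow] at this
      refine (this.resolve_left ?_).resolve_left ?_
      · intro h0
        simpa using congrArg (eval ![1,0,0]) h0
      · intro h0
        simpa using congrArg (eval ![1,0,0]) h0
  exact ⟨g, by rw [hh, hk, hg]; ring⟩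

lemma homog_of_mul (p q : MvPolynomial (Fin 3) ℂ) (m n : ℕ) (hp : p.IsHomogeneous m) (h0 : p ≠ 0)
    (h : (p * q).IsHomogeneous (m + n)) : q.IsHomogeneous n := by
  have e : homogeneousComponent (m+n) (p*q) = p * homogeneousComponent n q := by
    let _ : GradedAlgebra (homogeneousSubmodule (Fin 3) ℂ) := gradedAlgebra
    have := DirectSum.coe_decompose_mul_add_of_left_mem (𝒜 := homogeneousSubmodule (Fin 3) ℂ) (i := m) (j := n) (a := p) (b := q) hp
    have e3 : ∀ (r : MvPolynomial (Fin 3) ℂ) (i : ℕ), ((DirectSum.decompose (homogeneousSubmodule (Fin 3) ℂ) r) i : MvPolynomial (Fin 3) ℂ) = homogeneousComponent i r :=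
      fun r i => decomposition.decompose'_apply r i
    rwa [e3, e3] at this
  have e2 : homogeneousComponent (m+n) (p*q) = p * q := by
    rw [homogeneousComponent_of_mem h]; simp
  rw [e2] at e
  rw [mul_left_cancel₀ h0 e]
  exact homogeneousComponent_isHomogeneous _ _

lemma eval_smul_homog (g : MvPolynomial (Fin 3) ℂ) (n : ℕ) (hg : g.IsHomogeneous n) (t : ℂ)
    (p : Fin 3 → ℂ) : eval (t • p) g = t ^ n * eval p g := by
  rw [eval_eq', eval_eq', Finset.mul_sum]
  refine Finset.sum_congr rfl fun m hm => ?_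
  have hn : ∑ i, m i = n := by
    have := hg (mem_support_iff.1 hm)
    rw [← this, Finsupp.weight_apply, Finsupp.sum_fintype] <;> simp
  simp only [Pi.smul_apply, smul_eq_mul, mul_pow, Finset.prod_mul_distrib, Finset.prod_pow_eq_pow_sum, hn]
  ring

lemma max_height (I : Ideal (MvPolynomial (Fin 3) ℂ)) (hI : I = RingHom.ker (eval (0 : Fin 3 → ℂ))) : 3 ≤ I.height := by
  subst hI
  let φ1 : MvPolynomial (Fin 3) ℂ →ₐ[ℂ] MvPolynomial (Fin 3) ℂ := (aeval (![0, X 1, X 2] : Fin 3 → MvPolynomial (Fin 3) ℂ))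
  let φ2 : MvPolynomial (Fin 3) ℂ →ₐ[ℂ] MvPolynomial (Fin 3) ℂ := (aeval (![0, 0, X 2] : Fin 3 → MvPolynomial (Fin 3) ℂ))
  have h21 : φ2 = φ2.comp φ1 := by
    ext i : 1
    fin_cases i <;> simp [φ1, φ2]
  have h31 : ∀ p, eval 0 p = eval 0 (φ2 p) := by
    have : aeval (0 : Fin 3 → ℂ) = (aeval (0 : Fin 3 → ℂ)).comp φ2 := by
      ext i : 1
      fin_cases i <;> simp [φ2]
    intro p
    have := DFunLike.congr_fun this p
    simpa [aeval_eq_eval] using this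
  have P1 : (RingHom.ker φ1).IsPrime := RingHom.ker_isPrime _
  have P2 : (RingHom.ker φ2).IsPrime := RingHom.ker_isPrime _
  have P3 : (RingHom.ker (eval (0 : Fin 3 → ℂ))).IsPrime := RingHom.ker_isPrime _
  have X2 : (X 2 : MvPolynomial (Fin 3) ℂ) ≠ 0 := X_ne_zero _
  have X1 : (X 1 : MvPolynomial (Fin 3) ℂ) ≠ 0 := X_ne_zero _
  have X0 : (X 0 : MvPolynomial (Fin 3) ℂ) ≠ 0 := X_ne_zero _
  have l0 : ⊥ < RingHom.ker φ1 := by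
    refine bot_lt_iff_ne_bot.2 fun h => X0 ?_
    rw [← Ideal.mem_bot, ← h, RingHom.mem_ker]
    simp [φ1]
  have l1 : RingHom.ker φ1 < RingHom.ker φ2 := by
    refine lt_of_le_of_ne ?_ fun h => X1 ?_
    · intro p hp
      rw [RingHom.mem_ker] at *
      rw [h21, AlgHom.comp_apply, hp, map_zero]
    · have : X 1 ∈ RingHom.ker φ2 := by simp [RingHom.mem_ker, φ2]
      rw [← h] at this
      simp [RingHom.mem_ker, φ1] at this
  have l2 : RingHom.ker φ2 < RingHom.ker (eval (0 : Fin 3 → ℂ)) := by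
    refine lt_of_le_of_ne ?_ fun h => X2 ?_
    · intro p hp
      rw [RingHom.mem_ker] at *
      rw [h31, hp, map_zero]
    · have : X 2 ∈ RingHom.ker (eval (0 : Fin 3 → ℂ)) := by simp [RingHom.mem_ker]
      rw [← h] at this
      simp [RingHom.mem_ker, φ2] at this
  have a0 := Ideal.height_add_one_le_of_lt_of_isPrime l0
  have a1 := Ideal.height_add_one_le_of_lt_of_isPrime l1
  have a2 := Ideal.height_add_one_le_of_lt_of_isPrime l2
  calc (3 : ℕ∞) = 0 + 1 + 1 + 1 := by norm_num
    _ ≤ _ := by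
      refine le_trans ?_ a2
      gcongr
      refine le_trans ?_ a1
      gcongr
      refine le_trans ?_ a0
      gcongr
      simp

lemma common_zero (a b : MvPolynomial (Fin 3) ℂ) (ha : eval 0 a = 0) (hb : eval 0 b = 0) :
    ∃ p : Fin 3 → ℂ, p ≠ 0 ∧ eval p a = 0 ∧ eval p b = 0 := by
  classical
  by_contra! hcon
  have hz : zeroLocus ℂ (Ideal.span ({a, b} : Set (MvPolynomial (Fin 3) ℂ))) = {0} := by
    rw [zeroLocus_span]
    ext p
    simp only [Set.mem_ofPred_eq, Set.mem_insert_iff, Set.mem_singleton_iff, forall_eq_or_imp, forall_eq, aeval_eq_eval]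
    constructor
    · rintro ⟨h1, h2⟩
      by_contra h
      exact hcon p h h1 h2
    · rintro rfl; exact ⟨ha, hb⟩
  have hrad := vanishingIdeal_zeroLocus_eq_radical (K := ℂ) (Ideal.span ({a, b} : Set (MvPolynomial (Fin 3) ℂ)))
  rw [hz] at hrad
  have hm : (vanishingIdeal ℂ {(0 : Fin 3 → ℂ)}) = RingHom.ker (eval (0 : Fin 3 → ℂ)) := by
    ext p
    rw [mem_vanishingIdeal_singleton_iff, RingHom.mem_ker, aeval_eq_eval]
  have h3 := max_height _ hm
  have hmin : vanishingIdeal ℂ {(0 : Fin 3 → ℂ)} ∈ (Ideal.span (({a, b} : Finset (MvPolynomial (Fin 3) ℂ)) : Set (MvPolynomial (Fin 3) ℂ))).minimalPrimes := by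
    rw [← Ideal.radical_minimalPrimes]
    push_cast
    rw [← hrad, Ideal.minimalPrimes_eq_subsingleton_self]
    rfl
  have h2 := Ideal.height_le_card_of_mem_minimalPrimes_span_finset hmin
  have h4 : (({a, b} : Finset (MvPolynomial (Fin 3) ℂ)).card : ℕ∞) ≤ 2 := by
    exact_mod_cast Finset.card_le_two
  have := (h3.trans h2).trans h4
  exact absurd this (by norm_num)

lemma unit_of (a b g : MvPolynomial (Fin 3) ℂ) (n : ℕ) (hg : g.IsHomogeneous n) (hg0 : g ≠ 0)
    (hab : g = a * b) (ha : eval 0 a ≠ 0) : IsUnit a := by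
  have main : ∀ p, eval p g ≠ 0 → eval p a = eval 0 a := by
    intro p hp
    -- restrict to line
    let φ : MvPolynomial (Fin 3) ℂ →ₐ[ℂ] Polynomial ℂ := aeval (fun i => Polynomial.C (p i) * Polynomial.X)
    have hev : ∀ (q : MvPolynomial (Fin 3) ℂ) (t : ℂ), (φ q).eval t = eval (fun i => p i * t) q := by
      intro q t
      have : (Polynomial.aeval t).comp φ = aeval (fun i => p i * t) := by
        ext i; simp [φ]
      have := DFunLike.congr_fun this q
      simpa [aeval_eq_eval, Polynomial.coe_aeval_eq_eval] using this
    have hg' : φ g = Polynomial.C (eval p g) * Polynomial.X ^ n := by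
      apply Polynomial.funext
      intro t
      rw [hev]
      have e : (fun i => p i * t) = t • p := by ext i; simp [mul_comm]
      rw [e, eval_smul_homog g n hg, Polynomial.eval_mul, Polynomial.eval_C, Polynomial.eval_pow, Polynomial.eval_X, mul_comm]
    have hd : φ a ∣ Polynomial.X ^ n := by
      have : φ a ∣ Polynomial.C (eval p g) * Polynomial.X ^ n := ⟨φ b, by rw [← hg', hab, map_mul]⟩
      exact ((Polynomial.isUnit_C.2 (isUnit_iff_ne_zero.2 hp)).dvd_mul_left).1 this
    obtain ⟨i, hi, hai⟩ := (dvd_prime_pow Polynomial.prime_X n).1 hd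
    obtain ⟨u, hu⟩ := hai.symm
    obtain ⟨c, hc, hcu⟩ := Polynomial.isUnit_iff.1 u.isUnit
    have e1 := hev a 1
    have e0 := hev a 0
    rw [← hu, ← hcu] at e1 e0
    have z : (fun i => p i * 0) = 0 := by ext i; simp
    rw [z] at e0
    simp [-eval_zero] at e1 e0
    rcases Nat.eq_zero_or_pos i with h | h
    · subst h; simp [-eval_zero] at e0; rw [← e1, ← e0]
    · rw [zero_pow h.ne'] at e0
      exact absurd (by simpa [-eval_zero] using e0.symm) ha
  have : (a - C (eval 0 a)) * g = 0 := by
    apply MvPolynomial.funext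
    intro p
    by_cases hp : eval p g = 0
    · simp [hp]
    · simp [main p hp]
  have h := (mul_eq_zero.1 this).resolve_right hg0
  rw [sub_eq_zero.1 h]
  exact (isUnit_iff_ne_zero.2 ha).map C

lemma irred (g : MvPolynomial (Fin 3) ℂ) (n : ℕ) (hn : n ≠ 0) (hg : g.IsHomogeneous n) (hg0 : g ≠ 0)
    (hs : ∀ p : Fin 3 → ℂ, eval p g = 0 → (∀ i, eval p (pderiv i g) = 0) → p = 0) : Irreducible g := by
  refine ⟨?_, ?_⟩
  · intro hu
    have := hu.map (eval (0 : Fin 3 → ℂ))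
    have e := eval_smul_homog g n hg (0:ℂ) 0
    rw [smul_zero, zero_pow hn, zero_mul] at e
    rw [e] at this
    exact not_isUnit_zero this
  · intro a b hab
    by_contra! h
    have ha : eval 0 a = 0 := by
      by_contra h0
      exact h.1 (unit_of a b g n hg hg0 hab h0)
    have hb : eval 0 b = 0 := by
      by_contra h0
      exact h.2 (unit_of b a g n hg hg0 (by rw [hab, mul_comm]) h0)
    obtain ⟨p, hp, h1, h2⟩ := common_zero a b ha hb
    apply hp
    apply hs
    · simp [hab, h1]
    · intro i; simp [hab, h1, h2, Derivation.leibniz]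

lemma count (d : ℕ) (hd : 5 ≤ d) (hodd : Odd d) (G : ℂ → ℂ → ℂ)
   (h : ∀ a b, (a ≠ 0 ∨ b ≠ 0) → (G a b = 0 ↔ b ^ (d-1) = a ^ (d-1) ∧ b ≠ a ∧ b ≠ -a)) :
   {x : Projectivization ℂ (Fin 2 → ℂ) | G (x.rep 0) (x.rep 1) = 0}.ncard = d - 3 := by
  classical
  have hd1 : d - 1 ≠ 0 := by omega
  have heven : Even (d - 1) := by
    obtain ⟨k, rfl⟩ := hodd; exact ⟨k, by omega⟩
  let S : Finset ℂ := ((Polynomial.nthRootsFinset (d-1) (1:ℂ)).erase 1).erase (-1)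
  have hS : S.card = d - 3 := by
    rw [Finset.card_erase_of_mem, Finset.card_erase_of_mem,
      (Complex.isPrimitiveRoot_exp (d-1) hd1).card_nthRootsFinset]
    · omega
    · rw [Polynomial.mem_nthRootsFinset (by omega)]; simp
    · rw [Finset.mem_erase, Polynomial.mem_nthRootsFinset (by omega)]
      refine ⟨by norm_num, heven.neg_one_pow⟩
  have hne : ∀ t : ℂ, (![1, t] : Fin 2 → ℂ) ≠ 0 := by
    intro t h; simpa using congrFun h 0
  let φ : ℂ → Projectivization ℂ (Fin 2 → ℂ) := fun t => Projectivization.mk ℂ ![1, t] (hne t)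
  have hinj : Function.Injective φ := by
    intro s t hst
    rw [Projectivization.mk_eq_mk_iff'] at hst
    obtain ⟨c, hc⟩ := hst
    have h0 := congrFun hc 0
    have h1 := congrFun hc 1
    simp at h0 h1
    rw [← h1, h0, one_mul]
  rw [← hS, ← Set.ncard_coe_finset, ← Set.ncard_image_of_injective _ hinj]
  congr 1
  have hrep : ∀ x : Projectivization ℂ (Fin 2 → ℂ), x.rep 0 ≠ 0 ∨ x.rep 1 ≠ 0 := by
    intro x
    by_contra! hx
    apply x.rep_nonzero
    ext i; fin_cases i
    · exact hx.1
    · exact hx.2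
  ext x
  simp only [Set.mem_ofPred_eq, Set.mem_image, S, Finset.mem_coe, Finset.mem_erase, 
    Polynomial.mem_nthRootsFinset (show 0 < d - 1 by omega)]
  rw [h _ _ (hrep x)]
  constructor
  · rintro ⟨h1, h2, h3⟩
    have ha : x.rep 0 ≠ 0 := by
      intro ha
      rw [ha, zero_pow hd1] at h1
      have := pow_eq_zero_iff hd1 |>.1 h1
      rw [ha, this] at h2
      exact h2 rfl
    refine ⟨x.rep 1 / x.rep 0, ⟨?_, ?_, ?_⟩, ?_⟩
    · rw [Ne, div_eq_iff ha]; simpa using h3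
    · rw [Ne, div_eq_iff ha]; simpa using h2
    · rw [div_pow, h1, div_self (pow_ne_zero _ ha)]
    · conv_rhs => rw [← x.mk_rep]
      rw [Projectivization.mk_eq_mk_iff']
      refine ⟨(x.rep 0)⁻¹, ?_⟩
      ext i; fin_cases i
      · simp [ha]
      · simp [div_eq_inv_mul]
  · rintro ⟨t, ⟨h1, h2, h3⟩, rfl⟩
    obtain ⟨c, hc⟩ := (Projectivization.mk_eq_mk_iff' ℂ _ _ (φ t).rep_nonzero (hne t)).1 (by rw [Projectivization.mk_rep])
    have h0 := congrFun hc 0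
    have h1' := congrFun hc 1
    simp at h0 h1'
    have hc0 : c ≠ 0 := by
      intro hc0
      rcases hrep (φ t) with h | h
      · exact h (by rw [← h0, hc0])
      · exact h (by rw [← h1', hc0, zero_mul])
    rw [← h0, ← h1']
    refine ⟨by rw [mul_pow, h3, mul_one], ?_, ?_⟩
    · intro h; exact h2 (mul_left_cancel₀ hc0 (by rw [h, mul_one]))
    · intro h; exact h1 (mul_left_cancel₀ hc0 (by rw [h]; ring))


lemma D1 (d : ℕ) (g : MvPolynomial (Fin 3) ℂ) (hg : 
    (X 0) ^ d + (X 1) ^ d + (X 2) ^ d - (X 0 + X 1 + X 2) ^ d =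
     (X 0 + X 1) * (X 0 + X 2) * (X 1 + X 2) * g) (p : Fin 3 → ℂ) :
  (↑d * p 0 ^ (d - 1) - ↑d * (p 0 + p 1 + p 2) ^ (d - 1) =
    (p 0 + p 1) * (p 0 + p 2) * (p 1 + p 2) * (eval p) ((pderiv 0) g) +
      (eval p) g * ((p 1 + p 2) * (p 0 + p 1 + (p 0 + p 2)))) ∧
  (↑d * p 1 ^ (d - 1) - ↑d * (p 0 + p 1 + p 2) ^ (d - 1) =
    (p 0 + p 1) * (p 0 + p 2) * (p 1 + p 2) * (eval p) ((pderiv 1) g) +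
      (eval p) g * ((p 0 + p 1) * (p 0 + p 2) + (p 1 + p 2) * (p 0 + p 2))) ∧
  (↑d * p 2 ^ (d - 1) - ↑d * (p 0 + p 1 + p 2) ^ (d - 1) =
    (p 0 + p 1) * (p 0 + p 2) * (p 1 + p 2) * (eval p) ((pderiv 2) g) +
      (eval p) g * ((p 0 + p 1) * (p 0 + p 2) + (p 1 + p 2) * (p 0 + p 1))) ∧
  (-(↑d * (↑(d - 1) * (p 0 + p 1 + p 2) ^ (d - 1 - 1))) =
    (p 0 + p 1) * (p 0 + p 2) * (p 1 + p 2) * (eval p) ((pderiv 0) ((pderiv 1) g)) +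
        (eval p) ((pderiv 1) g) * ((p 1 + p 2) * (p 0 + p 1 + (p 0 + p 2))) +
      ((eval p) g * (p 0 + p 1 + (p 0 + p 2) + (p 1 + p 2)) +
        ((p 0 + p 1) * (p 0 + p 2) + (p 1 + p 2) * (p 0 + p 2)) * (eval p) ((pderiv 0) g))) ∧
  (-(↑d * (↑(d - 1) * (p 0 + p 1 + p 2) ^ (d - 1 - 1))) =
    (p 0 + p 1) * (p 0 + p 2) * (p 1 + p 2) * (eval p) ((pderiv 0) ((pderiv 2) g)) +
        (eval p) ((pderiv 2) g) * ((p 1 + p 2) * (p 0 + p 1 + (p 0 + p 2))) +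
      ((eval p) g * (p 0 + p 1 + (p 0 + p 2) + (p 1 + p 2)) +
        ((p 0 + p 1) * (p 0 + p 2) + (p 1 + p 2) * (p 0 + p 1)) * (eval p) ((pderiv 0) g))) ∧
  (-(↑d * (↑(d - 1) * (p 0 + p 1 + p 2) ^ (d - 1 - 1))) =
    (p 0 + p 1) * (p 0 + p 2) * (p 1 + p 2) * (eval p) ((pderiv 1) ((pderiv 2) g)) +
        (eval p) ((pderiv 2) g) * ((p 0 + p 1) * (p 0 + p 2) + (p 1 + p 2) * (p 0 + p 2)) +
      ((eval p) g * (p 0 + p 2 + (p 1 + p 2 + (p 0 + p 1))) +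
        ((p 0 + p 1) * (p 0 + p 2) + (p 1 + p 2) * (p 0 + p 1)) * (eval p) ((pderiv 1) g))) := by
  have h0 := congrArg (fun q => eval p (pderiv 0 q)) hg
  have h1 := congrArg (fun q => eval p (pderiv 1 q)) hg
  have h2 := congrArg (fun q => eval p (pderiv 2 q)) hg
  have h01 := congrArg (fun q => eval p (pderiv 0 (pderiv 1 q))) hg
  have h02 := congrArg (fun q => eval p (pderiv 0 (pderiv 2 q))) hg
  have h12 := congrArg (fun q => eval p (pderiv 1 (pderiv 2 q))) hg
  simp [Derivation.leibniz, Derivation.leibniz_pow, pderiv_X] at h0 h1 h2 h01 h02 h12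
  exact ⟨h0, h1, h2, h01, h02, h12⟩

lemma line_iff (d : ℕ) (hd : 5 ≤ d) (a b v : ℂ) (hab : a ≠ 0 ∨ b ≠ 0)
    (h : (d : ℂ) * a ^ (d-1) - d * b ^ (d-1) = v * ((b - a) * (a + b)))
    (h1 : b = a → v ≠ 0) (h2 : b = -a → v ≠ 0) :
    v = 0 ↔ b ^ (d-1) = a ^ (d-1) ∧ b ≠ a ∧ b ≠ -a := by
  have hd0 : (d : ℂ) ≠ 0 := by exact_mod_cast (by omega : d ≠ 0)
  constructor
  · rintro rfl
    refine ⟨?_, fun h => h1 h rfl, fun h => h2 h rfl⟩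
    apply mul_left_cancel₀ hd0
    linear_combination -h
  · rintro ⟨e, n1, n2⟩
    rw [e, sub_self] at h
    rcases mul_eq_zero.1 h.symm with h | h
    · exact h
    · rcases mul_eq_zero.1 h with h | h
      · exact absurd (sub_eq_zero.1 h) n1
      · exact absurd (by linear_combination h) n2

/-- Let `d ≥ 5` be odd and `f = x^d + y^d + z^d - (x + y + z)^d`.  Then
`f = (x+y)(x+z)(y+z) g` where `g` is homogeneous of degree `d-3`, the curve `g = 0`
is smooth (hence `g` is irreducible), `g` does not vanish at `(1:1:-1)`, `(1:-1:1)`,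
`(-1:1:1)` nor at the vertices `(1:-1:0)`, `(1:0:-1)`, `(0:1:-1)` of the triangle, and
`g = 0` meets each of the lines `x+y = 0`, `x+z = 0`, `y+z = 0` in exactly `d-3`
distinct points. -/
theorem stmt12 (d : ℕ) (hd : 5 ≤ d) (hodd : Odd d)
    (f : MvPolynomial (Fin 3) ℂ)
    (hf : f = (X 0) ^ d + (X 1) ^ d + (X 2) ^ d - (X 0 + X 1 + X 2) ^ d) :
    ∃ g : MvPolynomial (Fin 3) ℂ,
      f = (X 0 + X 1) * (X 0 + X 2) * (X 1 + X 2) * g ∧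
      g.IsHomogeneous (d - 3) ∧
      (∀ p : Fin 3 → ℂ, eval p g = 0 → (∀ i, eval p (pderiv i g) = 0) → p = 0) ∧
      Irreducible g ∧
      eval ![1, 1, -1] g ≠ 0 ∧ eval ![1, -1, 1] g ≠ 0 ∧ eval ![-1, 1, 1] g ≠ 0 ∧
      eval ![1, -1, 0] g ≠ 0 ∧ eval ![1, 0, -1] g ≠ 0 ∧ eval ![0, 1, -1] g ≠ 0 ∧
      {x : Projectivization ℂ (Fin 2 → ℂ) |
        eval ![x.rep 0, -(x.rep 0), x.rep 1] g = 0}.ncard = d - 3 ∧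
      {x : Projectivization ℂ (Fin 2 → ℂ) |
        eval ![x.rep 0, x.rep 1, -(x.rep 0)] g = 0}.ncard = d - 3 ∧
      {x : Projectivization ℂ (Fin 2 → ℂ) |
        eval ![x.rep 1, x.rep 0, -(x.rep 0)] g = 0}.ncard = d - 3 := by
  obtain ⟨g, hg⟩ := factor d hd hodd
  have D := D1 d g hg
  have hd0 : (d : ℂ) ≠ 0 := by exact_mod_cast (by omega : d ≠ 0)
  have hd1 : ((d - 1 : ℕ) : ℂ) ≠ 0 := by exact_mod_cast (by omega : d - 1 ≠ 0)
  have heven : Even (d - 1) := by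
    obtain ⟨k, rfl⟩ := hodd; exact ⟨k, by omega⟩
  have hhom : g.IsHomogeneous (d - 3) := by
    apply homog_of_mul ((X 0 + X 1) * (X 0 + X 2) * (X 1 + X 2)) g 3 (d - 3)
    · exact (((isHomogeneous_X ℂ 0).add (isHomogeneous_X ℂ 1)).mul
        ((isHomogeneous_X ℂ 0).add (isHomogeneous_X ℂ 2))).mul
        ((isHomogeneous_X ℂ 1).add (isHomogeneous_X ℂ 2))
    · intro h
      have := congrArg (eval (fun _ => 1)) h
      norm_num at this
    · rw [← hg, show 3 + (d - 3) = d by omega]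
      have hs : ((X 0 + X 1 + X 2 : MvPolynomial (Fin 3) ℂ) ^ d).IsHomogeneous d := by
        have := (((isHomogeneous_X ℂ (0 : Fin 3)).add (isHomogeneous_X ℂ 1)).add
          (isHomogeneous_X ℂ 2)).pow d
        simpa using this
      exact (((isHomogeneous_X_pow 0 d).add (isHomogeneous_X_pow 1 d)).add
        (isHomogeneous_X_pow 2 d)).sub hs
  have V0 : ∀ t : ℂ, t ≠ 0 → eval ![-t, t, t] g ≠ 0 := by
    intro t ht h0
    obtain ⟨-, -, -, -, -, h⟩ := D ![-t, t, t]
    rw [h0] at h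
    simp [hd0, hd1, ht] at h
  have V1 : ∀ t : ℂ, t ≠ 0 → eval ![t, -t, t] g ≠ 0 := by
    intro t ht h0
    obtain ⟨-, -, -, -, h, -⟩ := D ![t, -t, t]
    rw [h0] at h
    simp [hd0, hd1, ht] at h
  have V2 : ∀ t : ℂ, t ≠ 0 → eval ![t, t, -t] g ≠ 0 := by
    intro t ht h0
    obtain ⟨-, -, -, h, -, -⟩ := D ![t, t, -t]
    rw [h0] at h
    simp [hd0, hd1, ht] at h
  have hsm : ∀ p : Fin 3 → ℂ, eval p g = 0 → (∀ i, eval p (pderiv i g) = 0) → p = 0 := by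
    intro p h0 hi
    obtain ⟨e0, e1, e2, e01, -, -⟩ := D p
    simp only [h0, hi, mul_zero, zero_mul, add_zero] at e0 e1 e2 e01
    have k0 : p 0 ^ (d-1) = (p 0 + p 1 + p 2) ^ (d-1) := 
      mul_left_cancel₀ hd0 (by linear_combination e0)
    have k1 : p 1 ^ (d-1) = (p 0 + p 1 + p 2) ^ (d-1) := 
      mul_left_cancel₀ hd0 (by linear_combination e1)
    have k2 : p 2 ^ (d-1) = (p 0 + p 1 + p 2) ^ (d-1) := 
      mul_left_cancel₀ hd0 (by linear_combination e2)
    rw [mod_aux (d-1) (by omega) _ _ _ k0 k1 k2, zero_mul, neg_eq_zero] at e01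
    have hs : p 0 + p 1 + p 2 = 0 := by
      have := (mul_eq_zero.1 ((mul_eq_zero.1 e01).resolve_left hd0)).resolve_left hd1
      exact (pow_eq_zero_iff (by omega)).1 this
    rw [hs, zero_pow (by omega)] at k0 k1 k2
    ext i
    fin_cases i
    · exact (pow_eq_zero_iff (by omega)).1 k0
    · exact (pow_eq_zero_iff (by omega)).1 k1
    · exact (pow_eq_zero_iff (by omega)).1 k2
  have L0 : ∀ a b : ℂ, (a ≠ 0 ∨ b ≠ 0) →
      (eval ![a, -a, b] g = 0 ↔ b ^ (d-1) = a ^ (d-1) ∧ b ≠ a ∧ b ≠ -a) := by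
    intro a b hab
    apply line_iff d hd a b _ hab
    · obtain ⟨h, -, -, -, -, -⟩ := D ![a, -a, b]
      simp at h
      linear_combination h
    · rintro rfl; exact V1 b (by simpa using hab)
    · rintro rfl
      have := V0 (-a) (by simpa using hab)
      rwa [neg_neg] at this
  have L1 : ∀ a b : ℂ, (a ≠ 0 ∨ b ≠ 0) →
      (eval ![a, b, -a] g = 0 ↔ b ^ (d-1) = a ^ (d-1) ∧ b ≠ a ∧ b ≠ -a) := by
    intro a b hab
    apply line_iff d hd a b _ hab
    · obtain ⟨h, -, -, -, -, -⟩ := D ![a, b, -a]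
      simp at h
      linear_combination h
    · rintro rfl; exact V2 b (by simpa using hab)
    · rintro rfl
      have := V0 (-a) (by simpa using hab)
      rwa [neg_neg] at this
  have L2 : ∀ a b : ℂ, (a ≠ 0 ∨ b ≠ 0) →
      (eval ![b, a, -a] g = 0 ↔ b ^ (d-1) = a ^ (d-1) ∧ b ≠ a ∧ b ≠ -a) := by
    intro a b hab
    apply line_iff d hd a b _ hab
    · obtain ⟨-, h, -, -, -, -⟩ := D ![b, a, -a]
      simp at h
      linear_combination h
    · rintro rfl; exact V2 b (by simpa using hab)
    · rintro rfl
      have := V1 (-a) (by simpa using hab)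
      rwa [neg_neg] at this
  have hg0 : g ≠ 0 := by
    rintro rfl
    exact V0 1 one_ne_zero (by simp)
  have hdd : d - 1 ≠ 0 := by omega
  refine ⟨g, hf.trans hg, hhom, hsm, irred g (d-3) (by omega) hhom hg0 hsm,
    V2 1 one_ne_zero, V1 1 one_ne_zero, V0 1 one_ne_zero, ?_, ?_, ?_,
    count d hd hodd (fun a b => eval ![a, -a, b] g) L0,
    count d hd hodd (fun a b => eval ![a, b, -a] g) L1,
    count d hd hodd (fun a b => eval ![b, a, -a] g) L2⟩
  · rw [Ne, L0 1 0 (by simp)]; simp [hdd]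
  · rw [Ne, L1 1 0 (by simp)]; simp [hdd]
  · rw [Ne, L2 1 0 (by simp)]; simp [hdd]
end

section
/- Let f be a binary form of degree d over ℂ with factorization f = f_1^{m_1} ⋯ f_s^{m_s}, where s ≥ 2, the linear forms f_i and f_j are non-proportional for i ≠ j, and all m_i ≥ 1. Let m = max_i m_i. Then the Waring rank of f is at least m+1. -/
open MvPolynomial

lemma coeff_aux (a b : ℂ) (d k : ℕ) :
    ((Polynomial.C a + Polynomial.C b * Polynomial.X) ^ d).coeff k
      = a ^ (d - k) * b ^ k * (d.choose k : ℂ) := by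
  have h : (Polynomial.C a + Polynomial.C b * Polynomial.X) ^ d
      = ((Polynomial.X + Polynomial.C a) ^ d).comp (Polynomial.C b * Polynomial.X) := by
    simp [add_comm]
  rw [h, Polynomial.comp_C_mul_X_coeff, Polynomial.coeff_X_add_C_pow]
  ring

lemma moment_aux (r M d : ℕ) (hMd : M < d) (hr : r ≤ M) (a b : Fin r → ℂ)
    (h0 : ∀ k < M, ∑ i, a i ^ (d - k) * b i ^ k = 0) :
    ∑ i, a i ^ (d - M) * b i ^ M = 0 := by
  have key : ∀ k ≤ M, ∀ i, a i ^ (d - k) * b i ^ k = a i ^ d * (b i / a i) ^ k := by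
    intro k hk i
    by_cases ha : a i = 0
    · rw [ha, zero_pow (by omega), zero_pow (by omega)]; simp
    · have : a i ^ d = a i ^ (d - k) * a i ^ k := by rw [← pow_add]; congr 1; omega
      rw [this, div_pow]
      field_simp
  let Q : Polynomial ℂ := Polynomial.X ^ (M - r) *
    ∏ i, (Polynomial.X - Polynomial.C (b i / a i))
  have hmon' : (∏ i, (Polynomial.X - Polynomial.C (b i / a i))).Monic :=
    Polynomial.monic_prod_of_monic _ _ fun i _ => Polynomial.monic_X_sub_C _
  have hmon : Q.Monic := (Polynomial.monic_X_pow _).mul hmon'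
  have hdeg : Q.natDegree = M := by
    rw [(Polynomial.monic_X_pow _).natDegree_mul hmon', Polynomial.natDegree_X_pow,
      Polynomial.natDegree_prod_of_monic _ _ fun i _ => Polynomial.monic_X_sub_C _]
    simp; omega
  have hev : ∀ i, Q.eval (b i / a i) = 0 := by
    intro i
    simp only [Q, Polynomial.eval_mul, Polynomial.eval_prod]
    rw [Finset.prod_eq_zero (Finset.mem_univ i) (by simp)]
    simp
  have h1 : ∑ i, a i ^ d * Q.eval (b i / a i) = 0 := by simp [hev]
  simp only [Polynomial.eval_eq_sum_range, hdeg, Finset.mul_sum] at h1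
  rw [Finset.sum_comm, Finset.sum_range_succ] at h1
  have hlead : Q.coeff M = 1 := by rw [← hdeg]; exact hmon
  rw [Finset.sum_eq_zero, zero_add] at h1
  · rw [← h1]
    refine Finset.sum_congr rfl fun i _ => ?_
    rw [key M le_rfl, hlead, one_mul]
  · intro k hk
    rw [Finset.mem_range] at hk
    have := h0 k hk
    simp only [key k hk.le] at this
    calc _ = Q.coeff k * ∑ i, a i ^ d * (b i / a i) ^ k := by
          rw [Finset.mul_sum]; exact Finset.sum_congr rfl fun i _ => by ring
      _ = 0 := by rw [this, mul_zero]

/-- Let `f` be a binary form of degree `d = ∑ m_i`, a product `f = f₁^{m₁} ⋯ f_s^{m_s}`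
of pairwise non-proportional nonzero linear forms, `s ≥ 2`, all `m_i ≥ 1`, and let
`m = max m_i`.  Then the Waring rank of `f` is at least `m + 1`: any decomposition of `f`
as a sum of `r` `d`-th powers of linear forms has `r ≥ m + 1`. -/
theorem stmt13 (s : ℕ) (hs : 2 ≤ s) (c : Fin s → Fin 2 → ℂ) (hc : ∀ i, c i ≠ 0)
    (hprop : ∀ i j, i ≠ j → ∀ t : ℂ, c i ≠ t • c j)
    (m : Fin s → ℕ) (hm : ∀ i, 1 ≤ m i) (d : ℕ) (hd : d = ∑ i, m i)
    (f : MvPolynomial (Fin 2) ℂ)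
    (hf : f = ∏ i, (C (c i 0) * X 0 + C (c i 1) * X 1) ^ (m i))
    (r : ℕ) (ℓ : Fin r → Fin 2 → ℂ)
    (hdec : f = ∑ i, (C (ℓ i 0) * X 0 + C (ℓ i 1) * X 1) ^ d) :
    Finset.univ.sup m + 1 ≤ r := by
  obtain ⟨p, -, hp⟩ := Finset.exists_mem_eq_sup (Finset.univ : Finset (Fin s))
    ⟨⟨0, by omega⟩, Finset.mem_univ _⟩ m
  rw [hp]
  by_contra hlt
  have hr : r ≤ m p := by omega
  have hsplit := Finset.add_sum_erase Finset.univ m (Finset.mem_univ p)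
  have hMd : m p < d := by
    haveI : Nontrivial (Fin s) := Fin.nontrivial_iff_two_le.2 hs
    obtain ⟨q, hq⟩ := exists_ne p
    have := Finset.single_le_sum (f := m) (fun i _ => Nat.zero_le _)
      (Finset.mem_erase.2 ⟨hq, Finset.mem_univ q⟩)
    have := hm q
    omega
  obtain ⟨w, hw⟩ : ∃ w : Fin 2 → ℂ, c p 0 * w 0 + c p 1 * w 1 ≠ 0 := by
    by_cases h : c p 0 = 0
    · refine ⟨![0, 1], ?_⟩
      have : c p 1 ≠ 0 := fun h1 => hc p (by ext j; fin_cases j <;> simp [h, h1])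
      simpa using this
    · exact ⟨![1, 0], by simpa using h⟩
  let v : Fin 2 → ℂ := ![c p 1, - c p 0]
  let φ : MvPolynomial (Fin 2) ℂ →ₐ[ℂ] Polynomial ℂ :=
    aeval fun j => Polynomial.C (v j) + Polynomial.C (w j) * Polynomial.X
  have hφ : ∀ e : Fin 2 → ℂ, φ (C (e 0) * X 0 + C (e 1) * X 1)
      = Polynomial.C (e 0 * v 0 + e 1 * v 1)
        + Polynomial.C (e 0 * w 0 + e 1 * w 1) * Polynomial.X := by
    intro e
    simp only [φ, map_add, map_mul, aeval_X, aeval_C, Polynomial.algebraMap_eq, ← MvPolynomial.algebraMap_eq,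
      AlgHom.commutes]
    ring
  have hv : ∀ i, i ≠ p → c i 0 * v 0 + c i 1 * v 1 ≠ 0 := by
    intro i hi h
    simp only [v, Matrix.cons_val_zero, Matrix.cons_val_one] at h
    by_cases h0 : c p 0 = 0
    · have h1 : c p 1 ≠ 0 := fun h1 => hc p (by ext j; fin_cases j <;> simp [h0, h1])
      apply hprop i p hi (c i 1 / c p 1)
      ext j
      fin_cases j
      · simp [h0] at h ⊢; tauto
      · simp; field_simp
    · apply hprop i p hi (c i 0 / c p 0)
      ext j
      fin_cases j
      · simp; field_simp
      · simp; field_simp; linear_combination -h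
  have hpv : c p 0 * v 0 + c p 1 * v 1 = 0 := by simp [v]; ring
  set g : Polynomial ℂ := Polynomial.C ((c p 0 * w 0 + c p 1 * w 1) ^ m p) *
    ∏ i ∈ Finset.univ.erase p, (Polynomial.C (c i 0 * v 0 + c i 1 * v 1)
        + Polynomial.C (c i 0 * w 0 + c i 1 * w 1) * Polynomial.X) ^ m i with hg
  have e1 : φ f = g * Polynomial.X ^ m p := by
    rw [hf, map_prod, ← Finset.mul_prod_erase _ _ (Finset.mem_univ p)]
    simp only [map_pow, hφ, hpv, hg, map_zero, zero_add, mul_pow]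
    ring
  have hg0 : g.coeff 0 ≠ 0 := by
    rw [Polynomial.coeff_zero_eq_eval_zero, hg]
    simp only [Polynomial.eval_mul, Polynomial.eval_prod, Polynomial.eval_pow,
      Polynomial.eval_add, Polynomial.eval_C, Polynomial.eval_X, mul_zero, add_zero]
    refine mul_ne_zero (pow_ne_zero _ hw) (Finset.prod_ne_zero_iff.2 fun i hi => ?_)
    exact pow_ne_zero _ (hv i (Finset.ne_of_mem_erase hi))
  have e2 : ∀ k, (φ f).coeff k = (∑ i, (ℓ i 0 * v 0 + ℓ i 1 * v 1) ^ (d - k) *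
      (ℓ i 0 * w 0 + ℓ i 1 * w 1) ^ k) * (d.choose k : ℂ) := by
    intro k
    rw [hdec, map_sum, Polynomial.finset_sum_coeff, Finset.sum_mul]
    refine Finset.sum_congr rfl fun i _ => ?_
    rw [map_pow, hφ, coeff_aux]
  have := moment_aux r (m p) d hMd hr (fun i => ℓ i 0 * v 0 + ℓ i 1 * v 1)
    (fun i => ℓ i 0 * w 0 + ℓ i 1 * w 1) (by
      intro k hk
      have h := e2 k
      rw [e1, Polynomial.coeff_mul_X_pow', if_neg (by omega)] at h
      refine (mul_eq_zero.1 h.symm).resolve_right ?_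
      exact_mod_cast (Nat.choose_pos (by omega)).ne')
  have h := e2 (m p)
  rw [this, zero_mul, e1, Polynomial.coeff_mul_X_pow', if_pos le_rfl, Nat.sub_self] at h
  exact hg0 h
end

section
/- Let d ≥ 3 and let a_1, a_2 be nonzero complex numbers. Then the binary form f = x^d + y^d + (a_1x + a_2y)^d has no linear factor of multiplicity ≥ 3; that is, there is no nonzero linear form ℓ in x, y with ℓ^3 dividing f. -/
open MvPolynomial

theorem aux_dvd_s14 (l g : MvPolynomial (Fin 2) ℂ) (p : Fin 2 → ℂ) (hl : eval p l = 0) (i j : Fin 2) :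
    eval p (pderiv i (pderiv j (l ^ 3 * g))) = 0 := by
  simp [Derivation.leibniz, Derivation.leibniz_pow, hl]

theorem aux_pow_s14 (l : MvPolynomial (Fin 2) ℂ) (p : Fin 2 → ℂ) (n : ℕ) (i j : Fin 2) (u v : ℂ)
    (hi : pderiv i l = C u) (hj : pderiv j l = C v) :
    eval p (pderiv i (pderiv j (l ^ (n + 3)))) = (n + 3) * (n + 2) * u * v * (eval p l) ^ (n + 1) := by
  have h3 : pderiv i (3 : MvPolynomial (Fin 2) ℂ) = 0 := by
    have := (pderiv (R := ℂ) i).map_natCast 3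
    exact_mod_cast this
  simp [Derivation.leibniz, Derivation.leibniz_pow, hi, hj, h3]
  ring

/-- For `d ≥ 3` and nonzero complex numbers `a₁`, `a₂`, the binary form
`f = x^d + y^d + (a₁ x + a₂ y)^d` has no linear factor of multiplicity `≥ 3`:
no cube of a nonzero linear form divides `f`. -/
theorem stmt14 (d : ℕ) (hd : 3 ≤ d) (a₁ a₂ : ℂ) (h₁ : a₁ ≠ 0) (h₂ : a₂ ≠ 0)
    (f : MvPolynomial (Fin 2) ℂ)
    (hf : f = (X 0) ^ d + (X 1) ^ d + (C a₁ * X 0 + C a₂ * X 1) ^ d) :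
    ¬ ∃ c : Fin 2 → ℂ, c ≠ 0 ∧ (C (c 0) * X 0 + C (c 1) * X 1) ^ 3 ∣ f := by
  rintro ⟨c, hc, g, hg⟩
  obtain ⟨n, rfl⟩ : ∃ n, d = n + 3 := ⟨d - 3, by omega⟩
  have hn3 : (n : ℂ) + 3 ≠ 0 := by exact_mod_cast (by omega : n + 3 ≠ 0)
  have hn2 : (n : ℂ) + 2 ≠ 0 := by exact_mod_cast (by omega : n + 2 ≠ 0)
  set p : Fin 2 → ℂ := ![c 1, - c 0] with hp
  have key : ∀ i j : Fin 2, eval p (pderiv i (pderiv j f)) = 0 := by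
    intro i j
    rw [hg]
    apply aux_dvd_s14
    simp [hp]
    ring
  have x0 : pderiv (0 : Fin 2) (X 0 : MvPolynomial (Fin 2) ℂ) = C 1 := by simp
  have x1 : pderiv (1 : Fin 2) (X 0 : MvPolynomial (Fin 2) ℂ) = C 0 := by
    simp [pderiv_X]
  have y0 : pderiv (0 : Fin 2) (X 1 : MvPolynomial (Fin 2) ℂ) = C 0 := by
    simp [pderiv_X]
  have y1 : pderiv (1 : Fin 2) (X 1 : MvPolynomial (Fin 2) ℂ) = C 1 := by simp
  have l0 : pderiv (0 : Fin 2) (C a₁ * X 0 + C a₂ * X 1 : MvPolynomial (Fin 2) ℂ) = C a₁ := by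
    simp [Derivation.leibniz, x0, y0]
  have l1 : pderiv (1 : Fin 2) (C a₁ * X 0 + C a₂ * X 1 : MvPolynomial (Fin 2) ℂ) = C a₂ := by
    simp [Derivation.leibniz, x1, y1]
  have k01 := key 0 1
  have k00 := key 0 0
  have k11 := key 1 1
  rw [hf] at k01 k00 k11
  simp only [map_add (pderiv _), map_add (eval p)] at k01 k00 k11
  rw [aux_pow_s14 _ p n 0 1 _ _ x0 x1, aux_pow_s14 _ p n 0 1 _ _ y0 y1, aux_pow_s14 _ p n 0 1 _ _ l0 l1] at k01
  rw [aux_pow_s14 _ p n 0 0 _ _ x0 x0, aux_pow_s14 _ p n 0 0 _ _ y0 y0, aux_pow_s14 _ p n 0 0 _ _ l0 l0] at k00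
  rw [aux_pow_s14 _ p n 1 1 _ _ x1 x1, aux_pow_s14 _ p n 1 1 _ _ y1 y1, aux_pow_s14 _ p n 1 1 _ _ l1 l1] at k11
  have hL : (eval p (C a₁ * X 0 + C a₂ * X 1)) ^ (n + 1) = 0 := by
    simpa only [mul_zero, zero_mul, zero_add, mul_eq_zero, hn3, hn2, h₁, h₂, false_or] using k01
  rw [hL] at k00 k11
  have e0 : c 1 = 0 := by simpa [hn3, hn2, hp] using k00
  have e1 : c 0 = 0 := by simpa [hn3, hn2, hp] using k11
  apply hc
  funext i
  fin_cases i
  · exact e1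
  · exact e0
end

section
/- Let r ≥ 4, d ≥ 3, and let f = ℓ_1^d + ⋯ + ℓ_{r−1}^d + z^d ∈ ℂ[x,y,z] be squarefree, where ℓ_1, …, ℓ_{r−1} are pairwise non-proportional nonzero linear forms in x and y only, and assume f has Waring rank exactly r. Set h(x,y) = ℓ_1^d + ⋯ + ℓ_{r−1}^d. Then: (i) every singular point of the curve V : f = 0 in ℙ² is of the form (x_0 : y_0 : 0) where the linear form y_0x − x_0y divides the binary form h with some multiplicity m satisfying 2 ≤ m ≤ r−2 (the corresponding singularity is of type v^m + w^d); in particular every linear factor of h has multiplicity at most r−2; and (ii) r ≤ d+1. -/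
open MvPolynomial

lemma aux_expand {n d : ℕ} (α β : Fin n → ℂ) (s t : ℂ) :
    ∑ i, (s * α i + t * β i) ^ d =
      ∑ k ∈ Finset.range (d + 1), (s ^ k * t ^ (d - k) * (d.choose k)) *
        ∑ i, α i ^ k * β i ^ (d - k) := by
  simp_rw [add_pow, Finset.mul_sum]
  rw [Finset.sum_comm]
  refine Finset.sum_congr rfl fun k _ => Finset.sum_congr rfl fun i _ => ?_
  rw [mul_pow, mul_pow]; ring

lemma aux_A {n d : ℕ} (hd : 1 ≤ d) (α β : Fin n → ℂ) (hA : ∑ i, α i ^ d ≠ 0)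
    (hB : ∑ i, β i ^ d ≠ 0) :
    ∃ a b : Fin d → ℂ, ∀ s t : ℂ,
      ∑ i, (s * α i + t * β i) ^ d = ∑ j, (s * a j + t * b j) ^ d := by
  have hd0 : d ≠ 0 := by omega
  obtain ⟨τ, hτ⟩ := IsAlgClosed.exists_pow_nat_eq ((∑ i, α i ^ d) / ∑ i, β i ^ d) (n := d) (by omega)
  have hτ0 : τ ≠ 0 := by
    rintro rfl
    rw [zero_pow hd0] at hτ
    exact div_ne_zero hA hB hτ.symm
  have hζ := Complex.isPrimitiveRoot_exp d hd0
  set ζ := Complex.exp (2 * Real.pi * Complex.I / d)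
  let ω : Fin d → ℂ := fun j => τ * ζ ^ (j : ℕ)
  have hω : Function.Injective ω := by
    intro i j hij
    have := mul_left_cancel₀ hτ0 hij
    exact Fin.ext (hζ.pow_inj i.2 j.2 this)
  have hωd : ∀ j, ω j ^ d = (∑ i, α i ^ d) / ∑ i, β i ^ d := by
    intro j
    simp only [ω]
    rw [mul_pow, hτ, ← pow_mul, mul_comm (j : ℕ), pow_mul, hζ.pow_eq_one, one_pow, mul_one]
  have hdet : (Matrix.vandermonde ω).det ≠ 0 := Matrix.det_vandermonde_ne_zero_iff.2 hω
  let μ : Fin d → ℂ := fun k => ∑ i, α i ^ (k : ℕ) * β i ^ (d - k)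
  obtain ⟨w, hw⟩ : ∃ w : Fin d → ℂ, Matrix.vecMul w (Matrix.vandermonde ω) = μ := by
    refine ⟨Matrix.vecMul μ (Matrix.vandermonde ω)⁻¹, ?_⟩
    rw [Matrix.vecMul_vecMul, Matrix.nonsing_inv_mul _ (isUnit_iff_ne_zero.2 hdet), Matrix.vecMul_one]
  have hw' : ∀ k, k < d → ∑ j, w j * ω j ^ k = ∑ i, α i ^ k * β i ^ (d - k) := by
    intro k hk
    have := congrFun hw ⟨k, hk⟩
    simpa [Matrix.vecMul, dotProduct, Matrix.vandermonde, μ] using this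
  choose κ hκ using fun j => IsAlgClosed.exists_pow_nat_eq (w j) (n := d) (by omega)
  refine ⟨fun j => κ j * ω j, κ, fun s t => ?_⟩
  rw [aux_expand, aux_expand]
  refine Finset.sum_congr rfl fun k hk => ?_
  congr 1
  have hk' : k ≤ d := by simpa [Nat.lt_succ_iff] using hk
  have h1 : ∀ j, (κ j * ω j) ^ k * κ j ^ (d - k) = w j * ω j ^ k := by
    intro j
    have h2 : κ j ^ k * κ j ^ (d - k) = w j := by
      rw [← pow_add, Nat.add_sub_cancel' hk', hκ j]
    rw [mul_pow, ← h2]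
    ring
  simp_rw [h1]
  rcases hk'.lt_or_eq with hlt | rfl
  · exact (hw' k hlt).symm
  · have h0 := hw' 0 (by omega)
    simp only [pow_zero, mul_one, one_mul, Nat.sub_zero] at h0
    simp_rw [hωd]
    rw [← Finset.sum_mul, h0, mul_div_cancel₀ _ hB]
    simp

lemma aux_rank {n d : ℕ} (hd : 1 ≤ d) (c : Fin n → Fin 2 → ℂ) :
    ∃ e : Fin d → Fin 2 → ℂ, ∀ x y : ℂ,
      ∑ i, (c i 0 * x + c i 1 * y) ^ d = ∑ j, (e j 0 * x + e j 1 * y) ^ d := by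
  by_cases h0 : ∀ x y : ℂ, ∑ i, (c i 0 * x + c i 1 * y) ^ d = 0
  · refine ⟨fun _ _ => 0, fun x y => ?_⟩
    rw [h0]; simp; right; omega
  push Not at h0
  obtain ⟨u0, u1, hu⟩ := h0
  -- a second vector
  obtain ⟨w0, w1, hdet⟩ : ∃ w0 w1 : ℂ, u0 * w1 - u1 * w0 ≠ 0 := by
    by_cases hu0 : u0 = 0
    · refine ⟨1, 0, ?_⟩
      have : u1 ≠ 0 := by
        rintro rfl
        apply hu
        simp [hu0]
        right; omega
      simpa
    · exact ⟨0, 1, by simpa⟩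
  obtain ⟨t, ht0, ht⟩ : ∃ t : ℂ, t ≠ 0 ∧
      ∑ i, (c i 0 * (u0 + t * w0) + c i 1 * (u1 + t * w1)) ^ d ≠ 0 := by
    by_contra hcon
    push Not at hcon
    let P : Polynomial ℂ := Polynomial.X * ∑ i, (Polynomial.C (c i 0) * (Polynomial.C u0 + Polynomial.X * Polynomial.C w0) + Polynomial.C (c i 1) * (Polynomial.C u1 + Polynomial.X * Polynomial.C w1)) ^ d
    have hP : P = 0 := by
      apply Polynomial.funext
      intro t
      by_cases ht : t = 0
      · simp [P, ht]
      · have := hcon t ht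
        simp only [P, Polynomial.eval_mul, Polynomial.eval_finsetSum, Polynomial.eval_pow, Polynomial.eval_add, Polynomial.eval_C, Polynomial.eval_X, this, mul_zero, Polynomial.eval_zero]
    have := (mul_eq_zero.1 hP).resolve_left Polynomial.X_ne_zero
    have := congrArg (Polynomial.eval 0) this
    simp [Polynomial.eval_finsetSum] at this
    exact hu this
  obtain ⟨a, b, hab⟩ := aux_A hd (fun i => c i 0 * u0 + c i 1 * u1)
    (fun i => c i 0 * (u0 + t * w0) + c i 1 * (u1 + t * w1)) hu ht
  set v0 := u0 + t * w0 with hv0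
  set v1 := u1 + t * w1 with hv1
  have hD : u0 * v1 - u1 * v0 ≠ 0 := by
    have : u0 * v1 - u1 * v0 = t * (u0 * w1 - u1 * w0) := by rw [hv0, hv1]; ring
    rw [this]; exact mul_ne_zero ht0 hdet
  set D := u0 * v1 - u1 * v0 with hDd
  refine ⟨fun j => ![(v1 * a j - u1 * b j) / D, (-v0 * a j + u0 * b j) / D], fun x y => ?_⟩
  have := hab ((v1 * x - v0 * y) / D) ((u0 * y - u1 * x) / D)
  convert this using 3
  · field_simp
    rw [hDd]; ring
  · simp
    field_simp
    ring

lemma aux_w (a b : ℂ) (h : ¬ (a = 0 ∧ b = 0)) : ∃ w0 w1 : ℂ, a * w0 + b * w1 = 1 := by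
  by_cases ha : a = 0
  · have hb : b ≠ 0 := fun hb => h ⟨ha, hb⟩
    exact ⟨0, b⁻¹, by simp [hb]⟩
  · exact ⟨a⁻¹, 0, by simp [ha]⟩

lemma aux_mult {n d : ℕ} (hn : 2 ≤ n) (hnd : n ≤ d) (c : Fin n → Fin 2 → ℂ) (hc : ∀ i, c i ≠ 0)
    (hprop : ∀ i j, i ≠ j → ∀ t : ℂ, c i ≠ t • c j) (c' : Fin 2 → ℂ) (hc' : c' ≠ 0) :
    ¬ (C (c' 0) * X 0 + C (c' 1) * X 1 : MvPolynomial (Fin 2) ℂ) ^ n ∣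
      ∑ i, (C (c i 0) * X 0 + C (c i 1) * X 1) ^ d := by
  intro hdvd
  obtain ⟨w0, w1, hw⟩ := aux_w (c' 0) (c' 1) (by
    rintro ⟨h0, h1⟩; apply hc'; ext i; fin_cases i <;> simp [h0, h1])
  let φ : MvPolynomial (Fin 2) ℂ →ₐ[ℂ] Polynomial ℂ :=
    aeval ![Polynomial.C (c' 1) + Polynomial.C w0 * Polynomial.X,
      -Polynomial.C (c' 0) + Polynomial.C w1 * Polynomial.X]
  let α : Fin n → ℂ := fun i => c i 0 * c' 1 - c i 1 * c' 0
  let β : Fin n → ℂ := fun i => c i 0 * w0 + c i 1 * w1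
  have hφ1 : φ (C (c' 0) * X 0 + C (c' 1) * X 1) = Polynomial.X := by
    have h1 : φ (C (c' 0) * X 0 + C (c' 1) * X 1) =
      Polynomial.C (c' 0 * w0 + c' 1 * w1) * Polynomial.X := by
      simp only [φ, map_add, map_mul, aeval_X, algHom_C]
      simp [Polynomial.algebraMap_eq]
      ring
    rw [h1, hw]; simp
  have hφ2 : ∀ i, φ (C (c i 0) * X 0 + C (c i 1) * X 1) =
      Polynomial.C (β i) * Polynomial.X + Polynomial.C (α i) := by
    intro i
    simp only [φ, α, β, map_add, map_mul, aeval_X, algHom_C]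
    simp [Polynomial.algebraMap_eq]
    ring
  have h2 := map_dvd φ hdvd
  rw [map_pow, hφ1, map_sum] at h2
  simp only [map_pow, hφ2] at h2
  rw [Polynomial.X_pow_dvd_iff] at h2
  have h3 : ∀ k < n, ∑ i, α i ^ (d - k) * β i ^ k = 0 := by
    intro k hk
    have := h2 k hk
    rw [Polynomial.finsetSum_coeff] at this
    have h4 : ∀ i, ((Polynomial.C (β i) * Polynomial.X + Polynomial.C (α i)) ^ d).coeff k =
        (d.choose k : ℂ) * (α i ^ (d - k) * β i ^ k) := by
      intro i
      rw [add_pow, Polynomial.finsetSum_coeff, Finset.sum_eq_single k]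
      · rw [mul_pow, ← Polynomial.C_pow, ← Polynomial.C_pow, ← Polynomial.C_eq_natCast]
        rw [Polynomial.coeff_mul_C, Polynomial.coeff_mul_C, Polynomial.coeff_C_mul_X_pow]
        simp; ring
      · intro b _ hb
        rw [mul_pow, ← Polynomial.C_pow, ← Polynomial.C_pow, ← Polynomial.C_eq_natCast]
        rw [Polynomial.coeff_mul_C, Polynomial.coeff_mul_C, Polynomial.coeff_C_mul_X_pow]
        simp [hb.symm]
      · intro h; simp at h; omega
    simp_rw [h4] at this
    rw [← Finset.mul_sum] at this
    exact (mul_eq_zero.1 this).resolve_left (by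
      exact_mod_cast (Nat.choose_pos (by omega)).ne')
  -- recover c from α, β
  have hrec0 : ∀ i, c i 0 = α i * w1 + β i * c' 0 := by
    intro i; simp only [α, β]; linear_combination (-c i 0) * hw
  have hrec1 : ∀ i, c i 1 = -α i * w0 + β i * c' 1 := by
    intro i; simp only [α, β]; linear_combination (-c i 1) * hw
  have hne : ∀ i j, i ≠ j → α i * β j - α j * β i ≠ 0 := by
    intro i j hij h0
    by_cases hb : β j = 0
    · have ha : α j ≠ 0 := by
        intro ha; apply hc j; ext k; fin_cases k <;> simp [hrec0, hrec1, ha, hb]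
      have hbi : β i = 0 := by
        rw [hb] at h0; simpa [ha] using h0
      apply hprop i j hij (α i / α j)
      ext k; fin_cases k
      · simp [hrec0, hb, hbi]; field_simp
      · simp [hrec1, hb, hbi]; field_simp
    · have hai : α i = β i / β j * α j := by field_simp; linear_combination h0
      apply hprop i j hij (β i / β j)
      ext k; fin_cases k
      · simp [hrec0, hai]; field_simp
      · simp [hrec1, hai]; field_simp
  have hdet : (Matrix.projVandermonde β α).det ≠ 0 := by
    rw [Matrix.det_projVandermonde]
    refine Finset.prod_ne_zero_iff.2 fun i _ => Finset.prod_ne_zero_iff.2 fun j hj => ?_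
    have := hne i j (Finset.mem_Ioi.1 hj).ne
    intro h; apply this; linear_combination h
  have hz : (fun i => α i ^ (d - (n - 1))) = 0 := by
    apply Matrix.eq_zero_of_vecMul_eq_zero hdet
    ext k
    have := h3 k k.2
    simp only [Matrix.vecMul, dotProduct, Matrix.projVandermonde_apply, Pi.zero_apply]
    rw [← this]
    refine Finset.sum_congr rfl fun i _ => ?_
    rw [Fin.val_rev]
    have hk : d - (k:ℕ) = (d - (n - 1)) + (n - (k + 1)) := by have := k.2; omega
    rw [hk, pow_add]; ring
  have hz' : ∀ i, α i = 0 := fun i => pow_eq_zero_iff (by omega) |>.1 (congrFun hz i)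
  apply hne ⟨0, by omega⟩ ⟨1, by omega⟩ (by simp)
  simp [hz']

lemma aux_sq_s15 {n d : ℕ} (c : Fin n → Fin 2 → ℂ) (q0 q1 : ℂ) (hq : ¬ (q1 = 0 ∧ -q0 = 0)) (hd : 1 ≤ d)
    (h0 : ∑ i, (c i 0 * q0 + c i 1 * q1) ^ (d - 1) * c i 0 = 0)
    (h1 : ∑ i, (c i 0 * q0 + c i 1 * q1) ^ (d - 1) * c i 1 = 0) :
    (C q1 * X 0 - C q0 * X 1 : MvPolynomial (Fin 2) ℂ) ^ 2 ∣
      ∑ i, (C (c i 0) * X 0 + C (c i 1) * X 1) ^ d := by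
  obtain ⟨w0, w1, hw⟩ := aux_w _ _ hq
  set L : MvPolynomial (Fin 2) ℂ := C q1 * X 0 - C q0 * X 1 with hL
  let M : MvPolynomial (Fin 2) ℂ := C w0 * X 1 - C w1 * X 0
  let α : Fin n → ℂ := fun i => c i 0 * q0 + c i 1 * q1
  let β : Fin n → ℂ := fun i => c i 0 * w0 + c i 1 * w1
  have hwC : (C q1 * C w0 - C q0 * C w1 : MvPolynomial (Fin 2) ℂ) = 1 := by
    rw [← C_1, ← hw]; simp; ring
  have hlin : ∀ i, (C (c i 0) * X 0 + C (c i 1) * X 1 : MvPolynomial (Fin 2) ℂ) =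
      C (α i) * M + C (β i) * L := by
    intro i
    simp only [α, β, M, hL, map_add, map_mul]
    linear_combination (-C (c i 0) * X 0 - C (c i 1) * X 1) * hwC
  have hex : ∀ i, ∃ k, (C (c i 0) * X 0 + C (c i 1) * X 1 : MvPolynomial (Fin 2) ℂ) ^ d =
      C (α i ^ d) * M ^ d + C (α i ^ (d - 1) * β i) * ((d : MvPolynomial (Fin 2) ℂ) * M ^ (d - 1) * L) + k * L ^ 2 := by
    intro i
    obtain ⟨k, hk⟩ := Polynomial.powAddExpansion (C (α i) * M) (C (β i) * L) d
    refine ⟨k * C (β i) ^ 2, ?_⟩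
    rw [hlin, hk]
    simp only [map_mul, map_pow]
    ring
  choose k hk using hex
  simp_rw [hk, Finset.sum_add_distrib, ← Finset.sum_mul, ← map_sum]
  have e1 : ∑ i, α i ^ d = 0 := by
    have : ∑ i, α i ^ d = q0 * ∑ i, α i ^ (d - 1) * c i 0 + q1 * ∑ i, α i ^ (d - 1) * c i 1 := by
      rw [Finset.mul_sum, Finset.mul_sum, ← Finset.sum_add_distrib]
      refine Finset.sum_congr rfl fun i _ => ?_
      conv_lhs => rw [← Nat.sub_add_cancel hd, pow_succ]
      simp only [α]; ring
    rw [this, h0, h1]; simp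
  have e2 : ∑ i, α i ^ (d - 1) * β i = 0 := by
    have : ∑ i, α i ^ (d - 1) * β i = w0 * ∑ i, α i ^ (d - 1) * c i 0 + w1 * ∑ i, α i ^ (d - 1) * c i 1 := by
      rw [Finset.mul_sum, Finset.mul_sum, ← Finset.sum_add_distrib]
      refine Finset.sum_congr rfl fun i _ => ?_
      simp only [β]; ring
    rw [this, h0, h1]; simp
  rw [e1, e2]
  simp

/-- Let `r ≥ 4`, `d ≥ 3`, and `f = ℓ₁^d + ⋯ + ℓ_{r-1}^d + z^d` squarefree, where the
`ℓ_i` are pairwise non-proportional nonzero linear forms in `x`, `y` only, and assume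
`f` has Waring rank exactly `r`.  Set `h = ℓ₁^d + ⋯ + ℓ_{r-1}^d`.  Then (i) every
singular point of the curve `f = 0` has the form `(x₀ : y₀ : 0)` where the linear form
`y₀ x - x₀ y` divides `h` with multiplicity `m`, `2 ≤ m ≤ r - 2` (singularity of type
`v^m + w^d`); in particular every linear factor of `h` has multiplicity at most `r - 2`;
and (ii) `r ≤ d + 1`. -/
theorem stmt15 (r d : ℕ) (hr : 4 ≤ r) (hd : 3 ≤ d)
    (c : Fin (r - 1) → Fin 2 → ℂ) (hc : ∀ i, c i ≠ 0)
    (hprop : ∀ i j, i ≠ j → ∀ t : ℂ, c i ≠ t • c j)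
    (f : MvPolynomial (Fin 3) ℂ)
    (hf : f = (∑ i, (C (c i 0) * X 0 + C (c i 1) * X 1) ^ d) + (X 2) ^ d)
    (hsf : Squarefree f)
    (hrank : IsLeast {s : ℕ | ∃ ℓ : Fin s → Fin 3 → ℂ,
      f = ∑ i, (C (ℓ i 0) * X 0 + C (ℓ i 1) * X 1 + C (ℓ i 2) * X 2) ^ d} r)
    (h : MvPolynomial (Fin 2) ℂ)
    (hh : h = ∑ i, (C (c i 0) * X 0 + C (c i 1) * X 1) ^ d) :
    (∀ p : Fin 3 → ℂ, p ≠ 0 → (∀ i, eval p (pderiv i f) = 0) →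
      p 2 = 0 ∧ ∃ m : ℕ, 2 ≤ m ∧ m ≤ r - 2 ∧
        (C (p 1) * X 0 - C (p 0) * X 1) ^ m ∣ h ∧
        ¬ (C (p 1) * X 0 - C (p 0) * X 1) ^ (m + 1) ∣ h) ∧
    (∀ c' : Fin 2 → ℂ, c' ≠ 0 →
      ¬ (C (c' 0) * X 0 + C (c' 1) * X 1) ^ (r - 1) ∣ h) ∧
    r ≤ d + 1 := by
  have hd1 : 1 ≤ d := by omega
  have hrd : r ≤ d + 1 := by
    apply hrank.2
    obtain ⟨e, he⟩ := aux_rank hd1 c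
    refine ⟨Fin.cons ![0, 0, 1] (fun j => ![e j 0, e j 1, 0]), ?_⟩
    apply MvPolynomial.funext
    intro x
    rw [hf, Fin.sum_univ_succ]
    simp [he]
    ring
  have hm : ∀ c' : Fin 2 → ℂ, c' ≠ 0 →
      ¬ (C (c' 0) * X 0 + C (c' 1) * X 1) ^ (r - 1) ∣ h := by
    intro c' hc'
    rw [hh]
    exact aux_mult (by omega) (by omega) c hc hprop c' hc'
  refine ⟨?_, hm, hrd⟩
  intro p hp hs
  have hs2 := hs 2
  have hs0 := hs 0
  have hs1 := hs 1
  have hp2 : p 2 = 0 := by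
    rw [hf] at hs2
    simp [pderiv_pow, pderiv_X, Pi.single_apply] at hs2
    rcases hs2 with h | h
    · omega
    · exact h.1
  have hdC : (d : ℂ) ≠ 0 := by exact_mod_cast (by omega : d ≠ 0)
  have e0 : ∑ i, (c i 0 * p 0 + c i 1 * p 1) ^ (d - 1) * c i 0 = 0 := by
    rw [hf] at hs0
    simp [pderiv_pow, pderiv_X, Pi.single_apply, mul_assoc, ← Finset.mul_sum] at hs0
    exact hs0.resolve_left (by omega)
  have e1 : ∑ i, (c i 0 * p 0 + c i 1 * p 1) ^ (d - 1) * c i 1 = 0 := by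
    rw [hf] at hs1
    simp [pderiv_pow, pderiv_X, Pi.single_apply, mul_assoc, ← Finset.mul_sum] at hs1
    exact hs1.resolve_left (by omega)
  have hq : ¬ (p 1 = 0 ∧ -p 0 = 0) := by
    rintro ⟨h1, h0⟩
    apply hp
    ext i
    fin_cases i
    · simpa using h0
    · simpa using h1
    · simpa using hp2
  have hsq := aux_sq_s15 c (p 0) (p 1) hq hd1 e0 e1
  rw [← hh] at hsq
  have hn : ¬ (C (p 1) * X 0 - C (p 0) * X 1) ^ (r - 1) ∣ h := by
    have := hm ![p 1, -p 0] (by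
      intro h0
      exact hq ⟨congrFun h0 0, congrFun h0 1⟩)
    simpa [sub_eq_add_neg] using this
  refine ⟨hp2, ?_⟩
  classical
  have hex : ∃ k, ¬ (C (p 1) * X 0 - C (p 0) * X 1) ^ k ∣ h := ⟨_, hn⟩
  have hle := Nat.find_min' hex hn
  have hspec := Nat.find_spec hex
  have hmin := fun {m} => Nat.find_min hex (m := m)
  set N := Nat.find hex
  have hN : 2 < N := by
    by_contra hcon
    exact hspec ((pow_dvd_pow _ (by omega)).trans hsq)
  refine ⟨N - 1, by omega, by omega, ?_, ?_⟩
  · exact not_not.1 (hmin (by omega))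
  · rwa [Nat.sub_add_cancel (by omega)]
end
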